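/- Let 2 ≤ k ≤ 650 and suppose nonnegative integers n ≥ m ≥ l ≥ 0 with n ≥ k + 1 and n > 25, d ≥ 2 and 1 ≤ a ≤ 9 satisfy L_n^{(k)} · L_m^{(k)} · L_l^{(k)} = a·(10^d − 1)/9. Then m ≤ 606; moreover, if 3 ≤ k ≤ 650 then m ≤ 300. -/

import Mathlib

/-- The `k`-generalized Lucas sequence: `L 0 = 2`, `L 1 = 1`, and for `n ≥ 2`,
`L n = L (n-1) + L (n-2) + ⋯ + L (n-k)`, where terms with negative index count as `0`. -/
def lucasK (k : ℕ) : ℕ → ℕ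
  | 0 => 2
  | 1 => 1
  | n + 2 => ∑ j ∈ Finset.range k, if _ : j ≤ n + 1 then lucasK k (n + 1 - j) else 0
termination_by n => n
decreasing_by omega

noncomputable def bkDD (f : ℂ → ℂ) (ρ : ℝ) (m : Multiset ℕ) : ℂ :=
  (2 * Real.pi * Complex.I)⁻¹ * ∮ ζ in C(0, ρ), f ζ * (m.map fun z : ℕ => (ζ - (z : ℂ))⁻¹).prod

lemma bk_sub_ne {ρ : ℝ} {z : ℕ} (hz : (z : ℝ) < ρ) {ζ : ℂ} (hζ : ζ ∈ Metric.sphere (0 : ℂ) ρ) :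
    ζ - (z : ℂ) ≠ 0 := by
  intro h
  have h1 : ζ = z := sub_eq_zero.mp h
  have h2 : ‖ζ‖ = ρ := by simpa using hζ
  rw [h1] at h2
  simp at h2
  linarith

lemma bk_contOn {f : ℂ → ℂ} (hf : Continuous f) {ρ : ℝ} {m : Multiset ℕ}
    (hm : ∀ z ∈ m, (z : ℝ) < ρ) :
    ContinuousOn (fun ζ : ℂ => f ζ * (m.map fun z : ℕ => (ζ - (z : ℂ))⁻¹).prod)
      (Metric.sphere (0 : ℂ) ρ) := by
  refine hf.continuousOn.mul ?_
  induction m using Multiset.induction_on with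
  | empty => simpa using continuousOn_const
  | cons a s ih =>
    simp only [Multiset.map_cons, Multiset.prod_cons]
    refine ContinuousOn.mul ?_ (ih fun z hz => hm z (Multiset.mem_cons_of_mem hz))
    refine ContinuousOn.inv₀ (by fun_prop) ?_
    intro ζ hζ
    exact bk_sub_ne (hm a (Multiset.mem_cons_self a s)) hζ

lemma bk_int {f : ℂ → ℂ} (hf : Continuous f) {ρ : ℝ} (hρ : 0 ≤ ρ) {m : Multiset ℕ}
    (hm : ∀ z ∈ m, (z : ℝ) < ρ) :
    CircleIntegrable (fun ζ : ℂ => f ζ * (m.map fun z : ℕ => (ζ - (z : ℂ))⁻¹).prod) 0 ρ :=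
  (bk_contOn hf hm).circleIntegrable hρ

lemma bk_rec {f : ℂ → ℂ} (hf : Continuous f) {ρ : ℝ} (hρ : 0 ≤ ρ) {m : Multiset ℕ} {a b : ℕ}
    (ha : (a : ℝ) < ρ) (hb : (b : ℝ) < ρ) (hm : ∀ z ∈ m, (z : ℝ) < ρ) :
    ((a : ℂ) - b) * bkDD f ρ (a ::ₘ b ::ₘ m) = bkDD f ρ (a ::ₘ m) - bkDD f ρ (b ::ₘ m) := by
  have h1 : ∀ z ∈ a ::ₘ m, (z : ℝ) < ρ := by
    intro z hz
    rcases Multiset.mem_cons.1 hz with rfl | h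
    · exact ha
    · exact hm z h
  have h2 : ∀ z ∈ b ::ₘ m, (z : ℝ) < ρ := by
    intro z hz
    rcases Multiset.mem_cons.1 hz with rfl | h
    · exact hb
    · exact hm z h
  unfold bkDD
  rw [← mul_sub, ← circleIntegral.integral_sub (bk_int hf hρ h1) (bk_int hf hρ h2),
    mul_left_comm, ← smul_eq_mul ((a : ℂ) - b), ← circleIntegral.integral_smul]
  congr 1
  refine circleIntegral.integral_congr hρ ?_
  intro ζ hζ
  have e1 := bk_sub_ne ha hζ
  have e2 := bk_sub_ne hb hζ
  simp only [Multiset.map_cons, Multiset.prod_cons, smul_eq_mul]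
  field_simp
  ring

lemma bk_single {f : ℂ → ℂ} (hf : Differentiable ℂ f) {ρ : ℝ} {a : ℕ}
    (ha : (a : ℝ) < ρ) : bkDD f ρ {a} = f a := by
  have h := (hf.diffContOnCl (s := Metric.ball (0:ℂ) ρ)).two_pi_i_inv_smul_circleIntegral_sub_inv_smul
    (w := (a : ℂ)) (by simpa using ha)
  unfold bkDD
  rw [← h]
  simp [mul_comm]

lemma bk_repl {F : ℕ → ℂ → ℂ} (hF : ∀ t z, HasDerivAt (F t) (F (t+1) z) z) {ρ : ℝ} {a : ℕ}
    (ha : (a : ℝ) < ρ) (t : ℕ) : ∀ u, (t.factorial : ℂ) * bkDD (F u) ρ (Multiset.replicate (t+1) a) = F (u+t) a := by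
  have hρ : 0 ≤ ρ := le_trans (Nat.cast_nonneg a) ha.le
  induction t with
  | zero =>
    intro u
    have hd : Differentiable ℂ (F u) := fun z => (hF u z).differentiableAt
    simpa using bk_single hd ha
  | succ t ih =>
    intro u
    have h0 : (∮ ζ in C(0, ρ), (F (u+1) ζ * (ζ - a)⁻¹^(t+1) - (t+1) * (F u ζ * (ζ - a)⁻¹^(t+2)))) = 0 := by
      refine circleIntegral.integral_eq_zero_of_hasDerivWithinAt hρ
        (f := fun ζ => F u ζ * (ζ - a)⁻¹^(t+1)) ?_
      intro ζ hζ
      have e1 := bk_sub_ne ha hζ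
      have h1 : HasDerivAt (fun ζ : ℂ => (ζ - (a:ℂ))⁻¹) (-((ζ - a)⁻¹^2)) ζ := by
        have := ((hasDerivAt_id ζ).sub_const (a:ℂ)).inv e1
        refine this.congr_deriv ?_
        simp only [id]
        rw [div_eq_mul_inv, inv_pow]; ring
      have h2 := ((hF u ζ).mul (h1.pow (t+1))).hasDerivWithinAt (s := Metric.sphere (0:ℂ) ρ)
      refine h2.congr_deriv ?_
      simp only [Pi.pow_apply, Nat.add_sub_cancel]
      push_cast
      ring
    have c1 : Continuous (F (u+1)) := continuous_iff_continuousAt.2 fun z => (hF (u+1) z).continuousAt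
    have c0 : Continuous (F u) := continuous_iff_continuousAt.2 fun z => (hF u z).continuousAt
    have m1 : ∀ n : ℕ, ∀ z ∈ Multiset.replicate n a, (z : ℝ) < ρ := by
      intro n z hz
      rw [Multiset.eq_of_mem_replicate hz]; exact ha
    have i1 := bk_int c1 hρ (m1 (t+1))
    have i2 := bk_int c0 hρ (m1 (t+2))
    simp only [Multiset.map_replicate, Multiset.prod_replicate] at i1 i2
    have i3 : CircleIntegrable (fun ζ => ((t:ℂ)+1) * (F u ζ * (ζ - a)⁻¹^(t+2))) 0 ρ := by
      have := i2.const_smul (a := ((t:ℂ)+1))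
      exact this
    rw [circleIntegral.integral_sub i1 i3] at h0
    have h3 := ih (u+1)
    rw [show u + (t+1) = u + 1 + t by ring, ← h3]
    unfold bkDD
    simp only [Multiset.map_replicate, Multiset.prod_replicate]
    have h4 : (∮ ζ in C(0, ρ), ((t:ℂ)+1) * (F u ζ * (ζ - a)⁻¹^(t+2))) = ((t:ℂ)+1) * ∮ ζ in C(0, ρ), (F u ζ * (ζ - a)⁻¹^(t+2)) := by
      simpa using circleIntegral.integral_smul ((t:ℂ)+1) (fun ζ => (F u ζ * (ζ - a)⁻¹^(t+2))) 0 ρ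
    rw [h4] at h0
    rw [sub_eq_zero.1 h0, Nat.factorial_succ]
    push_cast
    ring

lemma bk_DD_small {F : ℕ → ℂ → ℂ} (hF : ∀ t z, HasDerivAt (F t) (F (t+1) z) z) {ρ η : ℝ}
    {T S : ℕ} (hη : 0 ≤ η) (hS : (S : ℝ) ≤ ρ) (hsm : ∀ t < T, ∀ s < S, ‖F t (s : ℂ)‖ ≤ η) (c : ℕ) :
    ∀ m : Multiset ℕ, m.card = c + 1 → (∀ z ∈ m, z < S) → (∀ z, m.count z ≤ T) →
      ‖bkDD (F 0) ρ m‖ ≤ 2^c * η := by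
  have c0 : Continuous (F 0) := continuous_iff_continuousAt.2 fun z => (hF 0 z).continuousAt
  have lt : ∀ z : ℕ, z < S → (z:ℝ) < ρ := fun z hz => lt_of_lt_of_le (by exact_mod_cast hz) hS
  induction c with
  | zero =>
    intro m hc hz ht
    obtain ⟨a, rfl⟩ := Multiset.card_eq_one.1 hc
    have ha : a < S := hz a (by simp)
    rw [bk_single (fun z => (hF 0 z).differentiableAt) (lt a ha)]
    have : 1 ≤ T := by have := ht a; simpa using this
    simpa using hsm 0 this a ha
  | succ c ih =>
    intro m hc hz ht
    by_cases hall : ∃ a, m = Multiset.replicate (c+1+1) a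
    · obtain ⟨a, rfl⟩ := hall
      have ha : a < S := hz a (by simp)
      have h1 := bk_repl hF (lt a ha) (c+1) 0
      have hT : c + 1 < T := by have := ht a; simp at this; omega
      have h2 := hsm (c+1) hT a ha
      rw [zero_add] at h1
      rw [← h1, norm_mul] at h2
      have h3 : (1:ℝ) ≤ ‖((c+1).factorial : ℂ)‖ := by
        simp only [Complex.norm_natCast]
        exact_mod_cast Nat.succ_le_of_lt (Nat.factorial_pos _)
      have h4 : (1:ℝ) ≤ 2^(c+1) := one_le_pow₀ (by norm_num)
      nlinarith [norm_nonneg (bkDD (F 0) ρ (Multiset.replicate (c+1+1) a))]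
    · have : ∃ a b, ∃ m', a ≠ b ∧ m = a ::ₘ b ::ₘ m' := by
        obtain ⟨a, ha⟩ := Multiset.card_pos_iff_exists_mem.1 (by omega : 0 < m.card)
        have : ∃ b ∈ m, b ≠ a := by
          by_contra hcon
          push Not at hcon
          exact hall ⟨a, by rw [← hc]; exact Multiset.eq_replicate_card.2 hcon⟩
        obtain ⟨b, hb, hba⟩ := this
        obtain ⟨m1, rfl⟩ := Multiset.exists_cons_of_mem ha
        have hb1 : b ∈ m1 := by simpa [hba] using hb
        obtain ⟨m2, rfl⟩ := Multiset.exists_cons_of_mem hb1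
        exact ⟨a, b, m2, hba.symm, rfl⟩
      obtain ⟨a, b, m', hab, rfl⟩ := this
      have ha : a < S := hz a (by simp)
      have hb : b < S := hz b (by simp)
      have hm' : ∀ z ∈ m', z < S := fun z h => hz z (by simp [h])
      have hρ : 0 ≤ ρ := le_trans (Nat.cast_nonneg _) hS
      have hr := bk_rec c0 hρ (lt a ha) (lt b hb) (fun z h => lt z (hm' z h))
      have i1 := ih (a ::ₘ m') (by simpa using hc)
        (by intro z h; rcases Multiset.mem_cons.1 h with rfl | h; exacts [ha, hm' z h])
        (by intro z; refine le_trans ?_ (ht z); rw [Multiset.cons_swap]; exact Multiset.count_le_count_cons _ _ _)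
      have i2 := ih (b ::ₘ m') (by simpa using hc)
        (by intro z h; rcases Multiset.mem_cons.1 h with rfl | h; exacts [hb, hm' z h])
        (by intro z; refine le_trans ?_ (ht z); exact Multiset.count_le_count_cons _ _ _)
      have h5 : (1:ℝ) ≤ ‖(a:ℂ) - b‖ := by
        have : ((a:ℂ) - b) = ((a - b : ℤ) : ℂ) := by push_cast; ring
        rw [this, Complex.norm_intCast]
        have : (1:ℤ) ≤ |(a:ℤ) - b| := Int.one_le_abs (by omega)
        exact_mod_cast this
      have h6 : ‖(a:ℂ) - b‖ * ‖bkDD (F 0) ρ (a ::ₘ b ::ₘ m')‖ ≤ 2^c*η + 2^c*η := by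
        rw [← norm_mul, hr]
        exact (norm_sub_le _ _).trans (add_le_add i1 i2)
      rw [pow_succ]
      nlinarith [norm_nonneg (bkDD (F 0) ρ (a ::ₘ b ::ₘ m'))]

lemma bk_bound {f : ℂ → ℂ} {ρ X A : ℝ} (hX : 0 ≤ X) (hXρ : X < ρ) (hA : ∀ ζ : ℂ, ‖ζ‖ = ρ → ‖f ζ‖ ≤ A)
    (m : Multiset ℕ) (hm : ∀ z ∈ m, (z : ℝ) ≤ X) :
    ‖bkDD f ρ m‖ ≤ ρ * (A * (1/(ρ - X))^m.card) := by
  have hρ : 0 ≤ ρ := by linarith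
  have h1 : ∀ ζ ∈ Metric.sphere (0:ℂ) ρ, ‖f ζ * (m.map fun z : ℕ => (ζ - (z : ℂ))⁻¹).prod‖ ≤ A * (1/(ρ - X))^m.card := by
    intro ζ hζ
    have hn : ‖ζ‖ = ρ := by simpa using hζ
    rw [norm_mul]
    have hA0 : 0 ≤ A := le_trans (norm_nonneg _) (hA ζ hn)
    refine mul_le_mul (hA ζ hn) ?_ (norm_nonneg _) hA0
    clear hA
    induction m using Multiset.induction_on with
    | empty => simp
    | cons a s ih =>
      simp only [Multiset.map_cons, Multiset.prod_cons, Multiset.card_cons, norm_mul, pow_succ']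
      have ha := hm a (Multiset.mem_cons_self a s)
      refine mul_le_mul ?_ (ih fun z hz => hm z (Multiset.mem_cons_of_mem hz)) (norm_nonneg _) (by have : 0 < ρ - X := by linarith
                                                                                                   positivity)
      rw [norm_inv, one_div]
      refine inv_anti₀ (by linarith) ?_
      have := norm_sub_norm_le ζ (a:ℂ)
      rw [hn, Complex.norm_natCast] at this
      linarith
  unfold bkDD
  have h2 := circleIntegral.norm_two_pi_i_inv_smul_integral_le_of_norm_le_const hρ h1
  simpa [smul_eq_mul] using h2

theorem bk_interp {F : ℕ → ℂ → ℂ} (hF : ∀ t z, HasDerivAt (F t) (F (t+1) z) z) {X η A E : ℝ}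
    {T S x : ℕ} (hη : 0 ≤ η) (hX1 : 1 ≤ X) (hSX : (S : ℝ) ≤ X) (hx : (x:ℝ) ≤ X) (hE : 2 ≤ E)
    (hsm : ∀ t < T, ∀ s < S, ‖F t (s : ℂ)‖ ≤ η)
    (hA : ∀ ζ : ℂ, ‖ζ‖ = E * X → ‖F 0 ζ‖ ≤ A) :
    ‖F 0 (x:ℂ)‖ ≤ η * (2*X+1)^(T*S) + 2 * A / (E-1)^(T*S) := by
  have c0 : Continuous (F 0) := continuous_iff_continuousAt.2 fun z => (hF 0 z).continuousAt
  have hρ : X < E * X := by nlinarith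
  have hρ0 : 0 ≤ E * X := by nlinarith
  have lt : ∀ z : ℕ, z < S → (z:ℝ) < E*X := fun z hz => by
    have : (z:ℝ) < S := by exact_mod_cast hz
    linarith
  have key : ∀ m : Multiset ℕ, (∀ z ∈ m, z < S) → (∀ z, m.count z ≤ T) →
      ‖F 0 (x:ℂ)‖ ≤ η * (2*X+1)^m.card + X^m.card * ‖bkDD (F 0) (E*X) (x ::ₘ m)‖ := by
    intro m
    induction m using Multiset.induction_on with
    | empty =>
      intro _ _
      have := bk_single (fun z => (hF 0 z).differentiableAt) (lt_of_le_of_lt hx hρ)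
      simp only [Multiset.cons_zero] at *
      rw [this]; simp; exact hη
    | cons a s ih =>
      intro hz ht
      have ha : a < S := hz a (Multiset.mem_cons_self a s)
      have hs : ∀ z ∈ s, z < S := fun z h => hz z (Multiset.mem_cons_of_mem h)
      have h1 := ih hs (fun z => (Multiset.count_le_count_cons _ _ _).trans (ht z))
      have h2 := bk_DD_small hF hη (by linarith : (S:ℝ) ≤ E*X) hsm s.card (a ::ₘ s) (by simp) hz ht
      have h3 := bk_rec c0 hρ0 (lt_of_le_of_lt hx hρ) (lt a ha) (fun z h => lt z (hs z h))
      have h4 : ‖bkDD (F 0) (E*X) (x ::ₘ s)‖ ≤ 2^s.card * η + X * ‖bkDD (F 0) (E*X) (x ::ₘ a ::ₘ s)‖ := by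
        have : bkDD (F 0) (E*X) (x ::ₘ s) = bkDD (F 0) (E*X) (a ::ₘ s) + ((x:ℂ) - a) * bkDD (F 0) (E*X) (x ::ₘ a ::ₘ s) := by
          rw [h3]; ring
        rw [this]
        refine (norm_add_le _ _).trans (add_le_add h2 ?_)
        rw [norm_mul]
        refine mul_le_mul_of_nonneg_right ?_ (norm_nonneg _)
        have : ((x:ℂ) - a) = (((x:ℝ) - a : ℝ) : ℂ) := by push_cast; ring
        rw [this, Complex.norm_real, Real.norm_eq_abs, abs_le]
        have h5 : (a:ℝ) < S := by exact_mod_cast ha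
        have h6 : (0:ℝ) ≤ a := Nat.cast_nonneg a
        have h7 : (0:ℝ) ≤ x := Nat.cast_nonneg x
        constructor <;> linarith
      have h5 : X^s.card * ‖bkDD (F 0) (E*X) (x ::ₘ s)‖ ≤ X^s.card * (2^s.card * η + X * ‖bkDD (F 0) (E*X) (x ::ₘ a ::ₘ s)‖) :=
        mul_le_mul_of_nonneg_left h4 (by positivity)
      have h6 : X^s.card * 2^s.card ≤ (2*X+1)^s.card := by
        rw [← mul_pow]
        exact pow_le_pow_left₀ (by positivity) (by linarith) _
      simp only [Multiset.card_cons, pow_succ]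
      have h7 : (0:ℝ) ≤ (2*X+1)^s.card := by positivity
      have h8 : X^s.card * 2^s.card * η ≤ (2*X+1)^s.card * η := mul_le_mul_of_nonneg_right h6 hη
      have h9 : η * (2*X+1)^s.card * 2 ≤ η * (2*X+1)^s.card * (2*X+1) :=
        mul_le_mul_of_nonneg_left (by linarith) (by positivity)
      nlinarith
  let m : Multiset ℕ := T • Multiset.range S
  have hm1 : ∀ z ∈ m, z < S := by
    intro z hz
    have := Multiset.mem_of_mem_nsmul hz
    simpa using this
  have hm2 : ∀ z, m.count z ≤ T := by
    intro z
    simp only [m, Multiset.count_nsmul]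
    have := Multiset.nodup_iff_count_le_one.1 (Multiset.nodup_range S) z
    nlinarith
  have hm3 : m.card = T * S := by simp [m]
  have h1 := key m hm1 hm2
  have h2 := bk_bound (by linarith : 0 ≤ X) hρ hA (x ::ₘ m) (by
    intro z hz
    rcases Multiset.mem_cons.1 hz with rfl | h
    · exact hx
    · have : (z:ℝ) < S := by exact_mod_cast hm1 z h
      linarith)
  rw [hm3] at h1
  rw [Multiset.card_cons, hm3] at h2
  have hA0 : 0 ≤ A := le_trans (norm_nonneg _) (hA ((E*X : ℝ) : ℂ) (by
    rw [Complex.norm_real, Real.norm_eq_abs, abs_of_nonneg hρ0]))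
  refine h1.trans (add_le_add le_rfl ?_)
  refine (mul_le_mul_of_nonneg_left h2 (by positivity)).trans ?_
  have hE1 : 0 < E - 1 := by linarith
  have hX0 : 0 < X := by linarith
  have e1 : E * X - X = (E-1) * X := by ring
  rw [e1, one_div, inv_pow, mul_pow, pow_succ, pow_succ]
  have : X ^ (T*S) * (E * X * (A * ((E-1)^(T*S) * (E-1) * (X^(T*S) * X))⁻¹)) = (E/(E-1)) * (A / (E-1)^(T*S)) := by
    field_simp
  rw [this, mul_div_assoc]
  refine mul_le_mul_of_nonneg_right ?_ (by positivity)
  rw [div_le_iff₀ hE1]; linarith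

/-- pigeonhole for real linear forms -/
lemma bk_pigeon {ι κ : Type*} [Fintype ι] [Fintype κ] [DecidableEq ι] (C : κ → ι → ℝ) (P K : ℕ) (Ξ ε : ℝ)
    (hε : 0 < ε) (hP : 0 < P)
    (hC : ∀ e, ∑ i, |C e i| * P ≤ Ξ) (hK : 2 * Ξ / ε + 1 ≤ K)
    (hcard : K ^ Fintype.card κ < P ^ Fintype.card ι) :
    ∃ p : ι → ℤ, p ≠ 0 ∧ (∀ i, |p i| ≤ P) ∧ ∀ e, |∑ i, C e i * (p i : ℝ)| < ε := by
  classical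
  let v : (ι → Fin P) → κ → ℝ := fun f e => ∑ i, C e i * ((f i : ℕ) : ℝ)
  have hv : ∀ f e, |v f e| ≤ Ξ := by
    intro f e
    refine (Finset.abs_sum_le_sum_abs _ _).trans ((Finset.sum_le_sum ?_).trans (hC e))
    intro i _
    rw [abs_mul]
    refine mul_le_mul_of_nonneg_left ?_ (abs_nonneg _)
    rw [abs_of_nonneg (Nat.cast_nonneg _)]
    exact_mod_cast (f i).2.le
  have hcell : ∀ f e, ⌊(v f e + Ξ) / ε⌋₊ < K := by
    intro f e
    have h0 := abs_le.1 (hv f e)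
    have : (⌊(v f e + Ξ) / ε⌋₊ : ℝ) ≤ (v f e + Ξ) / ε := Nat.floor_le (div_nonneg (by linarith) hε.le)
    have h2 : (v f e + Ξ) / ε ≤ 2 * Ξ / ε := div_le_div_of_nonneg_right (by linarith) hε.le
    have : (⌊(v f e + Ξ) / ε⌋₊ : ℝ) < K := by linarith
    exact_mod_cast this
  let φ : (ι → Fin P) → (κ → Fin K) := fun f e => ⟨⌊(v f e + Ξ) / ε⌋₊, hcell f e⟩
  have hcard' : Fintype.card (κ → Fin K) < Fintype.card (ι → Fin P) := by
    simpa using hcard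
  obtain ⟨f, g, hfg, hφ⟩ := Fintype.exists_ne_map_eq_of_card_lt φ hcard'
  refine ⟨fun i => ((f i : ℕ) : ℤ) - ((g i : ℕ) : ℤ), ?_, ?_, ?_⟩
  · intro h
    apply hfg
    funext i
    have := congrFun h i
    simp only [Pi.zero_apply, sub_eq_zero] at this
    exact Fin.ext (by exact_mod_cast this)
  · intro i
    have h1 := (f i).2
    have h2 := (g i).2
    show |((f i : ℕ) : ℤ) - ((g i : ℕ) : ℤ)| ≤ P
    rw [abs_le]; constructor <;> omega
  · intro e
    have h1 : ⌊(v f e + Ξ) / ε⌋₊ = ⌊(v g e + Ξ) / ε⌋₊ := by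
      have := congrFun hφ e
      simpa [φ] using this
    have hf0 := abs_le.1 (hv f e)
    have hg0 := abs_le.1 (hv g e)
    have a1 := Nat.floor_le (div_nonneg (by linarith : 0 ≤ v f e + Ξ) hε.le)
    have a2 := Nat.lt_floor_add_one ((v f e + Ξ) / ε)
    have b1 := Nat.floor_le (div_nonneg (by linarith : 0 ≤ v g e + Ξ) hε.le)
    have b2 := Nat.lt_floor_add_one ((v g e + Ξ) / ε)
    rw [h1] at a1 a2
    have e1 : ∑ i, C e i * (((((f i : ℕ) : ℤ) - ((g i : ℕ) : ℤ) : ℤ)) : ℝ) = v f e - v g e := by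
      simp only [v]
      rw [← Finset.sum_sub_distrib]
      refine Finset.sum_congr rfl fun i _ => ?_
      push_cast; ring
    rw [e1]
    have c1 : |(v f e + Ξ) / ε - (v g e + Ξ) / ε| < 1 := by
      rw [abs_lt]; constructor <;> linarith
    have c2 : (v f e + Ξ) / ε - (v g e + Ξ) / ε = (v f e - v g e) / ε := by ring
    rw [c2, abs_div, abs_of_pos hε, div_lt_one hε] at c1
    exact c1

/-- Vandermonde: if `∑ p_λ y_λ^s = 0` for `s < card ι`, `y` injective then `p = 0` -/
lemma bk_vander {ι : Type*} [Fintype ι] (y : ι → ℝ) (hy : Function.Injective y) (p : ι → ℝ)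
    (h : ∀ s < Fintype.card ι, ∑ i, p i * y i ^ s = 0) : p = 0 := by
  classical
  let e := Fintype.equivFin ι
  have h1 := Matrix.eq_zero_of_forall_pow_sum_mul_pow_eq_zero (R := ℝ) (f := fun i => y (e.symm i))
    (v := fun i => p (e.symm i)) (hy.comp e.symm.injective) (by
      intro i
      rw [← h i i.2]
      exact Fintype.sum_equiv e.symm _ _ (fun j => rfl))
  funext i
  have := congrFun h1 (e i)
  simpa using this

lemma bk_pow_bound {B : ℝ} (hB : 1 ≤ B) {P : ℝ} (p u v : ℤ) (hp : |(p:ℝ)| ≤ P) (hu : |(u:ℝ)| ≤ B) (hv : |(v:ℝ)| ≤ B)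
    {m1 m2 M : ℕ} (hm : m1 + m2 ≤ M) : |(p:ℝ) * u^m1 * v^m2| ≤ P * B^M := by
  have hP : 0 ≤ P := (abs_nonneg _).trans hp
  have hB0 : 0 ≤ B := by linarith
  rw [abs_mul, abs_mul, abs_pow, abs_pow, mul_assoc]
  refine mul_le_mul hp ?_ (by positivity) hP
  calc |(u:ℝ)|^m1 * |(v:ℝ)|^m2 ≤ B^m1 * B^m2 := by gcongr
    _ = B^(m1+m2) := (pow_add _ _ _).symm
    _ ≤ B^M := pow_le_pow_right₀ hB hm

/-- one extrapolation step -/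
lemma bk_step {ι : Type*} [Fintype ι] (p x1 x2 : ι → ℤ) (y : ι → ℝ) (θ1 θ2 W V B δ P : ℝ)
    (D M T M' S S' : ℕ)
    (hp : ∀ i, |(p i : ℝ)| ≤ P)
    (hB : 1 ≤ B) (hx1 : ∀ i, |(x1 i : ℝ)| ≤ B) (hx2 : ∀ i, |(x2 i : ℝ)| ≤ B)
    (hθ : |θ1| + |θ2| ≤ 6) (hw : ∀ i, |x1 i * θ1 + x2 i * θ2| ≤ W)
    (hP : 1 ≤ P) (hV : 1 ≤ V) (hδ0 : 0 ≤ δ)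
    (hL : ∀ (q : ι → ℤ) (s : ℕ) (Q : ℝ), 1 ≤ Q → (∀ i, |(q i : ℝ)| ≤ Q) →
      ∑ i, (q i : ℝ) * y i ^ s ≠ 0 →
      1 ≤ |∑ i, (q i : ℝ) * y i ^ s| * (Fintype.card ι * Q)^D * V^s)
    (hδ : ∀ i, ∀ s : ℕ, s ≤ S' → |Real.exp ((x1 i * θ1 + x2 i * θ2) * s) - y i ^ s| ≤ δ)
    (hS1 : 1 ≤ S) (hSS : S ≤ S') (hMM : M' + T ≤ M)
    (H2 : 4 * (Fintype.card ι * (P * B^M))^(D+1) * (Real.exp (22 * W) * V)^S' < 21^(T*S))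
    (H3 : 2 * (6^T * (2*S'+1)^(T*S) + 1) * δ * (Fintype.card ι * (P * B^M))^(D+1) * V^S' ≤ 1)
    (hinv : ∀ m1 m2 s : ℕ, m1 + m2 < M' + T → s < S → ∑ i, (p i : ℝ) * x1 i^m1 * x2 i^m2 * y i ^ s = 0) :
    ∀ m1 m2 s : ℕ, m1 + m2 < M' → s < S' → ∑ i, (p i : ℝ) * x1 i^m1 * x2 i^m2 * y i ^ s = 0 := by
  intro m1 m2 s' hm hs'
  set N : ℝ := ((Fintype.card ι : ℕ) : ℝ) with hN
  set Q : ℝ := P * B^M with hQ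
  set w : ι → ℝ := fun i => x1 i * θ1 + x2 i * θ2 with hwdef
  have hQ1 : 1 ≤ Q := by
    have : 1 ≤ B^M := one_le_pow₀ hB
    rw [hQ]; nlinarith
  have hN0 : 0 ≤ N := Nat.cast_nonneg _
  -- comparison of exp sums with y sums
  have hcmp : ∀ (a b s : ℕ), a + b ≤ M → s ≤ S' →
      |∑ i, (p i : ℝ) * x1 i^a * x2 i^b * Real.exp (w i * s) - ∑ i, (p i : ℝ) * x1 i^a * x2 i^b * y i ^ s| ≤ N * Q * δ := by
    intro a b s hab hs
    rw [← Finset.sum_sub_distrib]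
    refine (Finset.abs_sum_le_sum_abs _ _).trans ?_
    have : ∀ i ∈ (Finset.univ : Finset ι), |(p i : ℝ) * x1 i^a * x2 i^b * Real.exp (w i * s) - (p i : ℝ) * x1 i^a * x2 i^b * y i ^ s| ≤ Q * δ := by
      intro i _
      rw [← mul_sub, abs_mul]
      exact mul_le_mul (bk_pow_bound hB _ _ _ (hp i) (hx1 i) (hx2 i) hab) (hδ i s hs) (abs_nonneg _) (by linarith)
    refine (Finset.sum_le_sum this).trans ?_
    simp [hN]; linarith [mul_assoc N Q δ]
  let F : ℕ → ℂ → ℂ := fun t z => ∑ i, (((p i : ℝ) * x1 i^m1 * x2 i^m2 * (w i)^t : ℝ) : ℂ) * Complex.exp (w i * z)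
  have hF : ∀ t z, HasDerivAt (F t) (F (t+1) z) z := by
    intro t z
    have : ∀ i ∈ (Finset.univ : Finset ι), HasDerivAt (fun z : ℂ => (((p i : ℝ) * x1 i^m1 * x2 i^m2 * (w i)^t : ℝ) : ℂ) * Complex.exp (w i * z))
        ((((p i : ℝ) * x1 i^m1 * x2 i^m2 * (w i)^(t+1) : ℝ) : ℂ) * Complex.exp (w i * z)) z := by
      intro i _
      have h1 : HasDerivAt (fun z : ℂ => (w i : ℂ) * z) (w i : ℂ) z := by
        simpa using (hasDerivAt_id z).const_mul (w i : ℂ)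
      refine (h1.cexp.const_mul _).congr_deriv ?_
      push_cast; ring
    exact HasDerivAt.fun_sum this
  have hreal : ∀ (t s : ℕ), F t (s:ℂ) = ((∑ i, (p i : ℝ) * x1 i^m1 * x2 i^m2 * (w i)^t * Real.exp (w i * s) : ℝ) : ℂ) := by
    intro t s
    simp only [F]
    push_cast
    rfl
  have hsm : ∀ t < T, ∀ s < S, ‖F t (s:ℂ)‖ ≤ 6^T * (N * Q * δ) := by
    intro t ht s hs
    rw [hreal, Complex.norm_real, Real.norm_eq_abs]
    have e1 : ∑ i, (p i : ℝ) * x1 i^m1 * x2 i^m2 * (w i)^t * Real.exp (w i * s) =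
        ∑ a ∈ Finset.range (t+1), (θ1^a * θ2^(t-a) * (t.choose a : ℝ)) *
          ∑ i, (p i : ℝ) * x1 i^(m1+a) * x2 i^(m2+(t-a)) * Real.exp (w i * s) := by
      simp_rw [Finset.mul_sum]
      rw [Finset.sum_comm]
      refine Finset.sum_congr rfl fun i _ => ?_
      simp only [hwdef]
      rw [add_pow, Finset.mul_sum, Finset.sum_mul]
      refine Finset.sum_congr rfl fun a _ => ?_
      rw [mul_pow, mul_pow, pow_add, pow_add]
      ring
    rw [e1]
    refine (Finset.abs_sum_le_sum_abs _ _).trans ?_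
    have e2 : ∀ a ∈ Finset.range (t+1), |(θ1^a * θ2^(t-a) * (t.choose a : ℝ)) *
          ∑ i, (p i : ℝ) * x1 i^(m1+a) * x2 i^(m2+(t-a)) * Real.exp (w i * s)| ≤ (|θ1|^a * |θ2|^(t-a) * (t.choose a : ℝ)) * (N * Q * δ) := by
      intro a ha
      have ha' : a ≤ t := by simpa [Nat.lt_succ_iff] using ha
      rw [abs_mul, abs_mul, abs_mul, abs_pow, abs_pow, Nat.abs_cast]
      refine mul_le_mul_of_nonneg_left ?_ (by positivity)
      have h1 := hcmp (m1+a) (m2+(t-a)) s (by omega) (by omega)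
      rw [hinv (m1+a) (m2+(t-a)) s (by omega) hs, sub_zero] at h1
      exact h1
    refine (Finset.sum_le_sum e2).trans ?_
    rw [← Finset.sum_mul, ← add_pow]
    refine mul_le_mul_of_nonneg_right ?_ (by positivity)
    calc (|θ1| + |θ2|)^t ≤ 6^t := by gcongr
      _ ≤ 6^T := pow_le_pow_right₀ (by norm_num) ht.le
  have hS'1 : (1:ℝ) ≤ S' := by exact_mod_cast hS1.trans hSS
  have hA : ∀ ζ : ℂ, ‖ζ‖ = 22 * (S':ℝ) → ‖F 0 ζ‖ ≤ N * Q * Real.exp (22 * W) ^ S' := by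
    intro ζ hζ
    refine (norm_sum_le _ _).trans ?_
    have : ∀ i ∈ (Finset.univ : Finset ι), ‖(((p i : ℝ) * x1 i^m1 * x2 i^m2 * (w i)^0 : ℝ) : ℂ) * Complex.exp (w i * ζ)‖ ≤ Q * Real.exp (22*W)^S' := by
      intro i _
      rw [norm_mul, Complex.norm_real, Real.norm_eq_abs, pow_zero, mul_one, Complex.norm_exp]
      refine mul_le_mul (bk_pow_bound hB _ _ _ (hp i) (hx1 i) (hx2 i) (by omega)) ?_ (Real.exp_pos _).le (by linarith)
      rw [← Real.exp_nat_mul]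
      apply Real.exp_le_exp.2
      rw [Complex.re_ofReal_mul]
      have h1 : |w i * ζ.re| ≤ W * (22 * S') := by
        rw [abs_mul]
        refine mul_le_mul (hw i) ?_ (abs_nonneg _) ((abs_nonneg _).trans (hw i))
        rw [← hζ]; exact Complex.abs_re_le_norm ζ
      have := (abs_le.1 h1).2
      linarith
    refine (Finset.sum_le_sum this).trans ?_
    simp [hN]; linarith [mul_assoc N Q (Real.exp (22*W)^S')]
  have hη : 0 ≤ 6^T * (N * Q * δ) := by positivity
  have hinterp := bk_interp hF (X := (S':ℝ)) (E := 22) (T := T) (S := S) (x := s') hη hS'1 (by exact_mod_cast hSS)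
    (by exact_mod_cast hs'.le) (by norm_num) hsm hA
  rw [hreal, Complex.norm_real, Real.norm_eq_abs] at hinterp
  simp only [pow_zero, mul_one] at hinterp
  have hc := hcmp m1 m2 s' (by omega) hs'.le
  set G := ∑ i, (p i : ℝ) * x1 i^m1 * x2 i^m2 * y i ^ s' with hG
  by_contra hne
  let q : ι → ℤ := fun i => p i * x1 i^m1 * x2 i^m2
  have hq : ∀ i, |(q i : ℝ)| ≤ Q := by
    intro i
    simp only [q]; push_cast
    exact bk_pow_bound hB _ _ _ (hp i) (hx1 i) (hx2 i) (by omega)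
  have hGq : ∑ i, (q i : ℝ) * y i ^ s' = G := by
    simp only [q, hG]; push_cast; rfl
  have hl := hL q s' Q hQ1 hq (by rw [hGq]; exact hne)
  rw [hGq] at hl
  -- N ≥ 1
  have hN1 : 1 ≤ N := by
    have : Nonempty ι := by
      by_contra hem
      rw [not_nonempty_iff] at hem
      exact hne (by simp [hG])
    have : 0 < Fintype.card ι := Fintype.card_pos
    rw [hN]; exact_mod_cast this
  have hVs : V^s' ≤ V^S' := pow_le_pow_right₀ hV hs'.le
  have hNQ : 1 ≤ N * Q := by nlinarith
  have hl2 : 1 ≤ |G| * (N*Q)^D * V^S' := by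
    refine hl.trans (mul_le_mul_of_nonneg_left hVs (by positivity))
  have hG2 : |G| ≤ (6^T * (2*S'+1)^(T*S) + 1) * δ * (N * Q) + 2 * (N * Q * Real.exp (22*W)^S') / 21^(T*S) := by
    have h3 := abs_sub_abs_le_abs_sub G (∑ i, (p i : ℝ) * x1 i^m1 * x2 i^m2 * Real.exp (w i * s'))
    rw [abs_sub_comm] at h3
    norm_num at hinterp
    nlinarith
  have hpos : 0 < (N*Q)^D * V^S' := by positivity
  have hfin : |G| * ((N*Q)^D * V^S') < 1 := by
    refine lt_of_le_of_lt (mul_le_mul_of_nonneg_right hG2 hpos.le) ?_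
    have a1 : (6^T * (2*S'+1)^(T*S) + 1) * δ * (N * Q) * ((N*Q)^D * V^S') ≤ 1/2 := by
      rw [pow_succ] at H3
      nlinarith
    have a2 : 2 * (N * Q * Real.exp (22*W)^S') / 21^(T*S) * ((N*Q)^D * V^S') < 1/2 := by
      rw [div_mul_eq_mul_div, div_lt_iff₀ (by positivity)]
      rw [pow_succ, mul_pow (Real.exp _)] at H2
      nlinarith
    rw [add_mul]; linarith
  linarith [mul_assoc |G| ((N*Q)^D) (V^S')]

theorem bk_main {ι : Type*} [Fintype ι] [Nonempty ι] (x1 x2 : ι → ℤ) (y : ι → ℝ) (θ1 θ2 W V B δ : ℝ)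
    (D P M2 T S R J : ℕ)
    (hB : 1 ≤ B) (hx1 : ∀ i, |(x1 i : ℝ)| ≤ B) (hx2 : ∀ i, |(x2 i : ℝ)| ≤ B)
    (hθ : |θ1| + |θ2| ≤ 6) (hw : ∀ i, |x1 i * θ1 + x2 i * θ2| ≤ W)
    (hP : 1 ≤ P) (hV : 1 ≤ V) (hδ0 : 0 ≤ δ)
    (hy0 : ∀ i, 0 < y i) (hyW : ∀ i, y i ≤ Real.exp W) (hyinj : Function.Injective y)
    (hL : ∀ (q : ι → ℤ) (s : ℕ) (Q : ℝ), 1 ≤ Q → (∀ i, |(q i : ℝ)| ≤ Q) →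
      ∑ i, (q i : ℝ) * y i ^ s ≠ 0 →
      1 ≤ |∑ i, (q i : ℝ) * y i ^ s| * (Fintype.card ι * Q)^D * V^s)
    (hδ : ∀ i, ∀ s : ℕ, s ≤ S * R^J → |Real.exp ((x1 i * θ1 + x2 i * θ2) * s) - y i ^ s| ≤ δ)
    (hS1 : 1 ≤ S) (hR : 1 ≤ R) (hM2 : (J+1)*T ≤ M2 ∨ (M2 = 1 ∧ ∀ i, x2 i = 0))
    (H1 : (4 * (Fintype.card ι * (P * B^((J+1)*T)))^(D+1) * (Real.exp W * V)^S)^((J+1)*T*M2*S)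
      < (P:ℝ)^(Fintype.card ι))
    (H2 : ∀ j < J, 4 * (Fintype.card ι * (P * B^((J+1)*T)))^(D+1) * (Real.exp (22 * W) * V)^(S*R^(j+1)) < 21^(T*(S*R^j)))
    (H3 : 2 * (6^T * (2*(S*R^J : ℕ)+1)^(T*(S*R^J)) + 1) * δ * (Fintype.card ι * (P * B^((J+1)*T)))^(D+1) * V^(S*R^J) ≤ 1)
    (H4 : Fintype.card ι ≤ S*R^J) (hT : 1 ≤ T) : False := by
  classical
  set M := (J+1)*T with hM
  set N : ℝ := ((Fintype.card ι : ℕ) : ℝ) with hN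
  have hN1 : 1 ≤ N := by
    have : 0 < Fintype.card ι := Fintype.card_pos
    rw [hN]; exact_mod_cast this
  have hP1 : (1:ℝ) ≤ P := by exact_mod_cast hP
  set Q : ℝ := P * B^M with hQ
  have hBM : 1 ≤ B^M := one_le_pow₀ hB
  have hQ1 : 1 ≤ Q := by rw [hQ]; nlinarith
  have hW0 : 0 ≤ W := (abs_nonneg _).trans (hw (Classical.arbitrary ι))
  have hNQ : 1 ≤ N * Q := by nlinarith
  let κ := Fin M × Fin M2 × Fin S
  let C : κ → ι → ℝ := fun e i => (x1 i : ℝ)^(e.1:ℕ) * x2 i^(e.2.1:ℕ) * y i^(e.2.2:ℕ)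
  set ε : ℝ := ((N*Q)^D * V^S)⁻¹ with hε
  have hpos : 0 < (N*Q)^D * V^S := by positivity
  have hεpos : 0 < ε := inv_pos.2 hpos
  set Ξ : ℝ := N * Q * Real.exp W ^ S with hΞ
  set K : ℕ := ⌈2 * Ξ / ε⌉₊ + 1 with hK
  have hexpW : 1 ≤ Real.exp W := Real.one_le_exp hW0
  have hKle : (K:ℝ) ≤ 4 * (N*Q)^(D+1) * (Real.exp W * V)^S := by
    have h1 : (⌈2 * Ξ / ε⌉₊ : ℝ) < 2*Ξ/ε + 1 := Nat.ceil_lt_add_one (by positivity)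
    have h2 : 2*Ξ/ε = 2 * ((N*Q)^(D+1) * (Real.exp W * V)^S) := by
      rw [hε, div_inv_eq_mul, hΞ, mul_pow, pow_succ]; ring
    have h3 : 1 ≤ (N*Q)^(D+1) * (Real.exp W * V)^S := by
      have a1 : 1 ≤ (N*Q)^(D+1) := one_le_pow₀ hNQ
      have a2 : 1 ≤ (Real.exp W * V)^S := one_le_pow₀ (by nlinarith)
      nlinarith
    rw [hK]; push_cast
    rw [h2] at h1 ⊢
    nlinarith
  -- bound on C when exponents fit
  have hm2M : ∀ e : κ, (e.1:ℕ) + (e.2.1:ℕ) < M → ∑ i, |C e i| * P ≤ Ξ := by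
    intro e he
    have : ∀ i ∈ (Finset.univ : Finset ι), |C e i| * P ≤ Q * Real.exp W ^ S := by
      intro i _
      have h1 := bk_pow_bound hB (P := (P:ℝ)) P (x1 i) (x2 i) (by simp) (hx1 i) (hx2 i) he.le
      have h2 : y i^(e.2.2:ℕ) ≤ Real.exp W ^ S := by
        calc y i^(e.2.2:ℕ) ≤ Real.exp W ^ (e.2.2:ℕ) := pow_le_pow_left₀ (hy0 i).le (hyW i) _
          _ ≤ _ := pow_le_pow_right₀ hexpW e.2.2.2.le
      have h3 : 0 < y i^(e.2.2:ℕ) := pow_pos (hy0 i) _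
      have h4 : |C e i| * P = |((P:ℤ):ℝ) * (x1 i:ℝ)^(e.1:ℕ) * (x2 i:ℝ)^(e.2.1:ℕ)| * y i^(e.2.2:ℕ) := by
        simp only [C]
        rw [abs_mul, abs_of_pos h3, abs_mul, abs_mul, abs_mul]
        simp only [Int.cast_natCast, Nat.abs_cast]
        ring
      rw [h4]
      exact mul_le_mul h1 h2 h3.le (by linarith)
    refine (Finset.sum_le_sum this).trans ?_
    simp [hΞ, hN]; linarith [mul_assoc N Q (Real.exp W^S)]
  -- use modified system: only equations with m1+m2<M
  let C' : κ → ι → ℝ := fun e i => if (e.1:ℕ) + (e.2.1:ℕ) < M then C e i else 0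
  have hC' : ∀ e, ∑ i, |C' e i| * P ≤ Ξ := by
    intro e
    by_cases he : (e.1:ℕ) + (e.2.1:ℕ) < M
    · simpa [C', he] using hm2M e he
    · simp [C', he]; positivity
  have hcardκ : Fintype.card κ = M*M2*S := by simp [κ, mul_assoc]
  have hKcard : K ^ Fintype.card κ < P ^ Fintype.card ι := by
    rw [hcardκ]
    have : ((K ^ (M*M2*S) : ℕ):ℝ) < ((P ^ Fintype.card ι : ℕ) : ℝ) := by
      push_cast
      exact lt_of_le_of_lt (pow_le_pow_left₀ (Nat.cast_nonneg _) hKle _) H1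
    exact_mod_cast this
  obtain ⟨p, hp0, hpP, hpe⟩ := bk_pigeon C' P K Ξ ε hεpos hP hC' (by
    rw [hK]; push_cast; linarith [Nat.le_ceil (2 * Ξ / ε)]) hKcard
  have hpP' : ∀ i, |(p i : ℝ)| ≤ P := by
    intro i; have := hpP i; exact_mod_cast this
  -- base
  have base0 : ∀ m1 m2 s : ℕ, m1 + m2 < M → m2 < M2 → s < S → ∑ i, (p i : ℝ) * x1 i^m1 * x2 i^m2 * y i ^ s = 0 := by
    intro m1 m2 s hm hm2 hs
    have h1 := hpe (⟨m1, by omega⟩, ⟨m2, hm2⟩, ⟨s, hs⟩)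
    simp only [C', hm, if_true, C] at h1
    set G := ∑ i, (p i : ℝ) * x1 i^m1 * x2 i^m2 * y i ^ s with hG
    have hG' : ∑ i, (x1 i:ℝ)^m1 * x2 i^m2 * y i^s * (p i:ℝ) = G := by
      rw [hG]; exact Finset.sum_congr rfl fun i _ => by ring
    rw [hG'] at h1
    by_contra hne
    let q : ι → ℤ := fun i => p i * x1 i^m1 * x2 i^m2
    have hq : ∀ i, |(q i : ℝ)| ≤ Q := by
      intro i
      simp only [q]; push_cast
      exact bk_pow_bound hB _ _ _ (hpP' i) (hx1 i) (hx2 i) hm.le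
    have hGq : ∑ i, (q i : ℝ) * y i ^ s = G := by
      simp only [q, hG]; push_cast; rfl
    have hl := hL q s Q hQ1 hq (by rw [hGq]; exact hne)
    rw [hGq] at hl
    have hVs : V^s ≤ V^S := pow_le_pow_right₀ hV hs.le
    have hl2 : 1 ≤ |G| * (N*Q)^D * V^S :=
      hl.trans (mul_le_mul_of_nonneg_left hVs (by positivity))
    have : |G| * ((N*Q)^D * V^S) < 1 := by
      have := mul_lt_mul_of_pos_right h1 hpos
      rwa [hε, inv_mul_cancel₀ hpos.ne'] at this
    linarith [mul_assoc |G| ((N*Q)^D) (V^S)]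
  have inv : ∀ j ≤ J, ∀ m1 m2 s : ℕ, m1 + m2 < (J+1-j)*T → s < S*R^j → ∑ i, (p i : ℝ) * x1 i^m1 * x2 i^m2 * y i ^ s = 0 := by
    intro j
    induction j with
    | zero =>
      intro _ m1 m2 s hm hs
      simp only [Nat.sub_zero, pow_zero, mul_one] at hm hs
      rcases hM2 with h | ⟨h, hx⟩
      · exact base0 m1 m2 s hm (by omega) hs
      · rcases Nat.eq_zero_or_pos m2 with h0 | h0
        · exact base0 m1 m2 s hm (by omega) hs
        · refine Finset.sum_eq_zero fun i _ => ?_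
          rw [hx i]; simp [h0.ne']
    | succ j ih =>
      intro hj
      have e1 : (J+1-j)*T = (J+1-(j+1))*T + T := by
        rw [show J+1-j = (J+1-(j+1)) + 1 by omega]; ring
      have hSj : S*R^j ≤ S*R^(j+1) := Nat.mul_le_mul_left _ (Nat.pow_le_pow_right hR (by omega))
      have hSJ : S*R^(j+1) ≤ S*R^J := Nat.mul_le_mul_left _ (Nat.pow_le_pow_right hR (by omega))
      have hSjJ : S*R^j ≤ S*R^J := hSj.trans hSJ
      refine bk_step p x1 x2 y θ1 θ2 W V B δ P D M T ((J+1-(j+1))*T) (S*R^j) (S*R^(j+1)) hpP' hB hx1 hx2 hθ hw hP1 hV hδ0 hL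
        (fun i s hs => hδ i s (hs.trans hSJ)) (Nat.mul_pos hS1 (pow_pos hR _)) hSj ?_ (H2 j hj) ?_ ?_
      · rw [← e1, hM]; exact Nat.mul_le_mul_right _ (by omega)
      · refine le_trans ?_ H3
        have b1 : (1:ℝ) ≤ 2*(S*R^J : ℕ)+1 := by
          have : (0:ℝ) ≤ (S*R^J : ℕ) := Nat.cast_nonneg _
          linarith
        have b2 : ((S*R^(j+1) : ℕ):ℝ) ≤ (S*R^J : ℕ) := by exact_mod_cast hSJ
        have b3 : (2*((S*R^(j+1) : ℕ):ℝ)+1)^(T*(S*R^j)) ≤ (2*(S*R^J : ℕ)+1)^(T*(S*R^J)) := by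
          refine (pow_le_pow_left₀ (by positivity) (by linarith : _ ≤ (2*((S*R^J : ℕ):ℝ)+1)) _).trans ?_
          exact pow_le_pow_right₀ b1 (Nat.mul_le_mul_left _ hSjJ)
        have b4 : V^(S*R^(j+1)) ≤ V^(S*R^J) := pow_le_pow_right₀ hV hSJ
        gcongr
      · rw [← e1]; exact ih (by omega)
  have hfin := inv J le_rfl
  have hp00 : (fun i => (p i:ℝ)) = 0 := by
    refine bk_vander y hyinj _ ?_
    intro s hs
    have := hfin 0 0 s (by simp; omega) (by omega)
    simpa using this
  apply hp0
  funext i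
  have := congrFun hp00 i
  simpa using this

set_option maxHeartbeats 1000000 in
lemma bk_num {ι : Type*} [Fintype ι] [Nonempty ι] (x1 x2 : ι → ℤ) (y : ι → ℝ) (θ1 θ2 W v δ : ℝ)
    (k T S J b M2 yb : ℕ) (hk : 1 ≤ k) (hb : 1 ≤ b)
    (hx1 : ∀ i, |(x1 i : ℝ)| ≤ Real.exp b) (hx2 : ∀ i, |(x2 i : ℝ)| ≤ Real.exp b)
    (hθ : |θ1| + |θ2| ≤ 6) (hw : ∀ i, |x1 i * θ1 + x2 i * θ2| ≤ W)
    (hv : 0 ≤ v) (hδ0 : 0 ≤ δ)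
    (hy0 : ∀ i, 0 < y i) (hyW : ∀ i, y i ≤ Real.exp W) (hyinj : Function.Injective y)
    (hL : ∀ (q : ι → ℤ) (s : ℕ) (Q : ℝ), 1 ≤ Q → (∀ i, |(q i : ℝ)| ≤ Q) →
      ∑ i, (q i : ℝ) * y i ^ s ≠ 0 →
      1 ≤ |∑ i, (q i : ℝ) * y i ^ s| * (Fintype.card ι * Q)^k * Real.exp v ^s)
    (hδ : ∀ i, ∀ s : ℕ, s ≤ 4 * Fintype.card ι → |Real.exp ((x1 i * θ1 + x2 i * θ2) * s) - y i ^ s| ≤ δ)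
    (hT : 4 * (22 * W + v) ≤ T) (hTk : 6 * k + 16 ≤ T)
    (hS : 2 * (k+1) * (J+1) * b + 1 ≤ S)
    (hM2 : (J+1)*T ≤ M2 ∨ (M2 = 1 ∧ ∀ i, x2 i = 0)) (hM21 : 1 ≤ M2)
    (hN : 2 * (k+1) * ((J+1)*T) * M2 * S ≤ Fintype.card ι)
    (hNJ : Fintype.card ι ≤ S * 4^J)
    (hyb : 4 * Fintype.card ι ≤ 2^yb) :
    Real.exp (-((T * (4 * Fintype.card ι) * (yb + 6) : ℕ) : ℝ)) < δ := by
  classical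
  by_contra hcon
  push Not at hcon
  have hex : ∃ J', Fintype.card ι ≤ S * 4^J' := ⟨J, hNJ⟩
  set J' := Nat.find hex with hJ'
  have hJ'1 : Fintype.card ι ≤ S * 4^J' := Nat.find_spec hex
  have hJJ : J' ≤ J := Nat.find_min' hex hNJ
  have hS1 : 1 ≤ S := by omega
  have hT1 : 1 ≤ T := by omega
  have hY4 : S * 4^J' ≤ 4 * Fintype.card ι := by
    rcases Nat.eq_zero_or_pos J' with h0 | h0
    · rw [h0]
      have : S ≤ Fintype.card ι := by
        refine le_trans ?_ hN
        exact Nat.le_mul_of_pos_left _ (by positivity)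
      omega
    · have := Nat.find_min hex (m := J' - 1) (by omega)
      push Not at this
      have e : 4^J' = 4 * 4^(J'-1) := by
        rw [← pow_succ']; congr 1; omega
      rw [e]
      calc S * (4 * 4^(J'-1)) = 4 * (S * 4^(J'-1)) := by ring
        _ ≤ _ := Nat.mul_le_mul_left _ this.le
  set n := Fintype.card ι with hn
  have hn1 : 1 ≤ n := Fintype.card_pos
  set Y := S * 4^J' with hY
  have hSY : S ≤ Y := Nat.le_mul_of_pos_right _ (by positivity)
  set M := (J'+1)*T with hM
  have hMJ : M ≤ (J+1)*T := Nat.mul_le_mul_right _ (by omega)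
  have hnR : (1:ℝ) ≤ n := by exact_mod_cast hn1
  have hSR : (1:ℝ) ≤ S := by exact_mod_cast hS1
  have hTR : (1:ℝ) ≤ T := by exact_mod_cast hT1
  have hkR : (1:ℝ) ≤ k := by exact_mod_cast hk
  have hW0 : 0 ≤ W := (abs_nonneg _).trans (hw (Classical.arbitrary ι))
  have hlog4 : Real.log 4 ≤ 2 := by
    have : Real.log 4 = 2 * Real.log 2 := by
      rw [show (4:ℝ) = 2^2 by norm_num, Real.log_pow]; norm_num
    linarith [Real.log_two_lt_d9]
  have hlog40 : 0 ≤ Real.log 4 := Real.log_nonneg (by norm_num)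
  have hlogn0 : 0 ≤ Real.log n := Real.log_nonneg hnR
  have hlogn : Real.log n ≤ S + 2 * J := by
    have h1 : (n:ℝ) ≤ S * 4^J := by exact_mod_cast hNJ
    calc Real.log n ≤ Real.log (S * 4^J) := Real.log_le_log (by linarith) h1
      _ = Real.log S + J * Real.log 4 := by rw [Real.log_mul (by positivity) (by positivity), Real.log_pow]
      _ ≤ S + 2 * J := by
        have : Real.log S ≤ S := (Real.log_le_sub_one_of_pos (by linarith)).trans (by linarith)
        linarith [mul_le_mul_of_nonneg_left hlog4 (Nat.cast_nonneg (α := ℝ) J)]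
  set G : ℝ := Real.log n + M * b + (S * (W + v) + Real.log 4) / (k+1) with hG
  have hG0 : 0 ≤ G := by positivity
  set P : ℕ := ⌊Real.exp G⌋₊ + 1 with hP
  have hPG : G < Real.log P := by
    rw [Real.lt_log_iff_exp_lt (by rw [hP]; positivity)]
    rw [hP]; push_cast; exact Nat.lt_floor_add_one _
  have hPG2 : Real.log P ≤ G + 1 := by
    rw [Real.log_le_iff_le_exp (by rw [hP]; positivity), Real.exp_add]
    have h1 : (⌊Real.exp G⌋₊ : ℝ) ≤ Real.exp G := Nat.floor_le (Real.exp_pos _).le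
    have h2 : 1 ≤ Real.exp G := Real.one_le_exp hG0
    have h3 := Real.exp_one_gt_d9
    rw [hP]; push_cast
    linarith [mul_le_mul_of_nonneg_left h3.le (Real.exp_pos G).le]
  set lP := Real.log P with hlP
  have hPexp : (P:ℝ) = Real.exp lP := (Real.exp_log (by rw [hP]; positivity)).symm
  have hnexp : (n:ℝ) = Real.exp (Real.log n) := (Real.exp_log (by linarith)).symm
  set lQ : ℝ := Real.log n + lP + M * b with hlQ
  have hQexp : (n:ℝ) * (P * Real.exp b ^ M) = Real.exp lQ := by
    rw [hlQ, Real.exp_add, Real.exp_add, ← hnexp, ← hPexp, ← Real.exp_nat_mul]; ring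
  have h4exp : (4:ℝ) = Real.exp (Real.log 4) := (Real.exp_log (by norm_num)).symm
  have hQpow : ((n:ℝ) * (P * Real.exp b ^ M))^(k+1) = Real.exp ((k+1) * lQ) := by
    rw [hQexp, ← Real.exp_nat_mul]; push_cast; rfl
  -- key estimate
  have hkey : Real.log 4 + (k+1) * lQ ≤ 7/4 * (T * S) := by
    have e1 : (k+1) * G = (k+1) * (Real.log n + M * b) + (S * (W + v) + Real.log 4) := by
      rw [hG]; field_simp
    have e2 : (k+1) * lQ ≤ (k+1) * (Real.log n + M * b) + (k+1) * (G + 1) := by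
      have h1 := mul_le_mul_of_nonneg_left hPG2 (by positivity : (0:ℝ) ≤ (k:ℝ)+1)
      have h2 : ((k:ℝ)+1) * lQ = (k+1) * (Real.log n + M * b) + (k+1) * lP := by rw [hlQ]; ring
      linarith
    have e3 : (S:ℝ) * (W + v) ≤ 1/4 * (T * S) := by
      have : W + v ≤ T / 4 := by linarith
      have h1 := mul_le_mul_of_nonneg_left this (by positivity : (0:ℝ) ≤ S)
      linarith
    have e4 : 2 * ((k:ℝ)+1) * (M * b) ≤ T * S - T := by
      have h1 : 2 * (k+1) * (M * b) + T ≤ T * S := by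
        calc 2 * (k+1) * (M * b) + T ≤ 2 * (k+1) * ((J+1)*T * b) + T := by gcongr
          _ = T * (2 * (k+1) * (J+1) * b + 1) := by ring
          _ ≤ T * S := Nat.mul_le_mul_left _ hS
      have : ((2 * (k+1) * (M * b) + T : ℕ):ℝ) ≤ ((T * S : ℕ) : ℝ) := by exact_mod_cast h1
      push_cast at this
      linarith
    have e5 : 4 * ((k:ℝ)+1) * J ≤ 2 * S := by
      have h1 : 4 * (k+1) * J ≤ 2 * S := by
        have h2 : 2 * (k+1) * (J+1) * 1 ≤ 2 * (k+1) * (J+1) * b := by gcongr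
        have h3 : 4 * (k+1) * J + 4 * (k+1) = 2 * (2 * (k+1) * (J+1) * 1) := by ring
        omega
      exact_mod_cast h1
    have e6 : (6:ℝ) * k + 16 ≤ T := by exact_mod_cast hTk
    have e7 : 2 * ((k:ℝ)+1) * Real.log n ≤ 2 * (k+1) * S + 2 * S := by
      have h1 := mul_le_mul_of_nonneg_left hlogn (by positivity : (0:ℝ) ≤ 2 * ((k:ℝ)+1))
      linarith
    have e8 : 2 * ((k:ℝ)+1) * S + 2 * S + (k+1) + 4 ≤ 1/2 * (T * S) + T := by
      have h1 := mul_le_mul_of_nonneg_right e6 (by positivity : (0:ℝ) ≤ S)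
      have h2 := mul_le_mul_of_nonneg_left hSR (by positivity : (0:ℝ) ≤ k)
      linarith
    linarith
  refine bk_main x1 x2 y θ1 θ2 W (Real.exp v) (Real.exp b) δ k P M2 T S 4 J' (Real.one_le_exp (Nat.cast_nonneg b)) hx1 hx2 hθ hw
    (by omega) (Real.one_le_exp hv) hδ0 hy0 hyW hyinj hL (fun i s hs => hδ i s (hs.trans hY4)) hS1 (by norm_num) ?_ ?_ ?_ ?_ hJ'1 hT1
  · rcases hM2 with h | h
    · left; exact hMJ.trans h
    · right; exact h
  · rw [← hn, ← hM, hQpow, ← Real.exp_add, ← Real.exp_nat_mul, h4exp, ← Real.exp_add, ← Real.exp_add, ← Real.exp_nat_mul, hPexp, ← Real.exp_nat_mul]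
    apply Real.exp_lt_exp.2
    have e1 : Real.log 4 + (k+1) * lQ + S * (W + v) = (k+1) * (G + lP) := by
      rw [hG, hlQ]; field_simp; ring
    rw [e1]
    have hE0 : 0 < M * M2 * S := by positivity
    have e2 : 2 * (k+1) * (M * M2 * S) ≤ n := by
      refine le_trans ?_ hN
      calc 2 * (k+1) * (M * M2 * S) ≤ 2 * (k+1) * ((J+1)*T * M2 * S) := by gcongr
        _ = _ := by ring
    have e3 : 2 * ((k:ℝ)+1) * ((M * M2 * S : ℕ):ℝ) ≤ n := by exact_mod_cast e2
    have hE0' : (0:ℝ) < ((M * M2 * S : ℕ):ℝ) := by exact_mod_cast hE0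
    have hlP0 : 0 ≤ lP := by linarith
    calc ((M * M2 * S : ℕ):ℝ) * ((k+1) * (G + lP)) < ((M * M2 * S : ℕ):ℝ) * ((k+1) * (lP + lP)) := by
          gcongr
      _ = 2 * ((k:ℝ)+1) * ((M * M2 * S : ℕ):ℝ) * lP := by ring
      _ ≤ n * lP := mul_le_mul_of_nonneg_right e3 hlP0
  · intro j _
    rw [← hn, ← hM, hQpow, ← Real.exp_add, ← Real.exp_nat_mul, h4exp, ← Real.exp_add, ← Real.exp_add]
    have h21 : Real.exp 3 ≤ 21 := by
      have : Real.exp 3 = Real.exp 1 ^ 3 := by rw [← Real.exp_nat_mul]; norm_num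
      rw [this]
      have h1 := Real.exp_one_lt_d9
      calc Real.exp 1 ^ 3 ≤ (2.7182818286:ℝ)^3 := by gcongr
        _ ≤ 21 := by norm_num
    refine lt_of_lt_of_le ?_ (pow_le_pow_left₀ (Real.exp_pos _).le h21 _)
    rw [← Real.exp_nat_mul]
    apply Real.exp_lt_exp.2
    set Sj : ℕ := S * 4^j with hSj
    have hSSj : S ≤ Sj := Nat.le_mul_of_pos_right _ (by positivity)
    have e1 : S * 4^(j+1) = 4 * Sj := by rw [hSj]; ring
    rw [e1]
    have hSSjR : (S:ℝ) ≤ Sj := by exact_mod_cast hSSj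
    push_cast
    have e2 : (4:ℝ) * Sj * (22 * W + v) ≤ T * Sj := by linarith [mul_le_mul_of_nonneg_right hT (Nat.cast_nonneg (α := ℝ) Sj)]
    have e3 : (T:ℝ) * S ≤ T * Sj := by gcongr
    have e4 : (0:ℝ) < T * Sj := by
      have : (0:ℝ) < Sj := by linarith
      positivity
    linarith
  · rw [← hn, ← hM, ← hY, hQpow]
    have hYR : (1:ℝ) ≤ Y := hSR.trans (by exact_mod_cast hSY)
    have hSYR : (S:ℝ) ≤ Y := by exact_mod_cast hSY
    have f1 : (6:ℝ)^T ≤ Real.exp (2 * T) := by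
      have : (6:ℝ) ≤ Real.exp 2 := by
        have : Real.exp 2 = Real.exp 1 ^ 2 := by rw [← Real.exp_nat_mul]; norm_num
        rw [this]
        have h1 := Real.exp_one_gt_d9
        calc (6:ℝ) ≤ 2.7182818283^2 := by norm_num
          _ ≤ _ := pow_le_pow_left₀ (by norm_num) h1.le 2
      calc (6:ℝ)^T ≤ Real.exp 2 ^ T := by gcongr
        _ = Real.exp (2*T) := by rw [← Real.exp_nat_mul]; ring_nf
    have f2 : (2*(Y:ℝ)+1) ≤ Real.exp (yb + 2) := by
      have h1 : (Y:ℝ) ≤ 2^yb := by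
        have : Y ≤ 2^yb := hY4.trans hyb
        exact_mod_cast this
      have h2 : (2:ℝ)^yb ≤ Real.exp yb := by
        have : (2:ℝ) ≤ Real.exp 1 := by linarith [Real.exp_one_gt_d9]
        calc (2:ℝ)^yb ≤ Real.exp 1 ^ yb := by gcongr
          _ = Real.exp yb := by rw [← Real.exp_nat_mul]; ring_nf
      have h3 : (4:ℝ) ≤ Real.exp 2 := by
        have : Real.exp 2 = Real.exp 1 ^ 2 := by rw [← Real.exp_nat_mul]; norm_num
        rw [this]
        have h1 := Real.exp_one_gt_d9
        calc (4:ℝ) ≤ 2.7182818283^2 := by norm_num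
          _ ≤ _ := pow_le_pow_left₀ (by norm_num) h1.le 2
      rw [Real.exp_add]
      have : 1 ≤ Real.exp (yb:ℝ) := Real.one_le_exp (Nat.cast_nonneg _)
      linarith [mul_le_mul_of_nonneg_left h3 (Real.exp_pos (yb:ℝ)).le]
    have f3 : (2*(Y:ℝ)+1)^(T*Y) ≤ Real.exp ((T*Y) * (yb+2)) := by
      calc (2*(Y:ℝ)+1)^(T*Y) ≤ Real.exp (yb+2) ^ (T*Y) := by gcongr
        _ = _ := by rw [← Real.exp_nat_mul]; push_cast; ring_nf
    have f4 : 2 * ((6:ℝ)^T * (2*(Y:ℝ)+1)^(T*Y) + 1) ≤ Real.exp (Real.log 4 + 2 * T + (T*Y) * (yb+2)) := by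
      rw [Real.exp_add, Real.exp_add, ← h4exp]
      have g1 : (6:ℝ)^T * (2*(Y:ℝ)+1)^(T*Y) ≤ Real.exp (2*T) * Real.exp ((T*Y) * (yb+2)) := by gcongr
      have g2 : 1 ≤ Real.exp (2*(T:ℝ)) * Real.exp ((T*Y) * (yb+2)) := by
        rw [← Real.exp_add]; apply Real.one_le_exp; positivity
      linarith
    have f5 : δ ≤ Real.exp (-((T * Y) * (yb + 6))) := by
      refine hcon.trans (Real.exp_le_exp.2 ?_)
      have : (T * Y) * (yb + 6) ≤ T * (4 * n) * (yb + 6) := by gcongr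
      have : (((T * Y) * (yb + 6) : ℕ) : ℝ) ≤ ((T * (4 * n) * (yb + 6) : ℕ) : ℝ) := by exact_mod_cast this
      push_cast at this ⊢
      linarith
    calc _ ≤ Real.exp (Real.log 4 + 2 * T + (T*Y) * (yb+2)) * Real.exp (-((T * Y) * (yb + 6))) * Real.exp ((k+1) * lQ) * Real.exp v ^ Y := by
          gcongr
      _ = Real.exp (Real.log 4 + 2 * T + (T*Y) * (yb+2) + -((T * Y) * (yb + 6)) + (k+1) * lQ + Y * v) := by
          rw [← Real.exp_nat_mul, ← Real.exp_add, ← Real.exp_add, ← Real.exp_add]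
      _ ≤ 1 := by
        rw [Real.exp_le_one_iff]
        have e2 : (Y:ℝ) * v ≤ 1/4 * (T * Y) := by
          have : v ≤ T/4 := by linarith
          linarith [mul_le_mul_of_nonneg_left this (Nat.cast_nonneg (α := ℝ) Y)]
        have e3 : (T:ℝ) * S ≤ T * Y := by gcongr
        have e4 : (T:ℝ) ≤ T * Y := by linarith [mul_le_mul_of_nonneg_left hYR (Nat.cast_nonneg (α := ℝ) T)]
        linarith

open Polynomial in
/-- the characteristic polynomial -/
noncomputable def bkPsi (k : ℕ) : ℤ[X] := X^k - ∑ i ∈ Finset.range k, X^i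

open Polynomial in
lemma bkPsi_monic (k : ℕ) : (bkPsi k).Monic := by
  unfold bkPsi
  refine monic_X_pow_sub ?_
  refine (degree_sum_le _ _).trans_lt ?_
  rw [Finset.sup_lt_iff (by exact WithBot.bot_lt_coe k)]
  intro i hi
  rw [degree_X_pow]
  exact_mod_cast Finset.mem_range.1 hi

open Polynomial in
lemma bkPsi_natDegree (k : ℕ) : (bkPsi k).natDegree = k := by
  unfold bkPsi
  have h : degree (∑ i ∈ Finset.range k, (X:ℤ[X])^i) < (k : WithBot ℕ) := by
    refine (degree_sum_le _ _).trans_lt ?_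
    rw [Finset.sup_lt_iff (by exact WithBot.bot_lt_coe k)]
    intro i hi
    rw [degree_X_pow]
    exact_mod_cast Finset.mem_range.1 hi
  have h2 : degree ((X:ℤ[X])^k - ∑ i ∈ Finset.range k, (X:ℤ[X])^i) = k := by
    rw [degree_sub_eq_left_of_degree_lt (by rwa [degree_X_pow]), degree_X_pow]
  exact natDegree_eq_of_degree_eq_some h2

open Polynomial in
lemma bkPsi_aeval {A : Type*} [CommRing A] (k : ℕ) (x : A) :
    aeval x (bkPsi k) = x^k - ∑ i ∈ Finset.range k, x^i := by
  simp [bkPsi]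

lemma bk_root_le_two {k : ℕ} {β : ℂ} (h : β^k = ∑ i ∈ Finset.range k, β^i) : ‖β‖ ≤ 2 := by
  by_contra hcon
  push Not at hcon
  have h1 : ‖β‖^k ≤ ∑ i ∈ Finset.range k, ‖β‖^i := by
    rw [← norm_pow, h]
    exact (norm_sum_le _ _).trans (Finset.sum_le_sum fun i _ => by rw [norm_pow])
  have h2 : (∑ i ∈ Finset.range k, ‖β‖^i) * (‖β‖ - 1) = ‖β‖^k - 1 := geom_sum_mul _ _
  have h3 : 0 ≤ ∑ i ∈ Finset.range k, ‖β‖^i := Finset.sum_nonneg fun i _ => by positivity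
  nlinarith

section
open Polynomial IntermediateField

/-- norm of an integer polynomial value -/
noncomputable def bkNrm (α : ℝ) (P : ℤ[X]) : ℚ := Algebra.norm ℚ (aeval (AdjoinSimple.gen ℚ α) P)

variable {k : ℕ} {α : ℝ}

lemma bk_isInt (hα : α^k = ∑ i ∈ Finset.range k, α^i) : IsIntegral ℤ α := by
  refine ⟨bkPsi k, bkPsi_monic k, ?_⟩
  have := bkPsi_aeval k α
  rw [hα, sub_self] at this
  exact this

lemma bk_fd (hα : α^k = ∑ i ∈ Finset.range k, α^i) : FiniteDimensional ℚ ℚ⟮α⟯ :=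
  adjoin.finiteDimensional ((bk_isInt hα).tower_top)

lemma bk_gen_eq (hα : α^k = ∑ i ∈ Finset.range k, α^i) :
    (AdjoinSimple.gen ℚ α)^k = ∑ i ∈ Finset.range k, (AdjoinSimple.gen ℚ α)^i := by
  apply Subtype.ext
  simpa using hα

lemma bk_gen_int (hα : α^k = ∑ i ∈ Finset.range k, α^i) : IsIntegral ℤ (AdjoinSimple.gen ℚ α) := by
  refine ⟨bkPsi k, bkPsi_monic k, ?_⟩
  have := bkPsi_aeval k (AdjoinSimple.gen ℚ α)
  rw [bk_gen_eq hα, sub_self] at this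
  exact this

lemma bk_aeval_coe (P : ℤ[X]) : ((aeval (AdjoinSimple.gen ℚ α) P : ℚ⟮α⟯) : ℝ) = aeval α P := by
  have := (aeval_algebraMap_apply ℝ (AdjoinSimple.gen ℚ α) P)
  simpa using this.symm

lemma bkNrm_mul (P Q : ℤ[X]) : bkNrm α (P * Q) = bkNrm α P * bkNrm α Q := by
  simp [bkNrm]

lemma bkNrm_pow (P : ℤ[X]) (n : ℕ) : bkNrm α (P^n) = bkNrm α P ^ n := by
  simp [bkNrm]

lemma bkNrm_ge (hα : α^k = ∑ i ∈ Finset.range k, α^i) (P : ℤ[X]) (hP : aeval α P ≠ 0) :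
    1 ≤ |bkNrm α P| := by
  have := bk_fd hα
  have h1 : IsIntegral ℤ (aeval (AdjoinSimple.gen ℚ α) P) := by
    rw [aeval_eq_sum_range]
    exact IsIntegral.sum _ fun i _ => (((bk_gen_int hα).pow i).smul _)
  have h2 : IsIntegral ℤ (bkNrm α P) := Algebra.isIntegral_norm ℚ h1
  obtain ⟨z, hz⟩ := IsIntegrallyClosed.isIntegral_iff.1 h2
  have h3 : bkNrm α P ≠ 0 := by
    unfold bkNrm
    rw [Algebra.norm_ne_zero_iff]
    intro h
    apply hP
    rw [← bk_aeval_coe, h]; rfl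
  rw [← hz] at h3 ⊢
  simp only [eq_intCast] at h3 ⊢
  have : z ≠ 0 := by rintro rfl; simp at h3
  exact_mod_cast Int.one_le_abs this

noncomputable def bkDeg (α : ℝ) : ℕ := Module.finrank ℚ ℚ⟮α⟯

lemma bkDeg_le (hα : α^k = ∑ i ∈ Finset.range k, α^i) : bkDeg α ≤ k := by
  unfold bkDeg
  rw [adjoin.finrank ((bk_isInt hα).tower_top)]
  have h0 : aeval α ((bkPsi k).map (algebraMap ℤ ℚ)) = 0 := by
    rw [aeval_map_algebraMap, bkPsi_aeval, hα, sub_self]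
  have hm := (bkPsi_monic k).map (algebraMap ℤ ℚ)
  have := natDegree_le_of_dvd (minpoly.dvd ℚ α h0) hm.ne_zero
  rwa [(bkPsi_monic k).natDegree_map, bkPsi_natDegree] at this

lemma bkDeg_pos (hα : α^k = ∑ i ∈ Finset.range k, α^i) : 1 ≤ bkDeg α := by
  have := bk_fd hα
  exact Module.finrank_pos

lemma bkNrm_eq_prod [FiniteDimensional ℚ ℚ⟮α⟯] (P : ℤ[X]) :
    ((|bkNrm α P| : ℚ) : ℝ) = (∏ σ : ℚ⟮α⟯ →ₐ[ℚ] ℂ, ‖aeval (σ (AdjoinSimple.gen ℚ α)) P‖) := by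
  have h := Algebra.norm_eq_prod_embeddings ℚ ℂ (aeval (AdjoinSimple.gen ℚ α) P)
  have h2 : ‖(algebraMap ℚ ℂ) (bkNrm α P)‖ = ‖∏ σ : ℚ⟮α⟯ →ₐ[ℚ] ℂ, σ (aeval (AdjoinSimple.gen ℚ α) P)‖ := by
    rw [← h]; rfl
  rw [norm_prod] at h2
  have h3 : ‖(algebraMap ℚ ℂ) (bkNrm α P)‖ = ((|bkNrm α P| : ℚ) : ℝ) := by
    simp
  rw [← h3, h2]
  refine Finset.prod_congr rfl fun σ _ => ?_
  congr 1
  have := aeval_algHom_apply (σ.restrictScalars ℤ) (AdjoinSimple.gen ℚ α) P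
  simpa using this.symm

lemma bk_conj_root (hα : α^k = ∑ i ∈ Finset.range k, α^i) (σ : ℚ⟮α⟯ →ₐ[ℚ] ℂ) :
    (σ (AdjoinSimple.gen ℚ α))^k = ∑ i ∈ Finset.range k, (σ (AdjoinSimple.gen ℚ α))^i := by
  have := congrArg σ (bk_gen_eq hα)
  simpa using this

lemma bk_card_emb [FiniteDimensional ℚ ℚ⟮α⟯] : Fintype.card (ℚ⟮α⟯ →ₐ[ℚ] ℂ) = bkDeg α := by
  exact AlgHom.card ℚ ℚ⟮α⟯ ℂ

lemma bkNrm_le (hα : α^k = ∑ i ∈ Finset.range k, α^i) (P : ℤ[X]) (H : ℝ)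
    (hH : ∀ β : ℂ, ‖β‖ ≤ 2 → ‖aeval β P‖ ≤ H) : ((|bkNrm α P| : ℚ) : ℝ) ≤ H^(bkDeg α) := by
  have := bk_fd hα
  rw [bkNrm_eq_prod]
  refine (Finset.prod_le_prod (fun _ _ => norm_nonneg _) (fun σ _ => hH _ (bk_root_le_two (bk_conj_root hα σ)))).trans ?_
  rw [Finset.prod_const, Finset.card_univ, bk_card_emb]

lemma bk_liouville (hα : α^k = ∑ i ∈ Finset.range k, α^i) (P : ℤ[X]) (H : ℝ) (hH1 : 1 ≤ H)
    (hP : aeval α P ≠ 0)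
    (hH : ∀ β : ℂ, ‖β‖ ≤ 2 → ‖aeval β P‖ ≤ H) : 1 ≤ |aeval α P| * H^(k-1) := by
  classical
  have h1 := bkNrm_ge hα P hP
  have h2 : (1:ℝ) ≤ ((|bkNrm α P| : ℚ) : ℝ) := by exact_mod_cast h1
  have := bk_fd hα
  rw [bkNrm_eq_prod] at h2
  let σ0 : ℚ⟮α⟯ →ₐ[ℚ] ℂ := ((Complex.ofRealAm).restrictScalars ℚ).comp (ℚ⟮α⟯.val)
  rw [← Finset.mul_prod_erase _ _ (Finset.mem_univ σ0)] at h2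
  have h3 : ‖aeval (σ0 (AdjoinSimple.gen ℚ α)) P‖ = |aeval α P| := by
    have e : σ0 (AdjoinSimple.gen ℚ α) = ((α : ℝ) : ℂ) := rfl
    rw [e]
    have := aeval_algebraMap_apply ℂ α P
    simp only [Complex.coe_algebraMap] at this
    rw [this, Complex.norm_real, Real.norm_eq_abs]
  rw [h3] at h2
  refine h2.trans (mul_le_mul_of_nonneg_left ?_ (abs_nonneg _))
  refine (Finset.prod_le_prod (fun _ _ => norm_nonneg _) (fun σ _ => hH _ (bk_root_le_two (bk_conj_root hα σ)))).trans ?_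
  rw [Finset.prod_const, Finset.card_erase_of_mem (Finset.mem_univ _), Finset.card_univ, bk_card_emb]
  exact pow_le_pow_right₀ hH1 (Nat.sub_le_sub_right (bkDeg_le hα) 1)

/-- inverse of α is integral -/
lemma bk_inv_int (hk : 1 ≤ k) (hα : α^k = ∑ i ∈ Finset.range k, α^i) (h0 : α ≠ 0) : IsIntegral ℤ α⁻¹ := by
  obtain ⟨k, rfl⟩ : ∃ j, k = j + 1 := ⟨k - 1, by omega⟩
  have e : α⁻¹ = α^k - ∑ i ∈ Finset.range k, α^i := by
    rw [Finset.sum_range_succ'] at hα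
    have : α * (α^k - ∑ i ∈ Finset.range k, α^i) = 1 := by
      rw [mul_sub, Finset.mul_sum]
      have : ∑ i ∈ Finset.range k, α * α^i = ∑ i ∈ Finset.range k, α^(i+1) :=
        Finset.sum_congr rfl fun i _ => by ring
      rw [this, ← pow_succ', hα]; ring
    exact inv_eq_of_mul_eq_one_right this
  rw [e]
  exact ((bk_isInt hα).pow k).sub (IsIntegral.sum _ fun i _ => (bk_isInt hα).pow i)

lemma bkNrm_X (hk : 1 ≤ k) (hα : α^k = ∑ i ∈ Finset.range k, α^i) : |bkNrm α X| = 1 := by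
  obtain ⟨k, rfl⟩ : ∃ j, k = j + 1 := ⟨k - 1, by omega⟩
  have hg := bk_gen_eq hα
  have : bkNrm α (X * (X^k - ∑ i ∈ Finset.range k, X^i)) = 1 := by
    unfold bkNrm
    have e : aeval (AdjoinSimple.gen ℚ α) ((X:ℤ[X]) * (X^k - ∑ i ∈ Finset.range k, X^i)) = 1 := by
      simp only [map_mul, aeval_X, map_sub, map_pow, map_sum]
      rw [Finset.sum_range_succ'] at hg
      rw [mul_sub, Finset.mul_sum]
      have : ∑ i ∈ Finset.range k, AdjoinSimple.gen ℚ α * AdjoinSimple.gen ℚ α^i = ∑ i ∈ Finset.range k, AdjoinSimple.gen ℚ α^(i+1) :=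
        Finset.sum_congr rfl fun i _ => by ring
      rw [this, ← pow_succ', hg]; ring
    rw [e, map_one]
  have h0 : α ≠ 0 := by
    rintro rfl
    rw [Finset.sum_range_succ'] at hα
    simp at hα
  rw [bkNrm_mul] at this
  have h1 := bkNrm_ge hα X (by simpa using h0)
  have h2 := bkNrm_ge hα (X^k - ∑ i ∈ Finset.range k, X^i) (by
    intro h
    have : bkNrm α (X^k - ∑ i ∈ Finset.range k, X^i) = 0 := by
      have h' : aeval (AdjoinSimple.gen ℚ α) ((X:ℤ[X])^k - ∑ i ∈ Finset.range k, X^i) = 0 := by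
        apply Subtype.ext
        rw [bk_aeval_coe, h]; rfl
      have := bk_fd hα
      unfold bkNrm
      rw [h', Algebra.norm_zero]
    simp_all)
  have h3 : |bkNrm α X| * |bkNrm α (X^k - ∑ i ∈ Finset.range k, X^i)| = 1 := by
    rw [← abs_mul, this, abs_one]
  nlinarith

end

lemma bk_one {ι : Type*} [Fintype ι] [Nonempty ι] (x1 x2 : ι → ℤ) (lg : ι → ℝ) (θ1 θ2 W v E : ℝ)
  (k T S J b M2 yb : ℕ) (hk : 1 ≤ k) (hb : 1 ≤ b)
  (hx1 : ∀ i, |(x1 i : ℝ)| ≤ Real.exp b) (hx2 : ∀ i, |(x2 i : ℝ)| ≤ Real.exp b) (hθ : |θ1|+|θ2| ≤ 6)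
  (hw : ∀ i, |lg i| ≤ W - 1) (hwE : ∀ i, |x1 i*θ1 + x2 i*θ2 - lg i| ≤ E) (hE0 : 0 ≤ E)
  (hv : 0 ≤ v) (hyinj : Function.Injective lg)
  (hL : ∀ (q : ι → ℤ) (s : ℕ) (Q : ℝ), 1 ≤ Q → (∀ i, |(q i:ℝ)| ≤ Q) → ∑ i, (q i:ℝ)*Real.exp (lg i)^s ≠ 0 →
     1 ≤ |∑ i, (q i:ℝ)*Real.exp (lg i)^s| * (Fintype.card ι * Q)^k * Real.exp v ^ s)
  (hT : 4*(22*W+v) ≤ T) (hTk : 6*k+16 ≤ T) (hS : 2*(k+1)*(J+1)*b+1 ≤ S)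
  (hM2 : (J+1)*T ≤ M2 ∨ (M2 = 1 ∧ ∀ i, x2 i = 0)) (hM21 : 1 ≤ M2)
  (hN : 2*(k+1)*((J+1)*T)*M2*S ≤ Fintype.card ι) (hNJ : Fintype.card ι ≤ S*4^J) (hyb : 4*Fintype.card ι ≤ 2^yb) :
  Real.exp (-((T*(4*Fintype.card ι)*(yb+7) : ℕ):ℝ)) < E := by
  by_contra hcon
  push Not at hcon
  set n : ℕ := Fintype.card ι with hn
  have hn1 : 1 ≤ n := Fintype.card_pos
  have hT1 : 1 ≤ T := by omega
  have hn1' : (1:ℝ) ≤ n := by exact_mod_cast hn1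
  have hT1' : (16:ℝ) ≤ T := by
    have : 16 ≤ T := by omega
    exact_mod_cast this
  have hW1 : 1 ≤ W := by
    obtain ⟨i⟩ := ‹Nonempty ι›
    have := (abs_nonneg _).trans (hw i); linarith
  have hTW : 88 * W ≤ T := by linarith
  set Z : ℝ := (T:ℝ) * (4*n) with hZ
  have hZ64 : 64 * n ≤ Z := by rw [hZ]; nlinarith
  have hZn : 8 * (n:ℝ) ≤ Real.exp Z := by
    have := Real.add_one_le_exp Z
    linarith
  have h4W : 4 * n * W ≤ Z/8 := by rw [hZ]; nlinarith
  have hEs : E ≤ Real.exp (-(Z * (yb+7))) := by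
    refine hcon.trans_eq ?_
    congr 1; rw [hZ]; push_cast; ring
  have hyb0 : (0:ℝ) ≤ yb := by positivity
  have hZ0 : 0 ≤ Z := by linarith
  have hE1 : E ≤ Real.exp (-(2*Z)) := hEs.trans (Real.exp_le_exp.2 (by nlinarith))
  have h8 : 8 * n * E ≤ 1 := by
    calc 8 * n * E ≤ Real.exp Z * Real.exp (-(2*Z)) := by gcongr
      _ = Real.exp (-Z) := by rw [← Real.exp_add]; congr 1; ring
      _ ≤ 1 := Real.exp_le_one_iff.2 (by linarith)
  have hE1' : E ≤ 1 := by nlinarith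
  have key := bk_num x1 x2 (fun i => Real.exp (lg i)) θ1 θ2 W v (Real.exp (4*n*W) * (8*n*E)) k T S J b M2 yb hk hb
    hx1 hx2 hθ (fun i => ?_) hv (by positivity) (fun i => Real.exp_pos _) (fun i => ?_)
    (Real.exp_injective.comp hyinj) hL (fun i s hs => ?_) hT hTk hS hM2 hM21 hN hNJ hyb
  · have h1 : Real.exp (4*n*W) * (8*n*E) ≤ Real.exp (Z/8) * (Real.exp (Z/2) * Real.exp (-(Z * (yb+7)))) := by
      have : 8 * (n:ℝ) ≤ Real.exp (Z/2) := by
        have := Real.add_one_le_exp (Z/2)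
        linarith
      gcongr
    have h2 := key.trans_le h1
    rw [← Real.exp_add, ← Real.exp_add, Real.exp_lt_exp] at h2
    have : ((T * (4 * n) * (yb + 6) : ℕ) : ℝ) = Z * (yb + 6) := by rw [hZ]; push_cast; ring
    rw [this] at h2
    nlinarith
  · have h1 := hw i
    have h2 := hwE i
    rw [abs_le] at h1 h2 ⊢
    constructor <;> linarith [h1.1, h1.2, h2.1, h2.2]
  · have h1 := hw i
    rw [abs_le] at h1
    apply Real.exp_le_exp.2; linarith [h1.2]
  · have hs' : (s:ℝ) ≤ 4*n := by exact_mod_cast hs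
    have hs0 : (0:ℝ) ≤ s := by positivity
    set u := x1 i*θ1 + x2 i*θ2 - lg i with hu
    have e1 : Real.exp ((x1 i*θ1 + x2 i*θ2)*s) - Real.exp (lg i)^s = Real.exp (lg i * s) * (Real.exp (u*s) - 1) := by
      rw [← Real.exp_nat_mul, mul_sub, ← Real.exp_add, hu]
      congr 2 <;> ring
    simp only [e1]
    rw [abs_mul, Real.abs_exp]
    have hus : |u * s| ≤ 4*n*E := by
      rw [abs_mul, abs_of_nonneg hs0, mul_comm]
      exact mul_le_mul hs' (hwE i) (abs_nonneg _) (by positivity)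
    have h3 : |Real.exp (u*s) - 1| ≤ 2 * |u*s| := Real.abs_exp_sub_one_le (by linarith)
    have h4 : lg i * s ≤ 4*n*W := by
      have h1 := hw i
      rw [abs_le] at h1
      calc lg i * s ≤ W * s := by gcongr; linarith [h1.2]
        _ ≤ W * (4*n) := by gcongr
        _ = _ := by ring
    exact mul_le_mul (Real.exp_le_exp.2 h4) (by linarith) (abs_nonneg _) (by positivity)

open Polynomial in
lemma bk_hL {ι : Type*} [Fintype ι] [Nonempty ι] {k K : ℕ} {α γ h v : ℝ} (hkK : k ≤ K)
    (hα : α^k = ∑ i ∈ Finset.range k, α^i) (hα1 : 1 < α) (hα2 : α ≤ 2) (hk : 1 ≤ k) (hh : 0 ≤ h)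
    (g1 g2 : ℤ[X]) (hg1 : ∀ β : ℂ, ‖β‖ ≤ 2 → ‖aeval β g1‖ ≤ Real.exp h)
    (hg2 : ∀ β : ℂ, ‖β‖ ≤ 2 → ‖aeval β g2‖ ≤ Real.exp h)
    (hγ : 0 < γ) (hg20 : aeval α g2 ≠ 0) (hγg : γ * aeval α g2 = aeval α g1)
    (l1 l2 l3 : ι → ℕ) (c1 c2 c3 : ℕ) (hl1 : ∀ i, l1 i ≤ c1) (hl2 : ∀ i, l2 i ≤ c2) (hl3 : ∀ i, l3 i ≤ c3)
    (hv : K * (c1 * Real.log 10 + c2 * Real.log 2 + c3 * h) ≤ v)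
    (q : ι → ℤ) (s : ℕ) (Q : ℝ) (hQ : 1 ≤ Q) (hq : ∀ i, |(q i:ℝ)| ≤ Q)
    (hne : ∑ i, (q i:ℝ)*Real.exp (l1 i * Real.log 10 + l2 i * Real.log α + l3 i * Real.log γ)^s ≠ 0) :
     1 ≤ |∑ i, (q i:ℝ)*Real.exp (l1 i * Real.log 10 + l2 i * Real.log α + l3 i * Real.log γ)^s| *
        (Fintype.card ι * Q)^K * Real.exp v ^ s := by
  have hα0 : 0 < α := by linarith
  have hexp : ∀ i, Real.exp (l1 i * Real.log 10 + l2 i * Real.log α + l3 i * Real.log γ) = 10^(l1 i) * α^(l2 i) * γ^(l3 i) := by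
    intro i
    rw [Real.exp_add, Real.exp_add, Real.exp_nat_mul, Real.exp_nat_mul, Real.exp_nat_mul,
      Real.exp_log hα0, Real.exp_log hγ, Real.exp_log (by norm_num)]
  simp only [hexp] at hne ⊢
  set SG := ∑ i, (q i:ℝ)*(10^(l1 i) * α^(l2 i) * γ^(l3 i))^s with hSG
  let P : ℤ[X] := ∑ i, C (q i * 10^(l1 i * s)) * X^(l2 i * s) * g1^(l3 i * s) * g2^((c3 - l3 i) * s)
  have hP : aeval α P = SG * (aeval α g2)^(c3*s) := by
    rw [hSG, Finset.sum_mul, map_sum]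
    refine Finset.sum_congr rfl fun i _ => ?_
    have e : c3 * s = l3 i * s + (c3 - l3 i) * s := by
      rw [← Nat.add_mul, Nat.add_sub_cancel' (hl3 i)]
    rw [e, pow_add]
    simp only [map_mul, map_pow, aeval_X, ← hγg, aeval_C]
    simp only [mul_pow, ← pow_mul, eq_intCast, Int.cast_mul, Int.cast_pow, Int.cast_ofNat]
    ring
  have hP0 : aeval α P ≠ 0 := by
    rw [hP]; exact mul_ne_zero hne (pow_ne_zero _ hg20)
  set n : ℝ := ((Fintype.card ι : ℕ) : ℝ) with hn
  have hn1 : 1 ≤ n := by rw [hn]; exact_mod_cast Fintype.card_pos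
  set V : ℝ := 10^c1 * 2^c2 * Real.exp h^c3 with hV
  have heh : 1 ≤ Real.exp h := Real.one_le_exp hh
  have hV1 : 1 ≤ V := by
    rw [hV]
    exact one_le_mul_of_one_le_of_one_le (one_le_mul_of_one_le_of_one_le (one_le_pow₀ (by norm_num)) (one_le_pow₀ (by norm_num))) (one_le_pow₀ heh)
  have hH : ∀ β : ℂ, ‖β‖ ≤ 2 → ‖aeval β P‖ ≤ n * Q * V^s := by
    intro β hβ
    have : aeval β P = ∑ i, ((q i : ℂ) * 10^(l1 i * s)) * β^(l2 i * s) * (aeval β g1)^(l3 i * s) * (aeval β g2)^((c3 - l3 i)*s) := by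
      simp only [P, map_sum, map_mul, map_pow, aeval_X, aeval_C]
      refine Finset.sum_congr rfl fun i _ => ?_
      simp
    rw [this]
    refine (norm_sum_le _ _).trans ?_
    have : ∀ i ∈ Finset.univ, ‖((q i : ℂ) * 10^(l1 i * s)) * β^(l2 i * s) * (aeval β g1)^(l3 i * s) * (aeval β g2)^((c3 - l3 i)*s)‖ ≤ Q * V^s := by
      intro i _
      simp only [norm_mul, norm_pow]
      have e : Q * V^s = (Q * 10^(c1*s)) * 2^(c2*s) * Real.exp h^(l3 i * s) * Real.exp h^((c3 - l3 i) * s) := by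
        have e : c3 * s = l3 i * s + (c3 - l3 i) * s := by
          rw [← Nat.add_mul, Nat.add_sub_cancel' (hl3 i)]
        rw [hV, mul_pow, mul_pow, ← pow_mul, ← pow_mul, ← pow_mul, e, pow_add]; ring
      rw [e]
      have h10 : ‖(10:ℂ)‖ = 10 := by simp
      have hqi : ‖(q i : ℂ)‖ ≤ Q := by
        have := hq i
        rwa [Complex.norm_intCast]
      rw [h10]
      have hβ2 : ‖β‖^(l2 i * s) ≤ 2^(c2*s) :=
        (pow_le_pow_left₀ (norm_nonneg _) hβ _).trans (pow_le_pow_right₀ (by norm_num) (Nat.mul_le_mul_right _ (hl2 i)))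
      have h101 : (10:ℝ)^(l1 i * s) ≤ 10^(c1*s) := pow_le_pow_right₀ (by norm_num) (Nat.mul_le_mul_right _ (hl1 i))
      gcongr
      · exact hg1 β hβ
      · exact hg2 β hβ
    refine (Finset.sum_le_sum this).trans_eq ?_
    rw [Finset.sum_const, Finset.card_univ, nsmul_eq_mul, ← hn]; ring
  have hVs1 : 1 ≤ V^s := one_le_pow₀ hV1
  have hnQ : 1 ≤ n * Q := one_le_mul_of_one_le_of_one_le hn1 hQ
  have hH1 : 1 ≤ n * Q * V^s := one_le_mul_of_one_le_of_one_le hnQ hVs1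
  have := bk_liouville hα P _ hH1 hP0 hH
  rw [hP, abs_mul, abs_pow] at this
  have hg2a : |aeval α g2| ≤ Real.exp h := by
    have h1 := hg2 (α:ℂ) (by rw [Complex.norm_real, Real.norm_eq_abs, abs_of_pos hα0]; exact hα2)
    have h2 := aeval_algebraMap_apply ℂ α g2
    simp only [Complex.coe_algebraMap] at h2
    rwa [h2, Complex.norm_real, Real.norm_eq_abs] at h1
  refine this.trans ?_
  have h5 : |aeval α g2|^(c3*s) ≤ V^s := by
    refine (pow_le_pow_left₀ (abs_nonneg _) hg2a _).trans ?_
    rw [pow_mul]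
    refine pow_le_pow_left₀ (by positivity) ?_ _
    rw [hV]
    exact le_mul_of_one_le_left (by positivity) (one_le_mul_of_one_le_of_one_le (one_le_pow₀ (by norm_num)) (one_le_pow₀ (by norm_num)))
  have h6 : V^K ≤ Real.exp v := by
    have hV' : V = Real.exp (c1 * Real.log 10 + c2 * Real.log 2 + c3 * h) := by
      rw [Real.exp_add, Real.exp_add, Real.exp_nat_mul, Real.exp_nat_mul, Real.exp_nat_mul,
        Real.exp_log (by norm_num), Real.exp_log (by norm_num)]
    rw [hV', ← Real.exp_nat_mul]
    exact Real.exp_le_exp.2 hv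
  calc |SG| * |aeval α g2|^(c3*s) * (n*Q*V^s)^(k-1) ≤ |SG| * V^s * ((n*Q)^(k-1) * (V^s)^(k-1)) := by
        rw [mul_pow]; gcongr
    _ = |SG| * (n*Q)^(k-1) * (V^s)^(k-1+1) := by ring
    _ ≤ |SG| * (n*Q)^K * (V^s)^K := by
        have a1 : (n*Q)^(k-1) ≤ (n*Q)^K := pow_le_pow_right₀ hnQ (by omega)
        have a2 : (V^s)^(k-1+1) ≤ (V^s)^K := pow_le_pow_right₀ hVs1 (by omega)
        gcongr
    _ = |SG| * (n*Q)^K * (V^K)^s := by rw [← pow_mul, ← pow_mul, mul_comm s K]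
    _ ≤ |SG| * (n*Q)^K * Real.exp v^s := by
        have : 0 ≤ n * Q := by linarith
        gcongr

/-- multiplicative independence of 10 and α -/
lemma bk_indep {k : ℕ} {α : ℝ} (hk : 1 ≤ k) (hα : α^k = ∑ i ∈ Finset.range k, α^i) (hα1 : 1 < α)
    (A B : ℤ) (h : A * Real.log 10 = B * Real.log α) : A = 0 ∧ B = 0 := by
  have hα0 : 0 < α := by linarith
  have hl : 0 < Real.log α := Real.log_pos hα1
  have hl10 : 0 < Real.log 10 := Real.log_pos (by norm_num)
  have pos : ∀ A B : ℤ, A * Real.log 10 = B * Real.log α → 0 < A → False := by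
    intro A B h hA
    have hB : 0 < B := by
      have : 0 < (B:ℝ) * Real.log α := by rw [← h]; exact mul_pos (by exact_mod_cast hA) hl10
      exact_mod_cast (pos_iff_pos_of_mul_pos this).2 hl
    lift A to ℕ using hA.le
    lift B to ℕ using hB.le
    have e : (10:ℝ)^A = α^B := by
      rw [← Real.exp_log hα0, ← Real.exp_nat_mul, ← Real.exp_log (show (0:ℝ) < 10 by norm_num), ← Real.exp_nat_mul]
      first | (congr 1; exact_mod_cast h) | congr 1
    have e2 : ((1/10^A : ℚ) : ℝ) = (α⁻¹)^B := by
      push_cast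
      rw [e, inv_pow, one_div]
    have h1 : IsIntegral ℤ ((1/10^A : ℚ) : ℝ) := by
      rw [e2]; exact (bk_inv_int hk hα hα0.ne').pow B
    have h2 : IsIntegral ℤ (1/10^A : ℚ) := by
      have := (isIntegral_algebraMap_iff (R := ℤ) (A := ℚ) (B := ℝ) (algebraMap ℚ ℝ).injective (x := (1/10^A : ℚ))).1
      exact this h1
    obtain ⟨z, hz⟩ := IsIntegrallyClosed.isIntegral_iff.1 h2
    simp only [eq_intCast] at hz
    have hA1 : 1 ≤ A := by exact_mod_cast hA
    have h3 : (1:ℚ) < 10^A := one_lt_pow₀ (by norm_num) (by omega)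
    have h4 : (0:ℚ) < 1/10^A := by positivity
    have h5 : (1/10^A : ℚ) < 1 := by rw [div_lt_one (by positivity)]; exact h3
    rw [← hz] at h4 h5
    have h6 : 0 < z := by exact_mod_cast h4
    have h7 : z < 1 := by exact_mod_cast h5
    omega
  have hA : A = 0 := by
    rcases lt_trichotomy A 0 with h1 | h1 | h1
    · exact (pos (-A) (-B) (by push_cast; linarith) (by omega)).elim
    · exact h1
    · exact (pos A B h h1).elim
  refine ⟨hA, ?_⟩
  rw [hA] at h
  have : (B:ℝ) * Real.log α = 0 := by rw [← h]; simp
  rcases mul_eq_zero.1 this with h1 | h1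
  · exact_mod_cast h1
  · exact absurd h1 hl.ne'

lemma bk_log10_lt : Real.log 10 < 2.3106 := by
  have h1 : Real.log (10^3) < Real.log (2^10) := Real.log_lt_log (by norm_num) (by norm_num)
  rw [Real.log_pow, Real.log_pow] at h1
  have := Real.log_two_lt_d9
  push_cast at h1
  linarith

lemma bk_absub (a b : ℕ) (c : ℤ) (ha : (a:ℤ) ≤ c) (hb : (b:ℤ) ≤ c) : |(a:ℤ) - b| ≤ c := by
  rw [abs_le]; constructor <;> omega

lemma bk_aux1 (h z : ℝ) (hh : 1 ≤ h) (hz : 1 ≤ z) : 12*z ≤ 60*h*z^2 := by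
  have : z * 1 ≤ z * (h*z) := mul_le_mul_of_nonneg_left (by nlinarith) (by linarith)
  nlinarith

lemma bk_aux2 (h z D : ℝ) (hh : 1 ≤ h) (hz : 1 ≤ z) (hD : 1 ≤ D) : D*(12*z) ≤ 12*h*z^2*D := by
  have : z * 1 ≤ z * (h*z) := mul_le_mul_of_nonneg_left (by nlinarith) (by linarith)
  nlinarith

lemma bk_aux3 (h z c : ℝ) (hh : 1 ≤ h) (hz : 1 ≤ z) (hc : c ≤ 17) : c*h*z ≤ 170*h^2*z^2 := by
  have h1 : 1 ≤ h*z := by nlinarith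
  nlinarith

/-- arithmetic conditions on the Baker parameters -/
def bkCond (K h b z J yb D : ℕ) : Prop :=
  16*(K+1)*(J+1)^2*(814+36*K)^2*(2*(K+1)*(J+1)*b+1) ≤ 510*z ∧
  1020*h^2*z^3 ≤ (2*(K+1)*(J+1)*b+1)*4^J ∧ 4080*h^2*z^3 ≤ 2^yb ∧
  264*h*z^2*D+170*h^2*z^2 ≤ 2^b

def bkX (K h z yb : ℕ) : ℕ := 4*(4*h*z*(814+36*K))*(1020*h^2*z^3)*(yb+8)

set_option maxHeartbeats 4000000 in
open Polynomial in
lemma bk_three {k K : ℕ} {α γ : ℝ} (hkK : k ≤ K)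
    (hα : α^k = ∑ i ∈ Finset.range k, α^i) (hα1 : 1 < α) (hα2 : α ≤ 2) (hα6 : 2/5 ≤ Real.log α) (hk : 1 ≤ k)
    (h b z J yb D d N : ℕ) (hh : 1 ≤ h) (hb1 : 1 ≤ b) (hz1 : 1 ≤ z)
    (g1 g2 : ℤ[X]) (hg1 : ∀ β : ℂ, ‖β‖ ≤ 2 → ‖aeval β g1‖ ≤ Real.exp h)
    (hg2 : ∀ β : ℂ, ‖β‖ ≤ 2 → ‖aeval β g2‖ ≤ Real.exp h)
    (hγ : 0 < γ) (hg20 : aeval α g2 ≠ 0) (hγg : γ * aeval α g2 = aeval α g1)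
    (hγh : |Real.log γ| ≤ h) (hd : d ≤ D) (hN : N ≤ D) (hD1 : 1 ≤ D)
    (hc : bkCond K h b z J yb D)
    (hΛ : Real.log γ + d * Real.log 10 - N * Real.log α ≠ 0) :
    Real.exp (-(bkX K h z yb : ℝ)) < |Real.log γ + d * Real.log 10 - N * Real.log α| := by
  obtain ⟨hcz, hcJ, hcyb, hcb⟩ := hc
  set S : ℕ := 2*(K+1)*(J+1)*b+1 with hS
  set T : ℕ := 4*h*z*(814+36*K) with hT
  set L := Real.log γ + d * Real.log 10 - N * Real.log α with hL
  have hl10 := bk_log10_lt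
  have hl2 := Real.log_two_lt_d9
  have hl10p : 0 < Real.log 10 := Real.log_pos (by norm_num)
  have hlα2 : Real.log α ≤ Real.log 2 := Real.log_le_log (by linarith) hα2
  have hhz : 1 ≤ h * z := Nat.mul_pos hh hz1
  have hhz' : (1:ℝ) ≤ h * z := by exact_mod_cast hhz
  have hlα : |Real.log α| = Real.log α := abs_of_pos (by linarith)
  have hh0 : (0:ℝ) ≤ h := by positivity
  have hh1 : (1:ℝ) ≤ h := by exact_mod_cast hh
  have hz1' : (1:ℝ) ≤ z := by exact_mod_cast hz1
  have hD1' : (1:ℝ) ≤ D := by exact_mod_cast hD1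
  have hd' : (d:ℝ) ≤ D := by exact_mod_cast hd
  have hN' : (N:ℝ) ≤ D := by exact_mod_cast hN
  have hexpb : (264*h*z^2*D+170*h^2*z^2 : ℝ) ≤ Real.exp b := by
    have h1 : ((264*h*z^2*D+170*h^2*z^2 : ℕ) : ℝ) ≤ ((2^b : ℕ) : ℝ) := by exact_mod_cast hcb
    have h2 : (2:ℝ)^b ≤ Real.exp b := by
      rw [← Real.exp_one_pow]
      exact pow_le_pow_left₀ (by norm_num) (by have := Real.add_one_le_exp (1:ℝ); linarith) _
    push_cast at h1
    linarith
  set v : ℝ := 36 * (h*z) * K with hv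
  set W : ℝ := 37 * (h*z) with hW
  have hv0 : 0 ≤ v := by positivity
  have hK1 : 1 ≤ K := hk.trans hkK
  have hTle : 4*(22*W+v) ≤ T := by
    rw [hT, hv, hW]; push_cast; apply le_of_eq; ring
  have hTge : (h*z)*(814+36*K) ≤ T := by
    rw [hT, show 4*h*z*(814+36*K) = 4*(h*z*(814+36*K)) by ring]; omega
  have hTk : 6*K+16 ≤ T := by
    have : 1 * (814+36*K) ≤ (h*z)*(814+36*K) := Nat.mul_le_mul_right _ hhz
    omega
  have hvle : (K:ℝ) * (((5*h*z : ℕ):ℝ) * Real.log 10 + ((17*h*z : ℕ):ℝ) * Real.log 2 + ((12*z : ℕ):ℝ) * h) ≤ v := by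
    rw [hv]
    push_cast
    have : 5 * (h*z) * Real.log 10 + 17*(h*z)* Real.log 2 + 12*(h*z) ≤ 36 * (h*z : ℝ) := by
      have q1 := mul_le_mul_of_nonneg_left hl10.le (show (0:ℝ) ≤ 5*(h*z) by positivity)
      have q2 := mul_le_mul_of_nonneg_left hl2.le (show (0:ℝ) ≤ 17*(h*z) by positivity)
      linarith
    have hK0 : (0:ℝ) ≤ K := by positivity
    calc (K:ℝ) * (5 * h*z * Real.log 10 + 17*h*z* Real.log 2 + 12*z*h) = (K:ℝ) * (5 * (h*z) * Real.log 10 + 17*(h*z)* Real.log 2 + 12*(h*z)) := by ring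
      _ ≤ K * (36 * (h*z)) := by gcongr
      _ = _ := by ring
  set n : ℕ := 1020*h^2*z^3 with hn
  have hn1 : 1 ≤ n := by
    rw [hn]; exact Nat.mul_pos (Nat.mul_pos (by norm_num) (pow_pos hh 2)) (pow_pos hz1 3)
  have hX : (bkX K h z yb : ℝ) = ((T*(4*n)*(yb+8) : ℕ) : ℝ) := by
    unfold bkX; rw [← hT, ← hn]; push_cast; ring
  have h60 : (60*h*z^2 : ℝ) ≤ n := by
    rw [hn]; push_cast
    have : (h*z^2 : ℝ) ≤ h^2*z^3 := by
      have : (h*z^2 : ℝ) * 1 ≤ (h*z^2) * (h*z) := mul_le_mul_of_nonneg_left hhz' (by positivity)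
      linarith [show (h*z^2 : ℝ) * (h*z) = h^2*z^3 by ring]
    linarith [show (0:ℝ) ≤ h*z^2 by positivity]
  have hT16 : 16 ≤ T := by omega
  have hnT : (n:ℝ) ≤ Real.exp ((T*(4*n) : ℕ) : ℝ) := by
    have h1 := Real.add_one_le_exp ((T*(4*n) : ℕ) : ℝ)
    have h2 : n ≤ T*(4*n) := by
      have := Nat.mul_le_mul_right (4*n) hT16
      omega
    have h3 : (n:ℝ) ≤ ((T*(4*n) : ℕ) : ℝ) := by exact_mod_cast h2
    linarith
  -- it suffices to bound after multiplication
  have fin : ∀ c m : ℕ, (c:ℝ) ≤ 60*h*z^2 → m ≤ n → Real.exp (-((T*(4*m)*(yb+7) : ℕ):ℝ)) < c * |L| →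
      Real.exp (-(bkX K h z yb : ℝ)) < |L| := by
    intro c m hc hm hlt
    rw [hX]
    have h1 : Real.exp (-((T*(4*n)*(yb+7) : ℕ):ℝ)) < n * |L| := by
      refine lt_of_le_of_lt (Real.exp_le_exp.2 ?_) (hlt.trans_le ?_)
      · have : T*(4*m)*(yb+7) ≤ T*(4*n)*(yb+7) := by gcongr
        have : ((T*(4*m)*(yb+7) : ℕ):ℝ) ≤ ((T*(4*n)*(yb+7) : ℕ):ℝ) := by exact_mod_cast this
        linarith
      · exact mul_le_mul_of_nonneg_right (hc.trans h60) (abs_nonneg _)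
    have h2 : Real.exp (-((T*(4*n)*(yb+8) : ℕ):ℝ)) = Real.exp (-((T*(4*n)*(yb+7) : ℕ):ℝ)) * Real.exp (-((T*(4*n) : ℕ) : ℝ)) := by
      rw [← Real.exp_add]; congr 1; push_cast; ring
    rw [h2, Real.exp_neg ((T*(4*n) : ℕ) : ℝ), ← div_eq_mul_inv, div_lt_iff₀ (Real.exp_pos _)]
    refine h1.trans_le ?_
    rw [mul_comm]
    gcongr
  have hSle : 2*(K+1)*(J+1)*b+1 ≤ S := le_of_eq hS.symm
  have hhzN : 1 ≤ 5*h*z := by rw [Nat.mul_assoc]; omega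
  have hhzN2 : 1 ≤ 17*h*z := by rw [Nat.mul_assoc]; omega
  have hNe1 : NeZero (5*h*z) := ⟨by omega⟩
  have hNe2 : NeZero (17*h*z) := ⟨by omega⟩
  have hNe3 : NeZero (12*z) := ⟨by omega⟩
  let ι := Fin (5*h*z) × Fin (17*h*z) × Fin (12*z)
  have hcard : Fintype.card ι = n := by
    simp only [ι, Fintype.card_prod, Fintype.card_fin, hn]; ring
  have bnd : ∀ l1 l2 l3 : ℕ, l1 ≤ 5*h*z → l2 ≤ 17*h*z → l3 ≤ 12*z →
      |l1 * Real.log 10 + l2 * Real.log α + l3 * Real.log γ| ≤ W - 1 := by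
    intro l1 l2 l3 h1 h2 h3
    have h1' : (l1:ℝ) ≤ 5*h*z := by exact_mod_cast h1
    have h2' : (l2:ℝ) ≤ 17*h*z := by exact_mod_cast h2
    have h3' : (l3:ℝ) ≤ 12*z := by exact_mod_cast h3
    have a1 : |l1 * Real.log 10| ≤ 5*h*z * 2.3106 := by
      rw [abs_mul, abs_of_pos hl10p, Nat.abs_cast]
      exact mul_le_mul h1' hl10.le hl10p.le (by positivity)
    have a2 : |l2 * Real.log α| ≤ 17*h*z * 0.6932 := by
      rw [abs_mul, hlα, Nat.abs_cast]
      exact mul_le_mul h2' (by linarith) (by linarith) (by positivity)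
    have a3 : |l3 * Real.log γ| ≤ 12*z*h := by
      rw [abs_mul, Nat.abs_cast]
      exact mul_le_mul h3' hγh (abs_nonneg _) (by positivity)
    have := abs_add_three (l1 * Real.log 10) (l2 * Real.log α) (l3 * Real.log γ)
    rw [hW]
    linarith
  by_cases hinj : Function.Injective (fun i : ι => ((i.1:ℕ):ℝ) * Real.log 10 + ((i.2.1:ℕ):ℝ) * Real.log α + ((i.2.2:ℕ):ℝ) * Real.log γ)
  · refine fin (12*z) n ?_ le_rfl ?_
    · push_cast; exact bk_aux1 _ _ hh1 hz1'
    have key := bk_one (ι := ι) (fun i => ((i.1:ℕ):ℤ) - d * ((i.2.2:ℕ):ℤ)) (fun i => ((i.2.1:ℕ):ℤ) + N * ((i.2.2:ℕ):ℤ))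
      (fun i : ι => ((i.1:ℕ):ℝ) * Real.log 10 + ((i.2.1:ℕ):ℝ) * Real.log α + ((i.2.2:ℕ):ℝ) * Real.log γ)
      (Real.log 10) (Real.log α) W v ((12*z : ℕ) * |L|) K T S J b ((J+1)*T) yb hK1 hb1 (fun i => ?_) (fun i => ?_)
      (by rw [abs_of_pos hl10p, hlα]; linarith) (fun i => bnd _ _ _ i.1.2.le i.2.1.2.le i.2.2.2.le) (fun i => ?_)
      (by positivity) hv0 hinj
      (fun q s Q hQ hq hne => bk_hL hkK hα hα1 hα2 hk hh0 g1 g2 hg1 hg2 hγ hg20 hγg (fun i : ι => (i.1:ℕ)) (fun i : ι => (i.2.1:ℕ))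
        (fun i : ι => (i.2.2:ℕ)) (5*h*z) (17*h*z) (12*z) (fun i => i.1.2.le) (fun i => i.2.1.2.le) (fun i => i.2.2.2.le) hvle q s Q hQ hq hne)
      hTle hTk hSle (Or.inl le_rfl) (Nat.mul_pos (by omega) (by omega)) ?_ (by rw [hcard]; exact hcJ) (by rw [hcard, hn]; linarith)
    · rwa [hcard] at key
    · have h1 : ((i.1:ℕ):ℝ) ≤ 5*h*z := by exact_mod_cast i.1.2.le
      have h3 : ((i.2.2:ℕ):ℝ) ≤ 12*z := by exact_mod_cast i.2.2.2.le
      refine le_trans ?_ hexpb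
      push_cast
      have a1 : (d:ℝ) * ((i.2.2:ℕ):ℝ) ≤ D * (12*z) := mul_le_mul hd' h3 (by positivity) (by positivity)
      have a0 : 0 ≤ (d:ℝ) * ((i.2.2:ℕ):ℝ) := by positivity
      have a2 : (D:ℝ) * (12*z) ≤ 12 * h * z^2 * D := bk_aux2 _ _ _ hh1 hz1' hD1'
      have a3 : 5*h*z ≤ 170*h^2*(z^2:ℝ) := bk_aux3 _ _ _ hh1 hz1' (by norm_num)
      have a4 : 0 ≤ (h:ℝ) * z^2 * D := by positivity
      rw [abs_le]; constructor <;> linarith [show (0:ℝ) ≤ ((i.1:ℕ):ℝ) by positivity]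
    · have h1 : ((i.2.1:ℕ):ℝ) ≤ 17*h*z := by exact_mod_cast i.2.1.2.le
      have h3 : ((i.2.2:ℕ):ℝ) ≤ 12*z := by exact_mod_cast i.2.2.2.le
      refine le_trans ?_ hexpb
      push_cast
      have a1 : (N:ℝ) * ((i.2.2:ℕ):ℝ) ≤ D * (12*z) := mul_le_mul hN' h3 (by positivity) (by positivity)
      have a0 : 0 ≤ (N:ℝ) * ((i.2.2:ℕ):ℝ) := by positivity
      have a2 : (D:ℝ) * (12*z) ≤ 12 * h * z^2 * D := bk_aux2 _ _ _ hh1 hz1' hD1'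
      have a3 : 17*h*z ≤ 170*h^2*(z^2:ℝ) := bk_aux3 _ _ _ hh1 hz1' (by norm_num)
      have a4 : 0 ≤ (h:ℝ) * z^2 * D := by positivity
      rw [abs_le]; constructor <;> linarith [show (0:ℝ) ≤ ((i.2.1:ℕ):ℝ) by positivity]
    · have h3 : ((i.2.2:ℕ):ℝ) ≤ ((12*z : ℕ):ℝ) := by exact_mod_cast i.2.2.2.le
      have e : (((((i.1:ℕ):ℤ) - d * ((i.2.2:ℕ):ℤ) : ℤ) : ℝ)) * Real.log 10 + ((((i.2.1:ℕ):ℤ) + N * ((i.2.2:ℕ):ℤ) : ℤ) : ℝ) * Real.log α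
         - (((i.1:ℕ):ℝ) * Real.log 10 + ((i.2.1:ℕ):ℝ) * Real.log α + ((i.2.2:ℕ):ℝ) * Real.log γ) = - (((i.2.2:ℕ):ℝ) * L) := by
        rw [hL]; push_cast; ring
      simp only [e]
      rw [abs_neg, abs_mul, Nat.abs_cast]
      gcongr
    · rw [hcard, hn]
      have : 2 * (K + 1) * ((J + 1) * T) * ((J + 1) * T) * S = 2*h^2*z^2*(16*(K+1)*(J+1)^2*(814+36*K)^2*S) := by
        rw [hT]; ring
      rw [this]
      calc 2*h^2*z^2*(16*(K+1)*(J+1)^2*(814+36*K)^2*S) ≤ 2*h^2*z^2*(510*z) := by gcongr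
        _ = _ := by ring
  · -- degenerate case
    rw [Function.Injective] at hinj
    push Not at hinj
    obtain ⟨i, j, hij, hne⟩ := hinj
    set a1 : ℤ := ((i.1:ℕ):ℤ) - ((j.1:ℕ):ℤ) with ha1
    set a2 : ℤ := ((i.2.1:ℕ):ℤ) - ((j.2.1:ℕ):ℤ) with ha2
    set a3 : ℤ := ((i.2.2:ℕ):ℤ) - ((j.2.2:ℕ):ℤ) with ha3
    have hrel : a1 * Real.log 10 + a2 * Real.log α + a3 * Real.log γ = 0 := by
      rw [ha1, ha2, ha3]; push_cast; linarith
    have b1 : |a1| ≤ 5*h*z := by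
      exact bk_absub _ _ _ (by exact_mod_cast i.1.2.le) (by exact_mod_cast j.1.2.le)
    have b2 : |a2| ≤ 17*h*z := by
      exact bk_absub _ _ _ (by exact_mod_cast i.2.1.2.le) (by exact_mod_cast j.2.1.2.le)
    have b3 : |a3| ≤ 12*z := by
      exact bk_absub _ _ _ (by exact_mod_cast i.2.2.2.le) (by exact_mod_cast j.2.2.2.le)
    have ha30 : a3 ≠ 0 := by
      intro h0
      rw [h0] at hrel
      have := bk_indep hk hα hα1 a1 (-a2) (by push_cast at hrel ⊢; linarith)
      apply hne
      refine Prod.ext (Fin.ext ?_) (Prod.ext (Fin.ext ?_) (Fin.ext ?_)) <;> omega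
    set A : ℤ := a3 * d - a1 with hA
    set B : ℤ := a3 * N + a2 with hB
    have hAB : a3 * L = A * Real.log 10 - B * Real.log α := by
      rw [hL, hA, hB]; push_cast; linarith
    have b1' : |(a1:ℝ)| ≤ 5*h*z := by exact_mod_cast b1
    have b2' : |(a2:ℝ)| ≤ 17*h*z := by exact_mod_cast b2
    have b3' : |(a3:ℝ)| ≤ 12*z := by exact_mod_cast b3
    by_cases hA0 : A = 0
    · have hB0 : B ≠ 0 := by
        intro h0
        rw [hA0, h0] at hAB
        simp at hAB
        rcases hAB with h1 | h1
        · exact ha30 (by exact_mod_cast h1)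
        · exact hΛ h1
      refine fin (12*z) n ?_ le_rfl ?_
      · push_cast; exact bk_aux1 _ _ hh1 hz1'
      have hBa : (1:ℝ) ≤ |(B:ℝ)| := by exact_mod_cast Int.one_le_abs hB0
      have h1 : |(a3:ℝ)| * |L| = |(B:ℝ)| * Real.log α := by
        rw [← abs_mul, hAB, hA0]; simp [abs_mul, hlα]
      have h2 : 2/5 ≤ |(a3:ℝ)| * |L| := by
        rw [h1]
        have := mul_le_mul_of_nonneg_right hBa (show 0 ≤ Real.log α by linarith)
        linarith
      have h3 : |(a3:ℝ)| * |L| ≤ (12*z : ℕ) * |L| := by push_cast; gcongr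
      refine lt_of_lt_of_le ?_ (h2.trans h3)
      have : 1 ≤ T*(4*n)*(yb+7) := Nat.mul_pos (Nat.mul_pos (by omega) (by omega)) (by omega)
      have h4 : (1:ℝ) ≤ ((T*(4*n)*(yb+7) : ℕ):ℝ) := by exact_mod_cast this
      have h5 : Real.exp (-((T*(4*n)*(yb+7) : ℕ):ℝ)) ≤ Real.exp (-1) := Real.exp_le_exp.2 (by linarith)
      have h6 := Real.exp_neg_one_lt_d9
      linarith
    have hA1 : (1:ℝ) ≤ |(A:ℝ)| := by exact_mod_cast Int.one_le_abs hA0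
    have hAne : (A:ℝ) ≠ 0 := by exact_mod_cast hA0
    let ι' := Fin (5*h*z) × Fin (17*h*z)
    have hcard' : Fintype.card ι' = 85*h^2*z^2 := by
      simp only [ι', Fintype.card_prod, Fintype.card_fin]; ring
    have hn' : 85*h^2*z^2 ≤ n := by
      rw [hn]
      have q : h^2*z^2*1 ≤ h^2*z^2*z := Nat.mul_le_mul_left _ hz1
      have q2 : 85*h^2*z^2 = 85*(h^2*z^2*1) := by ring
      have q3 : 1020*h^2*z^3 = 1020*(h^2*z^2*z) := by ring
      omega
    have c1 : |(A:ℝ)| ≤ 12*z*D + 5*h*z := by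
      rw [hA]; push_cast
      refine (abs_sub _ _).trans ?_
      rw [abs_mul, Nat.abs_cast]
      gcongr
    have c2 : |(B:ℝ)| ≤ 12*z*D + 17*h*z := by
      rw [hB]; push_cast
      refine (abs_add_le _ _).trans ?_
      rw [abs_mul, Nat.abs_cast]
      gcongr
    refine fin (60*h*z^2) (85*h^2*z^2) (by push_cast; exact le_rfl) hn' ?_
    have key := bk_one (ι := ι') (fun i => ((i.1:ℕ):ℤ) * B + ((i.2:ℕ):ℤ) * A) (fun i => 0)
      (fun i : ι' => ((i.1:ℕ):ℝ) * Real.log 10 + ((i.2:ℕ):ℝ) * Real.log α + (((fun _ => 0 : ι' → ℕ) i : ℕ) : ℝ) * Real.log γ)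
      (Real.log α / A) 0 W v ((60*h*z^2 : ℕ) * |L|) K T S J b 1 yb hK1 hb1 (fun i => ?_) (fun i => ?_)
      ?_ (fun i => bnd _ _ _ i.1.2.le i.2.2.le (Nat.zero_le _)) (fun i => ?_)
      (by positivity) hv0 ?_
      (fun q s Q hQ hq hne => bk_hL hkK hα hα1 hα2 hk hh0 g1 g2 hg1 hg2 hγ hg20 hγg (fun i : ι' => (i.1:ℕ)) (fun i : ι' => (i.2:ℕ))
        (fun _ => 0) (5*h*z) (17*h*z) (12*z) (fun i => i.1.2.le) (fun i => i.2.2.le) (fun i => Nat.zero_le _) hvle q s Q hQ hq hne)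
      hTle hTk hSle (Or.inr ⟨rfl, fun _ => rfl⟩) le_rfl ?_ (by rw [hcard']; exact hn'.trans hcJ) (by rw [hcard']; linarith)
    · rwa [hcard'] at key
    · have h1 : ((i.1:ℕ):ℝ) ≤ 5*h*z := by exact_mod_cast i.1.2.le
      have h2 : ((i.2:ℕ):ℝ) ≤ 17*h*z := by exact_mod_cast i.2.2.le
      refine le_trans ?_ hexpb
      push_cast
      refine (abs_add_le _ _).trans ?_
      rw [abs_mul, abs_mul, Nat.abs_cast, Nat.abs_cast]
      have d1 : ((i.1:ℕ):ℝ) * |(B:ℝ)| ≤ (5*h*z) * (12*z*D + 17*h*z) := mul_le_mul h1 c2 (abs_nonneg _) (by positivity)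
      have d2 : ((i.2:ℕ):ℝ) * |(A:ℝ)| ≤ (17*h*z) * (12*z*D + 5*h*z) := mul_le_mul h2 c1 (abs_nonneg _) (by positivity)
      refine (add_le_add d1 d2).trans (le_of_eq ?_)
      ring
    · simp; positivity
    · rw [abs_zero, add_zero, abs_div, hlα, div_le_iff₀ (by linarith)]
      linarith
    · have h1 : ((i.1:ℕ):ℝ) ≤ 5*h*z := by exact_mod_cast i.1.2.le
      have e : ((((i.1:ℕ):ℤ) * B + ((i.2:ℕ):ℤ) * A : ℤ) : ℝ) * (Real.log α / A) + ((0:ℤ):ℝ) * 0 -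
         (((i.1:ℕ):ℝ) * Real.log 10 + ((i.2:ℕ):ℝ) * Real.log α + ((0:ℕ):ℝ) * Real.log γ) = -(((i.1:ℕ):ℝ) * (a3 * L) / A) := by
        rw [hAB]; push_cast; field_simp; ring
      simp only [e]
      rw [abs_neg, abs_div, div_le_iff₀ (by linarith), abs_mul, abs_mul, Nat.abs_cast]
      push_cast
      calc ((i.1:ℕ):ℝ) * (|(a3:ℝ)| * |L|) ≤ (5*h*z) * ((12*z)*|L|) := by gcongr
        _ = 60*h*z^2*|L| * 1 := by ring
        _ ≤ _ := by gcongr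
    · intro i j hij
      simp only [Nat.cast_zero, zero_mul, add_zero] at hij
      have := bk_indep hk hα hα1 (((i.1:ℕ):ℤ) - ((j.1:ℕ):ℤ)) (((j.2:ℕ):ℤ) - ((i.2:ℕ):ℤ)) (by push_cast; linarith)
      refine Prod.ext (Fin.ext ?_) (Fin.ext ?_) <;> omega
    · rw [hcard']
      have e1 : 16*(K+1)*(J+1)^2*(814+36*K)^2*S = (2*(K+1)*(J+1)*(814+36*K)*S)*(8*(J+1)*(814+36*K)) := by ring
      have e2 : 6512 ≤ 8*(J+1)*(814+36*K) := Nat.mul_le_mul (show 8 ≤ 8*(J+1) by omega) (show 814 ≤ 814+36*K by omega)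
      have e3 : (2*(K+1)*(J+1)*(814+36*K)*S)*6512 ≤ 510*z := by
        refine le_trans ?_ hcz
        rw [e1]; gcongr
      have e4 : 2*(K+1)*(J+1)*(814+36*K)*S ≤ z := by omega
      calc 2 * (K + 1) * ((J + 1) * T) * 1 * S = 4*h*z*(2*(K+1)*(J+1)*(814+36*K)*S) := by rw [hT]; ring
        _ ≤ 4*h*z*z := by gcongr
        _ ≤ 85*h^2*z^2 := by
          have q : h*(z*z)*1 ≤ h*(z*z)*h := Nat.mul_le_mul_left _ hh
          have q2 : 4*h*z*z = 4*(h*(z*z)*1) := by ring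
          have q3 : 85*h^2*z^2 = 85*(h*(z*z)*h) := by ring
          omega

lemma lk_zero (k : ℕ) : lucasK k 0 = 2 := by rw [lucasK]
lemma lk_one (k : ℕ) : lucasK k 1 = 1 := by rw [lucasK]
lemma lk_succ (k n : ℕ) : lucasK k (n+2) =
    ∑ j ∈ Finset.range k, if j ≤ n + 1 then lucasK k (n + 1 - j) else 0 := by
  rw [lucasK]
  apply Finset.sum_congr rfl
  intro j _
  by_cases h : j ≤ n+1 <;> simp [h]

lemma lk_two {k : ℕ} (hk : 2 ≤ k) : lucasK k 2 = 3 := by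
  obtain ⟨q, rfl⟩ := Nat.exists_eq_add_of_le hk
  rw [show (2:ℕ) = 0 + 2 from rfl, lk_succ, show 0 + 2 + q = (q+1)+1 by ring, Finset.sum_range_succ', Finset.sum_range_succ']
  rw [Finset.sum_eq_zero]
  · simp [lk_zero, lk_one]
  · intro j _
    rw [if_neg (by omega)]

lemma lk_rec {k : ℕ} (hk : 2 ≤ k) (n : ℕ) (hn : 2 ≤ n) :
    lucasK k (n+1) + (if k ≤ n then lucasK k (n-k) else 0) = 2 * lucasK k n := by
  obtain ⟨q, rfl⟩ := Nat.exists_eq_add_of_le' hk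
  obtain ⟨r, rfl⟩ := Nat.exists_eq_add_of_le' hn
  rw [show r + 2 + 1 = (r+1) + 2 by ring, lk_succ, show q + 2 = (q+1)+1 by ring, Finset.sum_range_succ']
  have h0 := lk_succ (q+1+1) r
  rw [Finset.sum_range_succ] at h0
  have h1 : ∀ j, (if j + 1 ≤ r + 1 + 1 then lucasK (q+1+1) (r + 1 + 1 - (j+1)) else 0)
      = (if j ≤ r + 1 then lucasK (q+1+1) (r + 1 - j) else 0) := by
    intro j
    rw [show r + 1 + 1 - (j+1) = r + 1 - j by omega]
    simp
  rw [Finset.sum_congr rfl (fun j _ => h1 j)]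
  rw [show r + 2 - (q+1+1) = r + 1 - (q+1) by omega]
  have h2 : (q + 1 + 1 ≤ r + 2) ↔ (q + 1 ≤ r + 1) := by omega
  simp only [h2, Nat.zero_le, if_true, Nat.sub_zero]
  rw [show r + 1 + 1 = r + 2 from rfl]
  omega

lemma lk_le {k : ℕ} (hk : 2 ≤ k) (n : ℕ) : lucasK k n ≤ 2^(n+1) := by
  induction n with
  | zero => simp [lk_zero]
  | succ n ih =>
    rcases Nat.lt_or_ge n 2 with h | h
    · interval_cases n
      · simp [lk_one]
      · simp [lk_two hk]
    · have := lk_rec hk n h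
      rw [pow_succ]
      omega

lemma lk_mono {k : ℕ} (hk : 2 ≤ k) (n : ℕ) (hn : 1 ≤ n) : lucasK k n ≤ lucasK k (n+1) := by
  rcases Nat.lt_or_ge n 2 with h | h
  · interval_cases n
    simp [lk_one, lk_two hk]
  · obtain ⟨r, rfl⟩ := Nat.exists_eq_add_of_le' h
    rw [show r + 2 + 1 = (r+1) + 2 by ring, lk_succ k (r+1), show k = (k-1)+1 by omega, Finset.sum_range_succ']
    simp

lemma lk_pos {k : ℕ} (hk : 2 ≤ k) (n : ℕ) : 1 ≤ lucasK k n := by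
  rcases Nat.eq_zero_or_pos n with h | h
  · subst h; simp [lk_zero]
  · induction n, h using Nat.le_induction with
    | base => simp [lk_one]
    | succ n hn ih => exact ih.trans (lk_mono hk n hn)

/-- `α` is the dominant root. -/
structure bkR (k : ℕ) (α : ℝ) : Prop where
  hk : 2 ≤ k
  h1 : 1 < α
  h2 : α < 2
  hp : α^k * (2-α) = 1
  hs : α^k = ∑ i ∈ Finset.range k, α^i
  hl2 : 1.615 ≤ α
  hl3 : 3 ≤ k → 1.835 ≤ α
  hl4 : 4 ≤ k → 1.9 ≤ α

lemma bkR_exists {k : ℕ} (hk : 2 ≤ k) : ∃ α, bkR k α := by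
  have key : ∀ lo : ℝ, 1 < lo → lo < 2 → 1 ≤ lo^k*(2-lo) →
      ∃ α, lo ≤ α ∧ α < 2 ∧ α^k*(2-α) = 1 := by
    intro lo h1 h2 h3
    have := intermediate_value_Icc' (f := fun x : ℝ => x^k*(2-x)) h2.le (by fun_prop)
    obtain ⟨x, ⟨hx1, hx2⟩, hx⟩ := this (show (1:ℝ) ∈ _ by constructor <;> norm_num; exact h3)
    refine ⟨x, hx1, lt_of_le_of_ne hx2 ?_, hx⟩
    rintro rfl
    simp at hx
  have main : ∃ α : ℝ, 1.615 ≤ α ∧ α < 2 ∧ α^k*(2-α) = 1 ∧ (3 ≤ k → 1.835 ≤ α) ∧ (4 ≤ k → 1.9 ≤ α) := by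
    rcases Nat.lt_or_ge k 4 with h | h
    · interval_cases k
      · obtain ⟨α, a, b, c⟩ := key 1.615 (by norm_num) (by norm_num) (by norm_num)
        exact ⟨α, a, b, c, by omega, by omega⟩
      · obtain ⟨α, a, b, c⟩ := key 1.835 (by norm_num) (by norm_num) (by norm_num)
        exact ⟨α, by linarith, b, c, fun _ => a, by omega⟩
    · obtain ⟨α, a, b, c⟩ := key 1.9 (by norm_num) (by norm_num) (by
        have : (1.9:ℝ)^4 ≤ 1.9^k := pow_le_pow_right₀ (by norm_num) h
        norm_num at this ⊢
        linarith)
      exact ⟨α, by linarith, b, c, fun _ => by linarith, fun _ => a⟩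
  obtain ⟨α, a, b, c, d, e⟩ := main
  refine ⟨α, hk, by linarith, b, c, ?_, a, d, e⟩
  have h := geom_sum_mul α k
  have hne : α - 1 ≠ 0 := by intro h; linarith
  apply mul_right_cancel₀ hne
  rw [h]
  linear_combination -c

lemma bkR_lo {k : ℕ} {α : ℝ} (R : bkR k α) {x : ℝ} (hx : 1 < x) (h : 1 ≤ x^k*(2-x)) : x ≤ α := by
  by_contra hc
  push Not at hc
  have h1 : (∑ i ∈ Finset.range k, x^i) * α^k ≤ (∑ i ∈ Finset.range k, α^i) * x^k := by
    rw [Finset.sum_mul, Finset.sum_mul]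
    apply Finset.sum_le_sum
    intro i hi
    have hi' := Finset.mem_range.mp hi
    obtain ⟨q, rfl⟩ := Nat.exists_eq_add_of_le hi'.le
    rw [pow_add, pow_add]
    have : α^q ≤ x^q := pow_le_pow_left₀ (by linarith [R.h1]) hc.le q
    have h0 : 0 < x^i * α^i := by have := R.h1; positivity
    nlinarith
  rw [← R.hs, mul_comm] at h1
  have hpos : 0 < α^k := by have := R.h1; positivity
  have h2 := le_of_mul_le_mul_left h1 hpos
  have h3 := geom_sum_mul x k
  have h4 : (∑ i ∈ Finset.range k, x^i) * (x-1) ≤ x^k*(x-1) := mul_le_mul_of_nonneg_right h2 (by linarith)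
  -- equality case: x^k (2-x) ≤ 1, so equals 1
  have h5 : x^k*(2-x) = 1 := by linarith
  -- strictness
  have h6 : α^k < x^k := pow_lt_pow_left₀ hc (by linarith [R.h1]) (by have := R.hk; omega)
  have h7 : (∑ i ∈ Finset.range k, x^i) * α^k < (∑ i ∈ Finset.range k, α^i) * x^k := by
    rw [Finset.sum_mul, Finset.sum_mul]
    apply Finset.sum_lt_sum
    · intro i hi
      have hi' := Finset.mem_range.mp hi
      obtain ⟨q, rfl⟩ := Nat.exists_eq_add_of_le hi'.le
      rw [pow_add, pow_add]
      have : α^q ≤ x^q := pow_le_pow_left₀ (by linarith [R.h1]) hc.le q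
      have h0 : 0 < x^i * α^i := by have := R.h1; positivity
      nlinarith
    · exact ⟨0, Finset.mem_range.mpr (by have := R.hk; omega), by simpa using h6⟩
  rw [← R.hs, mul_comm] at h7
  have h8 := lt_of_mul_lt_mul_left h7 hpos.le
  have h9 : (∑ i ∈ Finset.range k, x^i) * (x-1) < x^k*(x-1) := mul_lt_mul_of_pos_right h8 (by linarith)
  linarith

lemma bkR_hi {k : ℕ} {α : ℝ} (R : bkR k α) {x : ℝ} (hx : 1 < x) (h : x^k*(2-x) ≤ 1) : α ≤ x := by
  by_contra hc
  push Not at hc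
  have h1 : (∑ i ∈ Finset.range k, α^i) * x^k < (∑ i ∈ Finset.range k, x^i) * α^k := by
    rw [Finset.sum_mul, Finset.sum_mul]
    apply Finset.sum_lt_sum
    · intro i hi
      have hi' := Finset.mem_range.mp hi
      obtain ⟨q, rfl⟩ := Nat.exists_eq_add_of_le hi'.le
      rw [pow_add, pow_add]
      have : x^q ≤ α^q := pow_le_pow_left₀ (by linarith) hc.le q
      have h0 : 0 < x^i * α^i := by have := R.h1; positivity
      nlinarith
    · have h6 : x^k < α^k := pow_lt_pow_left₀ hc (by linarith) (by have := R.hk; omega)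
      exact ⟨0, Finset.mem_range.mpr (by have := R.hk; omega), by simpa using h6⟩
  rw [← R.hs, mul_comm (∑ i ∈ Finset.range k, x^i)] at h1
  have hpos : 0 < α^k := by have := R.h1; positivity
  have h8 := lt_of_mul_lt_mul_left h1 hpos.le
  have h3 := geom_sum_mul x k
  have h9 : x^k*(x-1) < (∑ i ∈ Finset.range k, x^i) * (x-1) := mul_lt_mul_of_pos_right h8 (by linarith)
  linarith

/-- `k+1` times `2-α` bounds -/
lemma bkR_t {k : ℕ} {α : ℝ} (R : bkR k α) : (k = 2 ∧ α^2 = α + 1) ∨ (3 ≤ k ∧ (2*k-1:ℝ)*(2-α) ≤ 0.9) := by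
  have hk := R.hk
  rcases Nat.lt_or_ge k 3 with h | h
  · left
    have : k = 2 := by omega
    subst this
    refine ⟨rfl, ?_⟩
    have := R.hs
    simp [Finset.sum_range_succ] at this
    linarith
  · right
    refine ⟨h, ?_⟩
    rcases Nat.lt_or_ge k 4 with h' | h'
    · have : k = 3 := by omega
      subst this
      have := R.hl3 (by norm_num)
      push_cast
      linarith
    · have h1 : (1.9:ℝ)^k ≤ α^k := pow_le_pow_left₀ (by norm_num) (R.hl4 h') k
      have h2 : ∀ j : ℕ, (2*((j+4:ℕ):ℝ)-1) ≤ 0.9*1.9^(j+4) := by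
        intro j
        induction j with
        | zero => norm_num
        | succ j ih =>
          rw [show j + 1 + 4 = (j+4)+1 by ring, pow_succ]
          push_cast at ih ⊢
          have : (1:ℝ) ≤ 1.9^j := one_le_pow₀ (by norm_num)
          have h3 : (1.9:ℝ)^(j+4) = 1.9^j*1.9^4 := pow_add _ _ _
          rw [h3] at ih ⊢
          norm_num at ih ⊢
          nlinarith
      have h3 := h2 (k-4)
      rw [Nat.sub_add_cancel h'] at h3
      have h4 : 0 < 2-α := by linarith [R.h2]
      calc (2*k-1:ℝ)*(2-α) ≤ (0.9*α^k)*(2-α) := mul_le_mul_of_nonneg_right (by linarith) h4.le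
        _ = 0.9 * (α^k*(2-α)) := by ring
        _ = 0.9 := by rw [R.hp]; ring

noncomputable def bkδ (k : ℕ) (α : ℝ) : ℝ := 2 + (k+1)*(α-2)
noncomputable def bkc (k : ℕ) (α : ℝ) : ℝ := (2*α-1)*(α-1)/(α*bkδ k α)

lemma bkR_δ {k : ℕ} {α : ℝ} (R : bkR k α) : 0.8 ≤ bkδ k α ∧ bkδ k α ≤ α := by
  have h2 := R.h2
  have hk : (2:ℝ) ≤ k := by exact_mod_cast R.hk
  have hl := R.hl2
  unfold bkδ
  rcases bkR_t R with ⟨rfl, h⟩ | ⟨h3, h⟩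
  · push_cast
    constructor <;> linarith
  · have h3' : (3:ℝ) ≤ k := by exact_mod_cast h3
    constructor
    · nlinarith
    · nlinarith

lemma bkR_c {k : ℕ} {α : ℝ} (R : bkR k α) : 1/2 ≤ bkc k α ∧ bkc k α ≤ 1 := by
  have hδ := bkR_δ R
  have hl := R.hl2
  have h2 := R.h2
  have hpos : 0 < α * bkδ k α := mul_pos (by linarith) (by linarith)
  unfold bkc
  constructor
  · rw [le_div_iff₀ hpos]
    have : α * bkδ k α ≤ α * α := mul_le_mul_of_nonneg_left hδ.2 (by linarith)
    nlinarith
  · rw [div_le_one hpos]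
    rcases bkR_t R with ⟨rfl, h⟩ | ⟨h3, h⟩
    · unfold bkδ
      push_cast
      nlinarith
    · unfold bkδ
      have h3' : (3:ℝ) ≤ k := by exact_mod_cast h3
      have h4 : 0 < 2 - α := by linarith
      nlinarith [mul_nonneg (sub_nonneg.mpr h3') h4.le, mul_pos h4 h4, mul_nonneg (mul_nonneg (sub_nonneg.mpr h3') h4.le) h4.le]

lemma bkR_c_two {α : ℝ} (R : bkR 2 α) : bkc 2 α = 1 := by
  rcases bkR_t R with ⟨_, h⟩ | ⟨h3, h⟩
  · have hδ := bkR_δ R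
    have hl := R.hl2
    have hpos : 0 < α * bkδ 2 α := mul_pos (by linarith) (by linarith)
    unfold bkc
    rw [div_eq_one_iff_eq hpos.ne']
    unfold bkδ
    push_cast
    linear_combination -h
  · omega

noncomputable def bkw (α : ℝ) (i : ℕ) : ℝ := ∑ j ∈ Finset.range i, (α⁻¹)^(j+1)

lemma bkw_succ (α : ℝ) (i : ℕ) : bkw α (i+1) = bkw α i + (α⁻¹)^(i+1) := by
  unfold bkw; rw [Finset.sum_range_succ]

lemma bkw_mul {α : ℝ} (h : 1 < α) (i : ℕ) : (α-1) * bkw α i = 1 - (α⁻¹)^i := by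
  have h0 : α ≠ 0 := by intro h'; linarith
  induction i with
  | zero => simp [bkw]
  | succ i ih =>
    rw [bkw_succ, mul_add, ih, pow_succ]
    field_simp
    ring

lemma bkw_alpha {α : ℝ} (h : 1 < α) (i : ℕ) : α * bkw α (i+1) = 1 + bkw α i := by
  have h0 : α ≠ 0 := by intro h'; linarith
  have h1 := bkw_mul h (i+1)
  have h2 := bkw_succ α i
  have h3 : α * (α⁻¹)^(i+1) = (α⁻¹)^i := by rw [pow_succ]; field_simp
  have h4 := bkw_mul h i
  rw [h2, mul_add, h3]; linarith

lemma bkw_k {k : ℕ} {α : ℝ} (R : bkR k α) : bkw α k = 1 := by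
  have h := bkw_mul R.h1 k
  have h0 : α^k ≠ 0 := by have := R.h1; positivity
  have h1 : (α⁻¹)^k = 2 - α := by
    rw [inv_pow]; apply mul_left_cancel₀ h0; rw [mul_inv_cancel₀ h0, R.hp]
  rw [h1] at h
  have h2 : α - 1 ≠ 0 := by have := R.h1; intro h; linarith
  apply mul_left_cancel₀ h2
  rw [h]; ring

noncomputable def bkφ (k : ℕ) (α : ℝ) (E : ℕ → ℝ) (n : ℕ) : ℝ := ∑ i ∈ Finset.range k, bkw α (i+1) * E (n+i)

lemma bkφ_aux {k : ℕ} {α : ℝ} (R : bkR k α) (E : ℕ → ℝ) (n : ℕ) :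
    bkφ k α E (n+1) = (∑ i ∈ Finset.range k, bkw α i * E (n+i)) + E (n+k) := by
  have h := Finset.sum_range_succ' (fun i => bkw α i * E (n+i)) k
  rw [Finset.sum_range_succ, bkw_k R] at h
  have h0 : bkw α 0 = 0 := by simp [bkw]
  rw [h0] at h
  unfold bkφ
  rw [one_mul] at h
  rw [h]
  simp only [zero_mul, add_zero]
  apply Finset.sum_congr rfl
  intro i _
  rw [show n + 1 + i = n + (i+1) by ring]

lemma bkφ_succ {k : ℕ} {α : ℝ} (R : bkR k α) (E : ℕ → ℝ) (hE : ∀ n, E (n+k) = ∑ i ∈ Finset.range k, E (n+i)) (n : ℕ) :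
    bkφ k α E (n+1) = α * bkφ k α E n := by
  rw [bkφ_aux R, hE, ← Finset.sum_add_distrib]
  unfold bkφ
  rw [Finset.mul_sum]
  apply Finset.sum_congr rfl
  intro i _
  rw [← mul_assoc, bkw_alpha R.h1]
  ring

lemma bk_decay {k : ℕ} {α : ℝ} (R : bkR k α) (E : ℕ → ℝ) (hE : ∀ n, E (n+k) = ∑ i ∈ Finset.range k, E (n+i))
    (h0 : bkφ k α E 0 = 0) (C : ℝ) (hC : ∀ j < k, |E j| ≤ C) (n : ℕ) : |E n| ≤ C := by
  have hφ : ∀ n, bkφ k α E n = 0 := by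
    intro n
    induction n with
    | zero => exact h0
    | succ n ih => rw [bkφ_succ R E hE, ih, mul_zero]
  have hrec : ∀ n, E (n+k) = ∑ i ∈ Finset.range k, (α⁻¹)^(i+1) * E (n+i) := by
    intro n
    have h1 := bkφ_aux R E n
    rw [hφ] at h1
    have h2 := hφ n
    unfold bkφ at h2
    have h3 : ∑ i ∈ Finset.range k, (α⁻¹)^(i+1) * E (n+i)
        = (∑ i ∈ Finset.range k, bkw α (i+1) * E (n+i)) - ∑ i ∈ Finset.range k, bkw α i * E (n+i) := by
      rw [← Finset.sum_sub_distrib]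
      apply Finset.sum_congr rfl
      intro i _
      rw [bkw_succ]; ring
    rw [h3, h2]; linarith
  have hα : 0 < α⁻¹ := by have := R.h1; positivity
  induction n using Nat.strong_induction_on with
  | _ n ih =>
    rcases Nat.lt_or_ge n k with h | h
    · exact hC n h
    · obtain ⟨q, rfl⟩ := Nat.exists_eq_add_of_le' h
      rw [hrec]
      calc |∑ i ∈ Finset.range k, (α⁻¹)^(i+1) * E (q+i)| ≤ ∑ i ∈ Finset.range k, |(α⁻¹)^(i+1) * E (q+i)| :=
            Finset.abs_sum_le_sum_abs _ _
        _ ≤ ∑ i ∈ Finset.range k, (α⁻¹)^(i+1) * C := by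
            apply Finset.sum_le_sum
            intro i hi
            rw [abs_mul, abs_of_pos (pow_pos hα _)]
            apply mul_le_mul_of_nonneg_left _ (pow_pos hα _).le
            apply ih
            have := Finset.mem_range.mp hi
            omega
        _ = bkw α k * C := by rw [← Finset.sum_mul]; rfl
        _ = C := by rw [bkw_k R, one_mul]

noncomputable def bkM (k : ℕ) (j : ℕ) : ℝ := if j + 2 < k then 0 else (lucasK k (j + 2 - k) : ℝ)

lemma bkM_rec {k : ℕ} (hk : 2 ≤ k) (n : ℕ) : bkM k (n+k) = ∑ i ∈ Finset.range k, bkM k (n+i) := by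
  unfold bkM
  rw [if_neg (by omega), show n + k + 2 - k = n + 2 by omega, lk_succ, ← Finset.sum_range_reflect]
  push_cast
  apply Finset.sum_congr rfl
  intro i hi
  have hi' := Finset.mem_range.mp hi
  by_cases h : n + i + 2 < k
  · rw [if_pos h, if_neg (by omega)]
  · rw [if_neg h, if_pos (by omega), show n + 1 - (k - 1 - i) = n + i + 2 - k by omega]

noncomputable def bkE (k : ℕ) (α : ℝ) (j : ℕ) : ℝ := bkM k j - bkc k α * α^2*(2-α) * α^j

lemma bkE_rec {k : ℕ} {α : ℝ} (R : bkR k α) (n : ℕ) : bkE k α (n+k) = ∑ i ∈ Finset.range k, bkE k α (n+i) := by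
  unfold bkE
  rw [bkM_rec R.hk, Finset.sum_sub_distrib]
  congr 1
  rw [← Finset.mul_sum]
  congr 1
  rw [pow_add, R.hs, Finset.mul_sum]
  apply Finset.sum_congr rfl
  intro i _
  rw [pow_add]

lemma bkE_zero {k : ℕ} {α : ℝ} (R : bkR k α) : bkφ k α (bkE k α) 0 = 0 := by
  have h1 : ∑ i ∈ Finset.range k, bkw α (i+1) * bkM k i = 2*α - 1 := by
    obtain ⟨q, hq⟩ := Nat.exists_eq_add_of_le' R.hk
    have hw1 : bkw α (q+1) = α - 1 := by
      have e := bkw_alpha R.h1 (q+1)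
      rw [show q + 1 + 1 = k by omega, bkw_k R] at e
      linarith
    have hw2 : bkw α (q+2) = 1 := by rw [← hq]; exact bkw_k R
    have : Finset.range k = Finset.range (q+1+1) := by rw [hq]
    rw [this, Finset.sum_range_succ, Finset.sum_range_succ, Finset.sum_eq_zero]
    · rw [hw1, show q + 1 + 1 = q + 2 from rfl, hw2]
      unfold bkM
      rw [if_neg (by omega), if_neg (by omega), show q + 2 - k = 0 by omega, show q + 1 + 2 - k = 1 by omega, lk_zero, lk_one]
      push_cast
      ring
    · intro i hi
      have := Finset.mem_range.mp hi
      unfold bkM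
      rw [if_pos (by omega), mul_zero]
  have hα0 : α ≠ 0 := by have := R.h1; intro h; linarith
  have h2 : (α-1) * ∑ i ∈ Finset.range k, bkw α (i+1) * α^i = α^k - k * α⁻¹ := by
    rw [Finset.mul_sum, R.hs]
    have : ∀ i ∈ Finset.range k, (α-1) * (bkw α (i+1) * α^i) = α^i - α⁻¹ := by
      intro i _
      rw [← mul_assoc, bkw_mul R.h1, sub_mul, one_mul, pow_succ, mul_right_comm, ← mul_pow, inv_mul_cancel₀ hα0, one_pow, one_mul]
    rw [Finset.sum_congr rfl this, Finset.sum_sub_distrib]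
    simp
  have hδ := bkR_δ R
  have hc : bkc k α * (α * bkδ k α) = (2*α-1)*(α-1) := by
    unfold bkc
    have : α * bkδ k α ≠ 0 := mul_ne_zero hα0 (by intro h; rw [h] at hδ; norm_num at hδ)
    exact div_mul_cancel₀ _ this
  have h3 : bkφ k α (bkE k α) 0 = (∑ i ∈ Finset.range k, bkw α (i+1) * bkM k i)
      - bkc k α * α^2*(2-α) * ∑ i ∈ Finset.range k, bkw α (i+1) * α^i := by
    unfold bkφ bkE
    rw [Finset.mul_sum, ← Finset.sum_sub_distrib]
    apply Finset.sum_congr rfl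
    intro i _
    rw [zero_add]; ring
  have h4 : (α-1) ≠ 0 := by have := R.h1; intro h; linarith
  apply mul_left_cancel₀ h4
  rw [h3, h1, mul_zero, mul_sub]
  have h5 : (α-1) * (bkc k α * α^2*(2-α) * ∑ i ∈ Finset.range k, bkw α (i+1) * α^i)
     = bkc k α * α^2*(2-α) * (α^k - k * α⁻¹) := by rw [← h2]; ring
  rw [h5]
  have h6 : bkc k α * α^2*(2-α) * (α^k - k * α⁻¹) = bkc k α * (α^2 *(α^k*(2-α)) - (2-α)*k*α*(α*α⁻¹)) := by ring
  rw [h6, R.hp, mul_inv_cancel₀ hα0]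
  have h7 : α^2 * 1 - (2-α)*k*α*1 = α * bkδ k α := by unfold bkδ; ring
  rw [h7, hc]; ring

lemma bk_binet {k : ℕ} {α : ℝ} (R : bkR k α) (n : ℕ) : |(lucasK k n : ℝ) - bkc k α * α^n| ≤ 1.5 := by
  have hc := bkR_c R
  have h1 := R.h1
  have h2 := R.h2
  have hb := bk_decay R (bkE k α) (bkE_rec R) (bkE_zero R) 1.5 (by
    intro j hj
    have e1 : α^j * (α^(k-j) * (2-α)) = 1 := by
      rw [← mul_assoc, ← pow_add, Nat.add_sub_cancel' hj.le, R.hp]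
    rcases Nat.lt_or_ge (j+2) k with h | h
    · unfold bkE bkM
      rw [if_pos h, zero_sub, abs_neg, abs_of_nonneg (by have : 0 ≤ 2-α := by linarith
                                                         have : 0 ≤ bkc k α := by linarith
                                                         positivity)]
      have e2 : (2-α)*α^2*α^j ≤ 1 := by
        have e3 : α^2 ≤ α^(k-j) := pow_le_pow_right₀ h1.le (by omega)
        have e4 : α^2 * ((2-α)*α^j) ≤ α^(k-j)*((2-α)*α^j) :=
          mul_le_mul_of_nonneg_right e3 (mul_nonneg (by linarith) (by positivity))
        linarith
      have e5 : 0 ≤ (2-α)*α^2*α^j := mul_nonneg (mul_nonneg (by linarith) (by positivity)) (by positivity)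
      nlinarith
    · rcases Nat.lt_or_ge (j+1) k with h' | h'
      · have hj' : k - j = 2 := by omega
        rw [hj'] at e1
        unfold bkE bkM
        rw [if_neg (by omega), show j + 2 - k = 0 by omega, lk_zero]
        have : bkc k α * α^2*(2-α)*α^j = bkc k α := by
          calc _ = bkc k α * (α^j * (α^2*(2-α))) := by ring
            _ = _ := by rw [e1, mul_one]
        rw [this, abs_le]; push_cast
        constructor <;> linarith
      · have hj' : k - j = 1 := by omega
        rw [hj', pow_one] at e1
        unfold bkE bkM
        rw [if_neg (by omega), show j + 2 - k = 1 by omega, lk_one]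
        have : bkc k α * α^2*(2-α)*α^j = bkc k α * α := by
          calc _ = bkc k α * α * (α^j * (α*(2-α))) := by ring
            _ = _ := by rw [e1, mul_one]
        rw [this, abs_le]; push_cast
        constructor <;> nlinarith) (n + k - 2)
  have hk := R.hk
  unfold bkE bkM at hb
  rw [if_neg (by omega), show n + k - 2 + 2 - k = n by omega] at hb
  have : bkc k α * α^2*(2-α)*α^(n+k-2) = bkc k α * α^n := by
    have : α^2 * α^(n+k-2) = α^n * α^k := by rw [← pow_add, ← pow_add]; congr 1; omega
    calc _ = bkc k α * (α^2 * α^(n+k-2)) * (2-α) := by ring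
      _ = bkc k α * α^n * (α^k*(2-α)) := by rw [this]; ring
      _ = _ := by rw [R.hp, mul_one]
  rwa [this] at hb

section bkP6
open Polynomial IntermediateField

noncomputable def bkL (k : ℕ) (α : ℝ) (a A i d N : ℕ) : ℝ :=
  Real.log (a/(9*A*(bkc k α)^i)) + d * Real.log 10 - N * Real.log α

lemma lk_rho {k : ℕ} {α : ℝ} (R : bkR k α) {j t : ℕ} (hj : j ≤ t) :
    |(lucasK k t : ℝ)/(bkc k α * α^t) - 1| ≤ 3 * (α^j)⁻¹ := by
  have hc := bkR_c R
  have h1 := R.h1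
  have hb := bk_binet R t
  have hp : 0 < bkc k α * α^t := mul_pos (by linarith) (by positivity)
  have e : (lucasK k t : ℝ)/(bkc k α * α^t) - 1 = ((lucasK k t : ℝ) - bkc k α * α^t)/(bkc k α * α^t) := by
    rw [sub_div, div_self hp.ne']
  rw [e, abs_div, abs_of_pos hp, div_le_iff₀ hp]
  have h2 : 1 ≤ (α^j)⁻¹ * α^t := by
    rw [le_inv_mul_iff₀ (by positivity), mul_one]
    exact pow_le_pow_right₀ h1.le hj
  have h3 : 1.5 ≤ 3 * (α^j)⁻¹ * (bkc k α * α^t) := by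
    have : 1/2 * 1 ≤ bkc k α * ((α^j)⁻¹ * α^t) := mul_le_mul hc.1 h2 (by norm_num) (by linarith)
    linarith
  linarith

lemma bk_u {k : ℕ} {α : ℝ} (R : bkR k α) {j : ℕ} (hj : 10 ≤ j) : (α^j)⁻¹ ≤ 1/120 := by
  rw [one_div]
  apply inv_anti₀ (by norm_num)
  calc (120:ℝ) ≤ 1.615^10 := by norm_num
    _ ≤ α^10 := pow_le_pow_left₀ (by norm_num) R.hl2 _
    _ ≤ α^j := pow_le_pow_right₀ R.h1.le hj

lemma lk_big {k : ℕ} {α : ℝ} (R : bkR k α) {t : ℕ} (ht : 10 ≤ t) : 58 ≤ lucasK k t := by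
  have hc := bkR_c R
  have hb := bk_binet R t
  have hu : (120:ℝ) ≤ α^t := by
    calc (120:ℝ) ≤ 1.615^10 := by norm_num
    _ ≤ α^10 := pow_le_pow_left₀ (by norm_num) R.hl2 _
    _ ≤ α^t := pow_le_pow_right₀ R.h1.le ht
  rw [abs_le] at hb
  have : (57:ℝ) < lucasK k t := by nlinarith
  have : 57 < lucasK k t := by exact_mod_cast this
  omega

lemma bk_logexp (y : ℝ) (u : ℝ) (h : |Real.exp y - 1| ≤ 12*u) (hu : u ≤ 1/120) : |y| ≤ 16 * u := by
  rw [abs_le] at h ⊢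
  have hu0 : 0 ≤ u := by linarith
  constructor
  · by_contra hc
    push Not at hc
    have h1 : Real.exp y < Real.exp (-(16*u)) := Real.exp_lt_exp.mpr (by linarith)
    have h2 : Real.exp (-(16*u)) * (1+16*u) ≤ 1 := by
      have := Real.add_one_le_exp (16*u)
      calc _ ≤ Real.exp (-(16*u)) * Real.exp (16*u) := mul_le_mul_of_nonneg_left (by linarith) (Real.exp_pos _).le
        _ = 1 := by rw [← Real.exp_add]; simp
    have h3 : (1-12*u) * (1+16*u) < 1 := lt_of_lt_of_le (mul_lt_mul_of_pos_right (by linarith) (by linarith)) h2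
    nlinarith
  · have := Real.add_one_le_exp y
    linarith

lemma lin_upper {k : ℕ} {α : ℝ} (R : bkR k α) (a A i d N : ℕ) (W u : ℝ) (ha : 1 ≤ a) (ha9 : a ≤ 9) (hA : 1 ≤ A)
    (heq : 9*A*W + a = a*(10:ℝ)^d) (hρ : |W/((bkc k α)^i*α^N) - 1| ≤ 10*u)
    (hτ : ((bkc k α)^i*α^N)⁻¹ ≤ 2*u) (hu : u ≤ 1/120) : |bkL k α a A i d N| ≤ 16*u := by
  have hc := bkR_c R
  have h1 := R.h1
  have hc0 : 0 < bkc k α := by linarith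
  have ha' : (1:ℝ) ≤ a := by exact_mod_cast ha
  have ha9' : (a:ℝ) ≤ 9 := by exact_mod_cast ha9
  have hA' : (1:ℝ) ≤ A := by exact_mod_cast hA
  have hcN : 0 < (bkc k α)^i*α^N := by positivity
  apply bk_logexp _ _ _ hu
  have he : Real.exp (bkL k α a A i d N) = a/(9*A*(bkc k α)^i) * 10^d / α^N := by
    unfold bkL
    rw [Real.exp_sub, Real.exp_add, Real.exp_log (by positivity), ← Real.log_pow, ← Real.log_pow,
      Real.exp_log (by positivity), Real.exp_log (by positivity)]
  have he2 : Real.exp (bkL k α a A i d N) = W/((bkc k α)^i*α^N) + (a/(9*A)) * ((bkc k α)^i*α^N)⁻¹ := by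
    rw [he]
    field_simp
    linarith
  rw [he2]
  have hq : 0 ≤ (a/(9*A):ℝ) := by positivity
  have hq1 : (a/(9*A):ℝ) ≤ 1 := by rw [div_le_one (by positivity)]; linarith
  have hi : 0 < ((bkc k α)^i*α^N)⁻¹ := by positivity
  have h5 : (a/(9*A):ℝ) * ((bkc k α)^i*α^N)⁻¹ ≤ 2*u := le_trans (mul_le_of_le_one_left hi.le hq1) hτ
  have h6 : 0 ≤ (a/(9*A):ℝ) * ((bkc k α)^i*α^N)⁻¹ := by positivity
  rw [abs_le] at hρ ⊢
  constructor <;> linarith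

noncomputable def bkp1 (k : ℕ) : ℤ[X] := X * (C 2 + C (k+1:ℤ) * (X - C 2))
noncomputable def bkp2 : ℤ[X] := (C 2 * X - C 1) * (X - C 1)

lemma bkp1_aeval (k : ℕ) (α : ℝ) : aeval α (bkp1 k) = α * bkδ k α := by
  rw [bkp1, map_mul, map_add, map_mul, map_sub, aeval_X, aeval_C, aeval_C, bkδ]; simp
lemma bkp2_aeval (α : ℝ) : aeval α bkp2 = (2*α-1)*(α-1) := by
  rw [bkp2, map_mul, map_sub, map_sub, map_mul, aeval_X, aeval_C, aeval_C]; simp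

lemma bkp1_norm (k : ℕ) (hk : k ≤ 650) (β : ℂ) (hβ : ‖β‖ ≤ 2) : ‖aeval β (bkp1 k)‖ ≤ 5212 := by
  rw [bkp1, map_mul, map_add, map_mul, map_sub, aeval_X, aeval_C, aeval_C]
  rw [norm_mul]
  have hk' : (k:ℝ) ≤ 650 := by exact_mod_cast hk
  have h1 : ‖(algebraMap ℤ ℂ) 2 + (algebraMap ℤ ℂ) (k+1:ℤ) * (β - (algebraMap ℤ ℂ) 2)‖ ≤ 2 + 651*4 := by
    refine (norm_add_le _ _).trans ?_
    rw [norm_mul]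
    have e1 : ‖(algebraMap ℤ ℂ) 2‖ = 2 := by simp
    have e2 : ‖(algebraMap ℤ ℂ) (k+1:ℤ)‖ = k+1 := by
      have : (algebraMap ℤ ℂ) (k+1:ℤ) = ((k+1:ℕ):ℂ) := by simp
      rw [this, Complex.norm_natCast]; push_cast; rfl
    have e3 : ‖β - (algebraMap ℤ ℂ) 2‖ ≤ 4 := by
      refine (norm_sub_le _ _).trans ?_
      rw [e1]; linarith
    rw [e1, e2]
    have : (k+1:ℝ) * ‖β - (algebraMap ℤ ℂ) 2‖ ≤ 651*4 := mul_le_mul (by linarith) e3 (norm_nonneg _) (by norm_num)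
    linarith
  calc _ ≤ 2 * (2+651*4) := mul_le_mul hβ h1 (norm_nonneg _) (by norm_num)
    _ = (5212:ℝ) := by norm_num

lemma bkp2_norm (β : ℂ) (hβ : ‖β‖ ≤ 2) : ‖aeval β bkp2‖ ≤ 15 := by
  simp only [bkp2, map_mul, map_sub, aeval_X, map_ofNat, map_one]
  rw [norm_mul]
  have h1 : ‖2*β - 1‖ ≤ 5 := by
    refine (norm_sub_le _ _).trans ?_
    rw [norm_mul]; simp; linarith
  have h2 : ‖β - 1‖ ≤ 3 := by
    refine (norm_sub_le _ _).trans ?_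
    simp; linarith
  calc _ ≤ 5*(3:ℝ) := mul_le_mul h1 h2 (norm_nonneg _) (by norm_num)
    _ = 15 := by norm_num

lemma bkNrm_C (α : ℝ) (z : ℤ) : bkNrm α (C z) = (z:ℚ)^(bkDeg α) := by
  unfold bkNrm bkDeg
  rw [aeval_C, show (algebraMap ℤ ℚ⟮α⟯) z = algebraMap ℚ ℚ⟮α⟯ (z:ℚ) by simp, Algebra.norm_algebraMap]

lemma bkNrm_congr {α : ℝ} (P Q : ℤ[X]) (h : aeval α P = aeval α Q) : bkNrm α P = bkNrm α Q := by
  unfold bkNrm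
  congr 1
  apply Subtype.ext
  rw [bk_aeval_coe, bk_aeval_coe, h]

lemma lin_ne {k : ℕ} {α : ℝ} (R : bkR k α) (a A i d N W : ℕ) (ha : 1 ≤ a) (hA : 1 ≤ A)
    (heq : 9*A*W + a = a*10^d) (hW : 15^i ≤ W) : bkL k α a A i d N ≠ 0 := by
  intro h0
  have hc := bkR_c R
  have h1 := R.h1
  have hδ := bkR_δ R
  have hc0 : 0 < bkc k α := by linarith
  have hA' : (1:ℝ) ≤ A := by exact_mod_cast hA
  have ha' : (1:ℝ) ≤ a := by exact_mod_cast ha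
  have he : Real.exp (bkL k α a A i d N) = a/(9*A*(bkc k α)^i) * 10^d / α^N := by
    unfold bkL
    rw [Real.exp_sub, Real.exp_add, Real.exp_log (by positivity), ← Real.log_pow, ← Real.log_pow,
      Real.exp_log (by positivity), Real.exp_log (by positivity)]
  rw [h0, Real.exp_zero] at he
  have hcδ : bkc k α * (α * bkδ k α) = (2*α-1)*(α-1) := by
    unfold bkc
    exact div_mul_cancel₀ _ (mul_pos (by linarith) (by linarith)).ne'
  have he2 : (a:ℝ) * 10^d * (α * bkδ k α)^i = 9*A*((2*α-1)*(α-1))^i * α^N := by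
    rw [← hcδ, mul_pow]
    field_simp at he
    rw [← he]; ring
  have hP : aeval α (C ((a*10^d:ℕ):ℤ) * (bkp1 k)^i) = aeval α (C ((9*A:ℕ):ℤ) * bkp2^i * X^N) := by
    simp only [map_mul, map_pow, aeval_C, aeval_X, bkp1_aeval, bkp2_aeval]
    simp
    rw [he2]
  have hN := bkNrm_congr _ _ hP
  rw [bkNrm_mul, bkNrm_mul, bkNrm_mul, bkNrm_C, bkNrm_C, bkNrm_pow, bkNrm_pow, bkNrm_pow] at hN
  have hN2 := congrArg abs hN
  simp only [abs_mul, abs_pow] at hN2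
  rw [bkNrm_X (by have := R.hk; omega) R.hs, one_pow, mul_one] at hN2
  have hg := bkNrm_ge R.hs (bkp1 k) (by rw [bkp1_aeval]; exact (mul_pos (by linarith) (by linarith)).ne')
  have hf := bkNrm_le R.hs bkp2 15 bkp2_norm
  have hf' : |bkNrm α bkp2| ≤ 15^(bkDeg α) := by exact_mod_cast hf
  have h2 : (|(((a*10^d:ℕ):ℤ):ℚ)|)^(bkDeg α) ≤ (|(((9*A:ℕ):ℤ):ℚ)| * 15^i)^(bkDeg α) := by
    calc (|(((a*10^d:ℕ):ℤ):ℚ)|)^(bkDeg α) ≤ (|(((a*10^d:ℕ):ℤ):ℚ)|)^(bkDeg α) * |bkNrm α (bkp1 k)|^i :=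
          le_mul_of_one_le_right (by positivity) (one_le_pow₀ hg)
      _ = (|(((9*A:ℕ):ℤ):ℚ)|)^(bkDeg α) * |bkNrm α bkp2|^i := hN2
      _ ≤ (|(((9*A:ℕ):ℤ):ℚ)|)^(bkDeg α) * (15^(bkDeg α))^i :=
          mul_le_mul_of_nonneg_left (pow_le_pow_left₀ (abs_nonneg _) hf' i) (by positivity)
      _ = _ := by rw [mul_pow]; ring
  have hdeg := bkDeg_pos R.hs
  have h3 := (pow_le_pow_iff_left₀ (by positivity) (by positivity) (by omega)).mp h2
  rw [abs_of_nonneg (by positivity), abs_of_nonneg (by positivity)] at h3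
  have h4 : a*10^d ≤ 9*A*15^i := by exact_mod_cast h3
  have h5 : 9*A*15^i ≤ 9*A*W := Nat.mul_le_mul_left _ hW
  omega

lemma bk_exp28 : (9:ℝ)*5212^3 ≤ Real.exp 28 := by
  have h : (2.718:ℝ)^28 ≤ Real.exp 28 := by
    have : Real.exp 28 = (Real.exp 1)^28 := by rw [← Real.exp_nat_mul]; norm_num
    rw [this]
    exact pow_le_pow_left₀ (by norm_num) (by linarith [Real.exp_one_gt_d9]) _
  refine le_trans ?_ h
  norm_num

lemma bk_expA {s h : ℕ} (hs : 7*s+120 ≤ 10*h) : (9:ℝ)*2^(s+2)*15^3 ≤ Real.exp h := by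
  have h1 : Real.exp ((7*s+120)/10) ≤ Real.exp h := by
    apply Real.exp_le_exp.mpr
    have : ((7*s+120:ℕ):ℝ) ≤ ((10*h:ℕ):ℝ) := by exact_mod_cast hs
    push_cast at this
    linarith
  refine le_trans ?_ h1
  have h2 : Real.exp ((7*s+120)/10) = Real.exp (7/10)^s * Real.exp 12 := by
    rw [← Real.exp_nat_mul, ← Real.exp_add]; congr 1; ring
  rw [h2]
  have h3 : (2:ℝ) ≤ Real.exp (7/10) := by
    rw [← Real.log_le_iff_le_exp (by norm_num)]
    linarith [Real.log_two_lt_d9]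
  have h4 : (9:ℝ)*4*15^3 ≤ Real.exp 12 := by
    have : Real.exp 12 = (Real.exp 1)^12 := by rw [← Real.exp_nat_mul]; norm_num
    rw [this]
    calc (9:ℝ)*4*15^3 ≤ 2.7^12 := by norm_num
      _ ≤ _ := pow_le_pow_left₀ (by norm_num) (by linarith [Real.exp_one_gt_d9]) _
  calc (9:ℝ)*2^(s+2)*15^3 = 2^s * (9*4*15^3) := by ring
    _ ≤ _ := mul_le_mul (pow_le_pow_left₀ (by norm_num) h3 s) h4 (by norm_num) (by positivity)

lemma lin_lower {k K : ℕ} {α : ℝ} (R : bkR k α) (hkK : k ≤ K) (hk : k ≤ 650) (a A i d N s : ℕ) (ha : 1 ≤ a) (ha9 : a ≤ 9) (hA : 1 ≤ A)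
    (hi : i ≤ 3) (hAs : A ≤ 2^(s+2)) (h b z J yb D : ℕ) (hh : 28 ≤ h) (hs : 7*s+120 ≤ 10*h)
    (hb1 : 1 ≤ b) (hz1 : 1 ≤ z) (hd : d ≤ D) (hN : N ≤ D) (hD1 : 1 ≤ D) (hc : bkCond K h b z J yb D)
    (hne : bkL k α a A i d N ≠ 0) : Real.exp (-(bkX K h z yb : ℝ)) < |bkL k α a A i d N| := by
  have hcc := bkR_c R
  have h1 := R.h1
  have hδ := bkR_δ R
  have hc0 : 0 < bkc k α := by linarith
  have hA' : (1:ℝ) ≤ A := by exact_mod_cast hA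
  have ha' : (1:ℝ) ≤ a := by exact_mod_cast ha
  have ha9' : (a:ℝ) ≤ 9 := by exact_mod_cast ha9
  have hAs' : (A:ℝ) ≤ 2^(s+2) := by exact_mod_cast hAs
  have h28 : Real.exp 28 ≤ Real.exp h := Real.exp_le_exp.mpr (by exact_mod_cast hh)
  have hcδ : bkc k α * (α * bkδ k α) = (2*α-1)*(α-1) := by
    unfold bkc
    exact div_mul_cancel₀ _ (mul_pos (by linarith) (by linarith)).ne'
  have hlog : 2/5 ≤ Real.log α := by
    have h2 : Real.log 1.615 ≤ Real.log α := Real.log_le_log (by norm_num) R.hl2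
    refine le_trans ?_ h2
    rw [Real.le_log_iff_exp_le (by norm_num)]
    have h3 : Real.exp (2/5) ^ 5 ≤ (1.615:ℝ)^5 := by
      rw [← Real.exp_nat_mul]
      have : Real.exp ((5:ℕ) * (2/5)) = Real.exp 1 ^ 2 := by rw [← Real.exp_nat_mul]; norm_num
      rw [this]
      calc Real.exp 1^2 ≤ 2.7182818286^2 := pow_le_pow_left₀ (Real.exp_pos _).le Real.exp_one_lt_d9.le _
        _ ≤ _ := by norm_num
    exact le_of_pow_le_pow_left₀ (by norm_num) (by norm_num) h3
  have hA15 : (9:ℝ)*A*15^3 ≤ Real.exp h := by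
    refine le_trans ?_ (bk_expA hs)
    have : (9:ℝ)*A ≤ 9*2^(s+2) := by linarith
    exact mul_le_mul_of_nonneg_right this (by norm_num)
  refine bk_three (k := k) (K := K) (γ := a/(9*A*(bkc k α)^i)) hkK R.hs R.h1 R.h2.le hlog (by have := R.hk; omega) h b z J yb D d N
    (by omega) hb1 hz1 (C (a:ℤ) * (bkp1 k)^i) (C ((9*A:ℕ):ℤ) * bkp2^i) ?_ ?_ (by positivity) ?_ ?_ ?_ hd hN hD1 hc hne
  · intro β hβ
    rw [map_mul, map_pow, norm_mul, norm_pow]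
    have e1 : ‖aeval β (C (a:ℤ) : ℤ[X])‖ = a := by simp
    rw [e1]
    have e2 : ‖aeval β (bkp1 k)‖^i ≤ 5212^3 := by
      calc _ ≤ (5212:ℝ)^i := pow_le_pow_left₀ (norm_nonneg _) (bkp1_norm k hk β hβ) i
        _ ≤ 5212^3 := pow_le_pow_right₀ (by norm_num) hi
    calc _ ≤ (9:ℝ)*5212^3 := mul_le_mul ha9' e2 (by positivity) (by norm_num)
      _ ≤ _ := bk_exp28.trans h28
  · intro β hβ
    rw [map_mul, map_pow, norm_mul, norm_pow]
    have e1 : ‖aeval β (C ((9*A:ℕ):ℤ) : ℤ[X])‖ = 9*A := by rw [aeval_C]; simp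
    rw [e1]
    have e2 : ‖aeval β bkp2‖^i ≤ 15^3 := by
      calc _ ≤ (15:ℝ)^i := pow_le_pow_left₀ (norm_nonneg _) (bkp2_norm β hβ) i
        _ ≤ 15^3 := pow_le_pow_right₀ (by norm_num) hi
    calc _ ≤ (9:ℝ)*A*15^3 := mul_le_mul_of_nonneg_left e2 (by positivity)
      _ ≤ _ := hA15
  · rw [map_mul, map_pow, bkp2_aeval]
    have : 0 < (2*α-1)*(α-1) := mul_pos (by linarith) (by linarith)
    simp only [aeval_C]
    apply mul_ne_zero
    · simp; omega
    · exact (pow_pos this i).ne'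
  · rw [map_mul, map_mul, map_pow, map_pow, bkp2_aeval, bkp1_aeval, ← hcδ, aeval_C, aeval_C, mul_pow]
    simp
    field_simp
  · have hu : (a/(9*A*(bkc k α)^i) : ℝ) ≤ Real.exp h := by
      rw [div_le_iff₀ (by positivity)]
      have e1 : (1/8:ℝ) ≤ (bkc k α)^i := by
        calc (1/8:ℝ) = (1/2)^3 := by norm_num
          _ ≤ (1/2)^i := pow_le_pow_of_le_one (by norm_num) (by norm_num) hi
          _ ≤ _ := pow_le_pow_left₀ (by norm_num) hcc.1 i
      have e2 : (8:ℝ) ≤ Real.exp h := by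
        refine le_trans ?_ (bk_exp28.trans h28)
        norm_num
      have e3 : (1:ℝ) ≤ Real.exp h * (bkc k α)^i := by
        calc (1:ℝ) = 8*(1/8) := by norm_num
          _ ≤ _ := mul_le_mul e2 e1 (by norm_num) (Real.exp_pos _).le
      calc (a:ℝ) ≤ 9 * 1 * 1 := by linarith
        _ ≤ 9 * A * (Real.exp h * (bkc k α)^i) := mul_le_mul (by linarith) e3 (by norm_num) (by positivity)
        _ = _ := by ring
    have hl : Real.exp (-h) ≤ (a/(9*A*(bkc k α)^i) : ℝ) := by
      rw [le_div_iff₀ (by positivity), Real.exp_neg, inv_mul_le_iff₀ (Real.exp_pos _)]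
      have e1 : (bkc k α)^i ≤ 1 := pow_le_one₀ hc0.le hcc.2
      calc 9*A*(bkc k α)^i ≤ 9*A*15^3 := mul_le_mul_of_nonneg_left (by linarith) (by positivity)
        _ ≤ Real.exp h := hA15
        _ ≤ _ := le_mul_of_one_le_right (Real.exp_pos _).le ha'
    rw [abs_le]
    constructor
    · rw [Real.le_log_iff_exp_le (by positivity)]; exact hl
    · rw [Real.log_le_iff_le_exp (by positivity)]; exact hu
end bkP6

structure bkS (k n m l d a : ℕ) : Prop where
  hk : 2 ≤ k
  hk' : k ≤ 650
  hnm : m ≤ n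
  hml : l ≤ m
  hn : 26 ≤ n
  hd : 1 ≤ d
  ha : 1 ≤ a
  ha9 : a ≤ 9
  heq : 9*(lucasK k n * lucasK k m * lucasK k l) + a = a * 10^d

lemma bkS_of {k n m l d a : ℕ} (hk : 2 ≤ k) (hk' : k ≤ 650) (hnm : m ≤ n) (hml : l ≤ m)
    (hn : 25 < n) (hd : 2 ≤ d) (ha1 : 1 ≤ a) (ha9 : a ≤ 9)
    (heq : lucasK k n * lucasK k m * lucasK k l = a * ((10 ^ d - 1) / 9)) : bkS k n m l d a := by
  refine ⟨hk, hk', hnm, hml, hn, by omega, ha1, ha9, ?_⟩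
  have h9 : 9 ∣ 10^d - 1 := by
    have := Nat.sub_dvd_pow_sub_pow 10 1 d
    simpa using this
  obtain ⟨q, hq⟩ := h9
  have hp : 1 ≤ 10^d := Nat.one_le_pow _ _ (by norm_num)
  rw [heq, hq, Nat.mul_div_cancel_left _ (by norm_num)]
  have : 10^d = 9*q + 1 := by omega
  rw [this]; ring

lemma bkS_d {k n m l d a : ℕ} (S : bkS k n m l d a) : d ≤ 3*n := by
  have h1 := lk_le S.hk n
  have h2 := lk_le S.hk m
  have h3 := lk_le S.hk l
  have h4 : lucasK k n * lucasK k m * lucasK k l ≤ 8^(n+1) := by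
    calc _ ≤ 2^(n+1) * 2^(m+1) * 2^(l+1) := Nat.mul_le_mul (Nat.mul_le_mul h1 h2) h3
      _ = 2^((n+1)+(m+1)+(l+1)) := by ring
      _ ≤ 2^(3*(n+1)) := Nat.pow_le_pow_right (by norm_num) (by have := S.hnm; have := S.hml; omega)
      _ = 8^(n+1) := by rw [pow_mul]; norm_num
  have h5 : 10^d ≤ 10^(n+2) := by
    have : 10^d ≤ a*10^d := Nat.le_mul_of_pos_left _ S.ha
    have h8 : 8^(n+1) ≤ 10^(n+1) := Nat.pow_le_pow_left (by norm_num) _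
    have h9 : 10^(n+2) = 10*10^(n+1) := by ring
    have h10 : 9 ≤ 8^(n+1) := by
      calc 9 ≤ 8^2 := by norm_num
        _ ≤ _ := Nat.pow_le_pow_right (by norm_num) (by have := S.hn; omega)
    have := S.heq
    have := S.ha9
    omega
  have := (Nat.pow_le_pow_iff_right (by norm_num : 1 < 10)).mp h5
  have := S.hn
  omega

lemma bk_ndvd {P a d : ℕ} (hd : 1 ≤ d) (ha : 1 ≤ a) (ha9 : a ≤ 9) (h : 9*P + a = a*10^d) : ¬ 16 ∣ P ∧ ¬ 25 ∣ P := by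
  obtain ⟨e, rfl⟩ := Nat.exists_eq_add_of_le' hd
  have h1 : 10^(e+1) = 10*10^e := by ring
  have h2 : 9*P = a*(10*10^e-1) := by
    have : 1 ≤ 10^e := Nat.one_le_pow _ _ (by norm_num)
    rw [Nat.mul_sub, ← h1, ← h]; omega
  have hp : 1 ≤ 10^e := Nat.one_le_pow _ _ (by norm_num)
  constructor
  · intro hc
    have h3 : 16 ∣ a*(10*10^e-1) := by rw [← h2]; exact hc.mul_left 9
    have hco : Nat.Coprime 16 (10*10^e-1) := by
      rw [show 16 = 2^4 by norm_num]
      apply Nat.Coprime.pow_left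
      rw [Nat.coprime_two_left, Nat.odd_iff]; omega
    have := Nat.le_of_dvd ha (hco.dvd_of_dvd_mul_right h3)
    omega
  · intro hc
    have h3 : 25 ∣ a*(10*10^e-1) := by rw [← h2]; exact hc.mul_left 9
    have hco : Nat.Coprime 25 (10*10^e-1) := by
      rw [show 25 = 5^2 by norm_num]
      apply Nat.Coprime.pow_left
      rw [Nat.Prime.coprime_iff_not_dvd (by norm_num)]
      omega
    have := Nat.le_of_dvd ha (hco.dvd_of_dvd_mul_right h3)
    omega

lemma bkS_nd {k n m l d a : ℕ} (S : bkS k n m l d a) : ¬ 16 ∣ lucasK k m * lucasK k l ∧ ¬ 25 ∣ lucasK k m * lucasK k l := by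
  have h := bk_ndvd S.hd S.ha S.ha9 S.heq
  rw [mul_assoc] at h
  exact ⟨fun hc => h.1 (hc.mul_left _), fun hc => h.2 (hc.mul_left _)⟩

lemma bkS_form1 {k n m l d a : ℕ} (S : bkS k n m l d a) {α : ℝ} (R : bkR k α) (hl : 10 ≤ l) :
    |bkL k α a 1 3 d (n+m+l)| ≤ 16*(α^l)⁻¹ ∧ bkL k α a 1 3 d (n+m+l) ≠ 0 := by
  have hm : 10 ≤ m := hl.trans S.hml
  have hn : 10 ≤ n := hm.trans S.hnm
  have hc := bkR_c R
  have h1 := R.h1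
  have hc0 : 0 < bkc k α := by linarith
  have hu := bk_u R hl
  constructor
  · refine lin_upper R a 1 3 d (n+m+l) ((lucasK k n * lucasK k m * lucasK k l : ℕ):ℝ) _ S.ha S.ha9 le_rfl ?_ ?_ ?_ hu
    · have := S.heq
      have h' : ((9*(lucasK k n * lucasK k m * lucasK k l) + a : ℕ):ℝ) = ((a * 10^d:ℕ):ℝ) := by rw [this]
      push_cast at h' ⊢
      linarith
    · have r1 := lk_rho R S.hml
      have r2 := lk_rho R (S.hml.trans S.hnm)
      have r3 := lk_rho R (le_refl l)
      have e : ((lucasK k n * lucasK k m * lucasK k l : ℕ):ℝ)/(bkc k α^3 * α^(n+m+l))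
        = ((lucasK k n:ℝ)/(bkc k α * α^n)) * ((lucasK k m:ℝ)/(bkc k α * α^m)) * ((lucasK k l:ℝ)/(bkc k α * α^l)) := by
        push_cast
        rw [div_mul_div_comm, div_mul_div_comm]
        congr 1
        rw [pow_add, pow_add]; ring
      rw [e]
      generalize (lucasK k n:ℝ)/(bkc k α * α^n) = x at *
      generalize (lucasK k m:ℝ)/(bkc k α * α^m) = y at *
      generalize (lucasK k l:ℝ)/(bkc k α * α^l) = w at *
      generalize (α^l)⁻¹ = u at *
      obtain ⟨x, rfl⟩ : ∃ x', x = 1 + x' := ⟨x-1, by ring⟩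
      obtain ⟨y, rfl⟩ : ∃ x', y = 1 + x' := ⟨y-1, by ring⟩
      obtain ⟨w, rfl⟩ : ∃ x', w = 1 + x' := ⟨w-1, by ring⟩
      simp only [add_sub_cancel_left] at r1 r2 r3
      have hu0 : 0 ≤ u := by have := abs_nonneg x; linarith
      have hxy : |x*y| ≤ (1/40)*(3*u) := by
        rw [abs_mul]; exact mul_le_mul (by linarith) (by linarith) (abs_nonneg _) (by norm_num)
      have hxw : |x*w| ≤ (1/40)*(3*u) := by
        rw [abs_mul]; exact mul_le_mul (by linarith) (by linarith) (abs_nonneg _) (by norm_num)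
      have hyw : |y*w| ≤ (1/40)*(3*u) := by
        rw [abs_mul]; exact mul_le_mul (by linarith) (by linarith) (abs_nonneg _) (by norm_num)
      have hxyw : |x*y*w| ≤ 1*(3*u) := by
        rw [abs_mul]; exact mul_le_mul (by linarith) (by linarith) (abs_nonneg _) (by norm_num)
      have hxyw' : |x*y*w| ≤ (1/40)*(3*u) := by
        rw [mul_assoc, abs_mul]; exact mul_le_mul (by linarith) (by linarith) (abs_nonneg _) (by norm_num)
      rw [show (1+x)*(1+y)*(1+w) - 1 = x + y + w + x*y + x*w + y*w + x*y*w by ring]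
      rw [abs_le] at *
      constructor <;> linarith
    · rw [← inv_inv (2*(α^l)⁻¹)]
      apply inv_anti₀ (by positivity)
      rw [mul_inv, inv_inv]
      have e1 : (1/2:ℝ)^3 ≤ (bkc k α)^3 := pow_le_pow_left₀ (by norm_num) hc.1 3
      have e2 : 120 * α^l ≤ α^(n+m+l) := by
        rw [pow_add]
        apply mul_le_mul_of_nonneg_right _ (by positivity)
        have := bk_u R (show 10 ≤ n + m by omega)
        rw [one_div, inv_le_inv₀ (by positivity) (by norm_num)] at this
        exact this
      have e3 : (1/2:ℝ)^3 * (120*α^l) ≤ (bkc k α)^3 * α^(n+m+l) := mul_le_mul e1 e2 (by positivity) (by positivity)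
      have e4 : 0 < α^l := by positivity
      linarith
  · refine lin_ne R a 1 3 d (n+m+l) (lucasK k n * lucasK k m * lucasK k l) S.ha le_rfl ?_ ?_
    · rw [mul_one]; exact S.heq
    · calc 15^3 ≤ 58*58*58 := by norm_num
        _ ≤ _ := Nat.mul_le_mul (Nat.mul_le_mul (lk_big R hn) (lk_big R hm)) (lk_big R hl)

lemma bkS_form2 {k n m l d a : ℕ} (S : bkS k n m l d a) {α : ℝ} (R : bkR k α) (hm : 10 ≤ m) :
    |bkL k α a (lucasK k l) 2 d (n+m)| ≤ 16*(α^m)⁻¹ ∧ bkL k α a (lucasK k l) 2 d (n+m) ≠ 0 := by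
  have hn : 10 ≤ n := hm.trans S.hnm
  have hc := bkR_c R
  have h1 := R.h1
  have hc0 : 0 < bkc k α := by linarith
  have hu := bk_u R hm
  constructor
  · refine lin_upper R a _ 2 d (n+m) ((lucasK k n * lucasK k m : ℕ):ℝ) _ S.ha S.ha9 (lk_pos S.hk l) ?_ ?_ ?_ hu
    · have := S.heq
      have h' : ((9*(lucasK k n * lucasK k m * lucasK k l) + a : ℕ):ℝ) = ((a * 10^d:ℕ):ℝ) := by rw [this]
      push_cast at h' ⊢
      linarith
    · have r1 := lk_rho R S.hnm
      have r2 := lk_rho R (le_refl m)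
      have e : ((lucasK k n * lucasK k m : ℕ):ℝ)/(bkc k α^2 * α^(n+m))
        = ((lucasK k n:ℝ)/(bkc k α * α^n)) * ((lucasK k m:ℝ)/(bkc k α * α^m)) := by
        push_cast
        rw [div_mul_div_comm]
        congr 1
        rw [pow_add]; ring
      rw [e]
      generalize (lucasK k n:ℝ)/(bkc k α * α^n) = x at *
      generalize (lucasK k m:ℝ)/(bkc k α * α^m) = y at *
      generalize (α^m)⁻¹ = u at *
      obtain ⟨x, rfl⟩ : ∃ x', x = 1 + x' := ⟨x-1, by ring⟩
      obtain ⟨y, rfl⟩ : ∃ x', y = 1 + x' := ⟨y-1, by ring⟩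
      simp only [add_sub_cancel_left] at r1 r2
      have hu0 : 0 ≤ u := by have := abs_nonneg x; linarith
      have hxy : |x*y| ≤ (1/40)*(3*u) := by
        rw [abs_mul]; exact mul_le_mul (by linarith) (by linarith) (abs_nonneg _) (by norm_num)
      rw [show (1+x)*(1+y) - 1 = x + y + x*y by ring]
      rw [abs_le] at *
      constructor <;> linarith
    · rw [← inv_inv (2*(α^m)⁻¹)]
      apply inv_anti₀ (by positivity)
      rw [mul_inv, inv_inv]
      have e1 : (1/2:ℝ)^2 ≤ (bkc k α)^2 := pow_le_pow_left₀ (by norm_num) hc.1 2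
      have e2 : 120 * α^m ≤ α^(n+m) := by
        rw [pow_add]
        apply mul_le_mul_of_nonneg_right _ (by positivity)
        have := bk_u R (show 10 ≤ n by omega)
        rw [one_div, inv_le_inv₀ (by positivity) (by norm_num)] at this
        exact this
      have e3 : (1/2:ℝ)^2 * (120*α^m) ≤ (bkc k α)^2 * α^(n+m) := mul_le_mul e1 e2 (by positivity) (by positivity)
      have e4 : 0 < α^m := by positivity
      linarith
  · refine lin_ne R a _ 2 d (n+m) (lucasK k n * lucasK k m) S.ha (lk_pos S.hk l) ?_ ?_
    · rw [← S.heq]; ring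
    · calc 15^2 ≤ 58*58 := by norm_num
        _ ≤ _ := Nat.mul_le_mul (lk_big R hn) (lk_big R hm)

lemma bkS_form3 {k n m l d a : ℕ} (S : bkS k n m l d a) {α : ℝ} (R : bkR k α) :
    |bkL k α a (lucasK k l * lucasK k m) 1 d n| ≤ 16*(α^n)⁻¹ ∧ bkL k α a (lucasK k l * lucasK k m) 1 d n ≠ 0 := by
  have hn : 10 ≤ n := by have := S.hn; omega
  have hc := bkR_c R
  have h1 := R.h1
  have hc0 : 0 < bkc k α := by linarith
  have hu := bk_u R hn
  constructor
  · refine lin_upper R a _ 1 d n (lucasK k n :ℝ) _ S.ha S.ha9 (Nat.mul_pos (lk_pos S.hk l) (lk_pos S.hk m)) ?_ ?_ ?_ hu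
    · have := S.heq
      have h' : ((9*(lucasK k n * lucasK k m * lucasK k l) + a : ℕ):ℝ) = ((a * 10^d:ℕ):ℝ) := by rw [this]
      push_cast at h' ⊢
      linarith
    · have r1 := lk_rho R (le_refl n)
      rw [pow_one]
      have : 0 ≤ (α^n)⁻¹ := by positivity
      linarith
    · rw [← inv_inv (2*(α^n)⁻¹)]
      apply inv_anti₀ (by positivity)
      rw [mul_inv, inv_inv, pow_one]
      have e4 : 0 < α^n := by positivity
      have := mul_le_mul_of_nonneg_right hc.1 e4.le
      linarith
  · refine lin_ne R a _ 1 d n (lucasK k n) S.ha (Nat.mul_pos (lk_pos S.hk l) (lk_pos S.hk m)) ?_ ?_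
    · rw [← S.heq]; ring
    · exact le_trans (by norm_num) (lk_big R hn)

lemma bk_stepj {k : ℕ} {α : ℝ} (R : bkR k α) (Λ : ℝ) (j X : ℕ) (h1 : |Λ| ≤ 16*(α^j)⁻¹) (h2 : Real.exp (-(X:ℝ)) < |Λ|) :
    j ≤ 3*X+7 := by
  have hα := R.h1
  have h3 : Real.exp (-(X:ℝ)) < 16*(α^j)⁻¹ := h2.trans_le h1
  have hp : 0 < α^j := by positivity
  have h4 : α^j < 16 * Real.exp X := by
    rw [Real.exp_neg] at h3
    have he := Real.exp_pos (X:ℝ)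
    rw [← div_eq_mul_inv, lt_div_iff₀ hp, inv_mul_eq_div, div_lt_iff₀ he] at h3
    exact h3
  have h5 : Real.exp (0.4:ℝ) ≤ α := by
    refine le_trans ?_ R.hl2
    have h : Real.exp (0.4:ℝ) ^ 5 ≤ (1.615:ℝ)^5 := by
      rw [← Real.exp_nat_mul]
      have := Real.exp_one_lt_d9
      have e : Real.exp (((5:ℕ):ℝ) * 0.4) = Real.exp 1 ^ 2 := by rw [← Real.exp_nat_mul]; norm_num
      rw [e]
      nlinarith [Real.exp_pos 1]
    exact le_of_pow_le_pow_left₀ (by norm_num) (by norm_num) h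
  have h6 : Real.exp (0.4*j) < Real.exp (2.8 + X) := by
    rw [Real.exp_add]
    have h16 : (16:ℝ) ≤ Real.exp 2.8 := by
      have e : Real.exp (2.8:ℝ) ^ 5 = Real.exp 1 ^ 14 := by rw [← Real.exp_nat_mul, ← Real.exp_nat_mul]; norm_num
      have h : (16:ℝ)^5 ≤ Real.exp 2.8 ^ 5 := by
        rw [e]
        have := Real.exp_one_gt_d9
        calc (16:ℝ)^5 ≤ 2.7182818283 ^ 14 := by norm_num
          _ ≤ _ := by gcongr
      exact le_of_pow_le_pow_left₀ (by norm_num) (Real.exp_pos _).le h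
    calc Real.exp (0.4*j) = Real.exp 0.4 ^ j := by rw [← Real.exp_nat_mul]; ring_nf
      _ ≤ α^j := by gcongr
      _ < 16 * Real.exp X := h4
      _ ≤ _ := by gcongr
  have h7 := Real.exp_lt_exp.1 h6
  have h8 : (j:ℝ) < 3*X+8 := by
    have : (0:ℝ) ≤ X := by positivity
    linarith
  have : j < 3*X+8 := by exact_mod_cast h8
  omega

section
variable {k n m l d a K h b z J yb D : ℕ}

lemma bkF1 (S : bkS k n m l d a) (hK : k ≤ K) (hD : 3*n ≤ D) (hb1 : 1 ≤ b) (hz1 : 1 ≤ z)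
    (hc : bkCond K 28 b z J yb D) : l ≤ 3*bkX K 28 z yb + 7 := by
  by_cases hl : l < 10
  · by_contra hcon
    have : bkX K 28 z yb = 0 := by omega
    have hX : 0 < bkX K 28 z yb := by unfold bkX; positivity
    omega
  obtain ⟨α, R⟩ := bkR_exists S.hk
  obtain ⟨h1, h2⟩ := bkS_form1 S R (by omega)
  have hd := bkS_d S
  have := S.hnm; have := S.hml; have := S.hn
  exact bk_stepj R _ _ _ h1 (lin_lower R hK S.hk' a 1 3 d (n+m+l) 0 S.ha S.ha9 le_rfl (by norm_num) (by norm_num)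
    28 b z J yb D (by norm_num) (by norm_num) hb1 hz1 (by omega) (by omega) (by omega) hc h2)

lemma bkF2 (S : bkS k n m l d a) (hK : k ≤ K) (hD : 3*n ≤ D) (hb1 : 1 ≤ b) (hz1 : 1 ≤ z)
    (hl : l + 28 ≤ h) (hc : bkCond K h b z J yb D) : m ≤ 3*bkX K h z yb + 7 := by
  by_cases hm : m < 10
  · have hX : 0 < bkX K h z yb := by
      have : 0 < h := by omega
      unfold bkX; positivity
    omega
  obtain ⟨α, R⟩ := bkR_exists S.hk
  obtain ⟨h1, h2⟩ := bkS_form2 S R (by omega)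
  have hd := bkS_d S
  have := S.hnm; have := S.hml; have := S.hn
  have hL : lucasK k l ≤ 2^(l+2) := (lk_le S.hk l).trans (Nat.pow_le_pow_right (by norm_num) (by omega))
  exact bk_stepj R _ _ _ h1 (lin_lower R hK S.hk' a _ 2 d (n+m) l S.ha S.ha9 (lk_pos S.hk l) (by norm_num) hL
    h b z J yb D (by omega) (by omega) hb1 hz1 (by omega) (by omega) (by omega) hc h2)

lemma bkF3 (S : bkS k n m l d a) (hK : k ≤ K) (hD : 3*n ≤ D) (hb1 : 1 ≤ b) (hz1 : 1 ≤ z)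
    (hl : l + m + 28 ≤ h) (hc : bkCond K h b z J yb D) : n ≤ 3*bkX K h z yb + 7 := by
  obtain ⟨α, R⟩ := bkR_exists S.hk
  obtain ⟨h1, h2⟩ := bkS_form3 S R
  have hd := bkS_d S
  have := S.hnm; have := S.hml; have := S.hn
  have hL : lucasK k l * lucasK k m ≤ 2^(l+m+2) := by
    calc _ ≤ 2^(l+1) * 2^(m+1) := Nat.mul_le_mul (lk_le S.hk l) (lk_le S.hk m)
      _ = _ := by ring
  exact bk_stepj R _ _ _ h1 (lin_lower R hK S.hk' a _ 1 d n (l+m) S.ha S.ha9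
    (Nat.mul_pos (lk_pos S.hk l) (lk_pos S.hk m)) (by norm_num) hL
    h b z J yb D (by omega) (by omega) hb1 hz1 (by omega) (by omega) (by omega) hc h2)
end

lemma bkCond_pow (η lam : ℕ) (H : 2*η+12*lam+160 ≤ 2^lam) :
    bkCond 650 (2^η) (2^(lam+1)) (2^(45+4*lam)) (2^lam-1) (2*η+12*lam+147) (2^(2^lam+2)) := by
  set t := 2^lam with ht
  have ht1 : 160 ≤ t := by omega
  have e1 : 2^(lam+1) = 2*t := by rw [ht]; ring
  have e2 : 2^(45+4*lam) = 2^45*t^4 := by rw [ht, pow_add, mul_comm 4 lam, pow_mul]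
  have e3 : t - 1 + 1 = t := by omega
  unfold bkCond
  rw [e3]
  refine ⟨?_, ?_, ?_, ?_⟩
  · rw [e1, e2]
    have h1 : 2*(650+1)*t*(2*t)+1 ≤ 2605*t^2 := by nlinarith
    calc _ ≤ 16*(650+1)*t^2*(814+36*650)^2*(2605*t^2) := Nat.mul_le_mul le_rfl h1
      _ = (16*(650+1)*(814+36*650)^2*2605)*t^4 := by ring
      _ ≤ (510*2^45)*t^4 := Nat.mul_le_mul (by norm_num) le_rfl
      _ = _ := by ring
  · calc 1020*(2^η)^2*(2^(45+4*lam))^3 ≤ 2^10*(2^η)^2*(2^(45+4*lam))^3 := by gcongr; norm_num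
      _ = 2^(10+η*2+(45+4*lam)*3) := by rw [← pow_mul, ← pow_mul, ← pow_add, ← pow_add]
      _ ≤ 2^(2*(t-1)) := Nat.pow_le_pow_right (by norm_num) (by omega)
      _ = 1*4^(t-1) := by rw [pow_mul]; norm_num
      _ ≤ _ := Nat.mul_le_mul (by omega) le_rfl
  · calc 4080*(2^η)^2*(2^(45+4*lam))^3 ≤ 2^12*(2^η)^2*(2^(45+4*lam))^3 := by gcongr; norm_num
      _ = 2^(12+η*2+(45+4*lam)*3) := by rw [← pow_mul, ← pow_mul, ← pow_add, ← pow_add]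
      _ ≤ _ := Nat.pow_le_pow_right (by norm_num) (by omega)
  · have a1 : 264*2^η*(2^(45+4*lam))^2*2^(t+2) ≤ 2^(2*t-1) := by
      calc _ ≤ 2^9*2^η*(2^(45+4*lam))^2*2^(t+2) := by gcongr; norm_num
        _ = 2^(9+η+(45+4*lam)*2+(t+2)) := by rw [← pow_mul, ← pow_add, ← pow_add, ← pow_add]
        _ ≤ _ := Nat.pow_le_pow_right (by norm_num) (by omega)
    have a2 : 170*(2^η)^2*(2^(45+4*lam))^2 ≤ 2^(2*t-1) := by
      calc _ ≤ 2^8*(2^η)^2*(2^(45+4*lam))^2 := by gcongr; norm_num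
        _ = 2^(8+η*2+(45+4*lam)*2) := by rw [← pow_mul, ← pow_mul, ← pow_add, ← pow_add]
        _ ≤ _ := Nat.pow_le_pow_right (by norm_num) (by omega)
    have a3 : 2^(2^(lam+1)) = 2*2^(2*t-1) := by
      have e9 : 2^(lam+1) = (2*t-1)+1 := by omega
      rw [e9, pow_succ']
    rw [a3, two_mul]; exact Nat.add_le_add a1 a2

lemma bkX_pow (η lam : ℕ) (H : 2*η+12*lam+160 ≤ 2^lam) :
    3*bkX 650 (2^η) (2^(45+4*lam)) (2*η+12*lam+147) + 7 < 2^(212+3*η+17*lam) := by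
  unfold bkX
  set h := 2^η with hh
  set z := 2^(45+4*lam) with hz
  have hpos : 0 < h^3*z^4 := by positivity
  have e : 2^(212+3*η+17*lam) = 2^32*(h^3*z^4*2^lam) := by
    rw [hh, hz, ← pow_mul, ← pow_mul, ← pow_add, ← pow_add, ← pow_add]; congr 1; ring
  rw [e]
  have a1 : 4*(4*h*z*(814+36*650))*(1020*h^2*z^3)*(2*η+12*lam+147+8) ≤ 2^29*(h^3*z^4*2^lam) := by
    calc _ = (4*4*24214*1020)*(h^3*z^4*(2*η+12*lam+147+8)) := by ring
      _ ≤ 2^29*(h^3*z^4*2^lam) := by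
        apply Nat.mul_le_mul (by norm_num)
        exact Nat.mul_le_mul le_rfl (by omega)
  have : 1 ≤ h^3*z^4*2^lam := Nat.mul_pos hpos (by positivity)
  omega

lemma bk_desc {k n m l d a : ℕ} (S : bkS k n m l d a) (lam : ℕ) (H : 442*0+2*(898+68*lam)+12*lam+160 ≤ 2^lam)
    (hn : n < 2^(2^lam)) : n < 2^(2906+221*lam) := by
  have hD : 3*n ≤ 2^(2^lam+2) := by rw [pow_add]; omega
  have hpw : ∀ e : ℕ, 1 ≤ 2^e := fun e => Nat.one_le_two_pow
  have c1 := bkCond_pow 5 lam (by omega)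
  have c1' : bkCond 650 28 (2^(lam+1)) (2^(45+4*lam)) (2^lam-1) (2*5+12*lam+147) (2^(2^lam+2)) := by
    obtain ⟨a1, a2, a3, a4⟩ := c1
    refine ⟨a1, le_trans ?_ a2, le_trans ?_ a3, le_trans ?_ a4⟩
    · gcongr; norm_num
    · gcongr; norm_num
    · gcongr <;> norm_num
  have hl := bkF1 S S.hk' hD (hpw _) (hpw _) c1'
  have hl2 : l < 2^(212+3*5+17*lam) := by
    refine lt_of_le_of_lt (hl.trans ?_) (bkX_pow 5 lam (by omega))
    have : bkX 650 28 (2^(45+4*lam)) (2*5+12*lam+147) ≤ bkX 650 (2^5) (2^(45+4*lam)) (2*5+12*lam+147) := by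
      unfold bkX; gcongr <;> norm_num
    omega
  have hm := bkF2 S S.hk' hD (hpw _) (hpw _) (h := 2^(228+17*lam)) (by
    have e : 2^(228+17*lam) = 2*2^(212+3*5+17*lam) := by rw [← pow_succ']; congr 1; ring
    have e2 : 28 ≤ 2^(212+3*5+17*lam) := by
      calc 28 ≤ 2^5 := by norm_num
        _ ≤ _ := Nat.pow_le_pow_right (by norm_num) (by omega)
    omega) (bkCond_pow _ lam (by omega))
  have hm2 := lt_of_le_of_lt hm (bkX_pow (228+17*lam) lam (by omega))
  have hn' := bkF3 S S.hk' hD (hpw _) (hpw _) (h := 2^(898+68*lam)) (by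
    have e : 2^(898+68*lam) = 4*2^(212+3*(228+17*lam)+17*lam) := by
      rw [show (4:ℕ) = 2^2 by norm_num, ← pow_add]; congr 1; ring
    have e2 : 28 ≤ 2^(212+3*(228+17*lam)+17*lam) := by
      calc 28 ≤ 2^5 := by norm_num
        _ ≤ _ := Nat.pow_le_pow_right (by norm_num) (by omega)
    have := S.hml
    omega) (bkCond_pow _ lam (by omega))
  have hn2 := lt_of_le_of_lt hn' (bkX_pow (898+68*lam) lam (by omega))
  refine hn2.trans_le (Nat.pow_le_pow_right (by norm_num) (by omega))

lemma bk_desc0 {k n m l d a : ℕ} (S : bkS k n m l d a) : n < 2^5779 := by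
  have key : ∀ j : ℕ, n < 2^(2^(13+j)) → n < 2^(2^13) := by
    intro j
    induction j with
    | zero => intro h; exact h
    | succ j ih =>
      intro h
      apply ih
      have hb : 2906+221*(14+j) ≤ 2^(13+j) := by
        clear ih h
        induction j with
        | zero => norm_num
        | succ j ih => rw [show 13+(j+1) = (13+j)+1 by ring, pow_succ]; omega
      have hb' : 2^(13+(j+1)) = 2*2^(13+j) := by rw [← pow_succ']; congr 1
      exact (bk_desc S (13+(j+1)) (by omega) h).trans_le (Nat.pow_le_pow_right (by norm_num) (by omega))
  have h0 : n < 2^(2^(13+n)) := by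
    have a1 : n < 2^n := Nat.lt_two_pow_self
    have a2 : 13 + n < 2^(13+n) := Nat.lt_two_pow_self
    exact a1.trans (Nat.pow_lt_pow_right (by norm_num) (by omega))
  exact bk_desc S 13 (by norm_num) (key n h0)

theorem bk_g1 {k n m l d a K b z J yb ℓ h' : ℕ} (S : bkS k n m l d a) (hK : k ≤ K) (hn : n < 2 ^ ℓ)
    (hb1 : 1 ≤ b) (hz1 : 1 ≤ z) (hc : bkCond K 28 b z J yb (2 ^ (ℓ + 2))) (hE : 3*bkX K 28 z yb + 7 + 28 ≤ h') :
    l + 28 ≤ h' := by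
  have hD : 3 * n ≤ 2 ^ (ℓ + 2) := by rw [pow_add]; generalize 2 ^ ℓ = t at hn; omega
  have := bkF1 S hK hD hb1 hz1 hc
  omega

theorem bk_g2 {k n m l d a K b z J yb ℓ h h' : ℕ} (S : bkS k n m l d a) (hK : k ≤ K) (hn : n < 2 ^ ℓ) (hl : l + 28 ≤ h)
    (hb1 : 1 ≤ b) (hz1 : 1 ≤ z) (hc : bkCond K h b z J yb (2 ^ (ℓ + 2))) (hE : 2 * (3*bkX K h z yb + 7) + 28 ≤ h') :
    l + m + 28 ≤ h' := by
  have hD : 3 * n ≤ 2 ^ (ℓ + 2) := by rw [pow_add]; generalize 2 ^ ℓ = t at hn; omega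
  have := bkF2 S hK hD hb1 hz1 hl hc
  have := S.hml
  omega

theorem bk_g3 {k n m l d a K b z J yb ℓ h h' : ℕ} (S : bkS k n m l d a) (hK : k ≤ K) (hn : n < 2 ^ ℓ) (hl : l + m + 28 ≤ h)
    (hb1 : 1 ≤ b) (hz1 : 1 ≤ z) (hc : bkCond K h b z J yb (2 ^ (ℓ + 2))) (hE : 3*bkX K h z yb + 7 + 1 ≤ h') :
    n < h' := by
  have hD : 3 * n ≤ 2 ^ (ℓ + 2) := by rw [pow_add]; generalize 2 ^ ℓ = t at hn; omega
  have := bkF3 S hK hD hb1 hz1 hl hc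
  omega

theorem bk_descA {k n m l d a : ℕ} (S : bkS k n m l d a) : n < 2 ^ 4746 := by
  have hn0 := bk_desc0 S
  have hl0 := bk_g1 (K := 650) (b := 5948) (z := 130286639937491509074619) (J := 111) (yb := 252) (ℓ := 5779) (h' := 2 ^ 360) S (by have := S.hk'; omega) hn0 (by norm_num) (by norm_num)
    (by unfold bkCond; decide +kernel) (by decide +kernel)
  have hm0 := bk_g2 (K := 650) (b := 6316) (z := 10553531380390247587979530) (J := 474) (yb := 982) (ℓ := 5779) (h := 2 ^ 360) (h' := 2 ^ 1454) S (by have := S.hk'; omega) hn0 hl0 (by norm_num) (by norm_num)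
    (by unfold bkCond; decide +kernel) (by decide +kernel)
  have hn1 := bk_g3 (K := 650) (b := 7421) (z := 452903760400777249733752977) (J := 1575) (yb := 3186) (ℓ := 5779) (h := 2 ^ 1454) (h' := 2 ^ 4758) S (by have := S.hk'; omega) hn0 hm0 (by norm_num) (by norm_num)
    (by unfold bkCond; decide +kernel) (by decide +kernel)
  have hl1 := bk_g1 (K := 650) (b := 4926) (z := 105036006159600190105370) (J := 110) (yb := 252) (ℓ := 4758) (h' := 2 ^ 359) S (by have := S.hk'; omega) hn1 (by norm_num) (by norm_num)
    (by unfold bkCond; decide +kernel) (by decide +kernel)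
  have hm1 := bk_g2 (K := 650) (b := 5293) (z := 8788439647427195459700864) (J := 473) (yb := 979) (ℓ := 4758) (h := 2 ^ 359) (h' := 2 ^ 1450) S (by have := S.hk'; omega) hn1 hl1 (by norm_num) (by norm_num)
    (by unfold bkCond; decide +kernel) (by decide +kernel)
  have hn2 := bk_g3 (K := 650) (b := 6395) (z := 387322770312425940249554083) (J := 1571) (yb := 3177) (ℓ := 4758) (h := 2 ^ 1450) (h' := 2 ^ 4746) S (by have := S.hk'; omega) hn1 hm1 (by norm_num) (by norm_num)
    (by unfold bkCond; decide +kernel) (by decide +kernel)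
  exact hn2

theorem bk_descB {k n m l d a : ℕ} (S : bkS k n m l d a) (hl : l ≤ 7020) : n < 2 ^ 1504 := by
  have hn0 := bk_descA S
  have hl0 : l + 28 ≤ 7048 := by omega
  have hm0 := bk_g2 (K := 650) (b := 4923) (z := 132632034036848328786523) (J := 119) (yb := 268) (ℓ := 4746) (h := 7048) (h' := 2 ^ 385) S (by have := S.hk'; omega) hn0 hl0 (by norm_num) (by norm_num)
    (by unfold bkCond; decide +kernel) (by decide +kernel)
  have hn1 := bk_g3 (K := 650) (b := 5308) (z := 10344649558584725123105883) (J := 499) (yb := 1032) (ℓ := 4746) (h := 2 ^ 385) (h' := 2 ^ 1528) S (by have := S.hk'; omega) hn0 hm0 (by norm_num) (by norm_num)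
    (by unfold bkCond; decide +kernel) (by decide +kernel)
  have hm1 := bk_g2 (K := 650) (b := 1702) (z := 43599392183546948945512) (J := 117) (yb := 264) (ℓ := 1528) (h := 7048) (h' := 2 ^ 379) S (by have := S.hk'; omega) hn1 hl0 (by norm_num) (by norm_num)
    (by unfold bkCond; decide +kernel) (by decide +kernel)
  have hn2 := bk_g3 (K := 650) (b := 2081) (z := 3887654787555059882335789) (J := 492) (yb := 1016) (ℓ := 1528) (h := 2 ^ 379) (h' := 2 ^ 1504) S (by have := S.hk'; omega) hn1 hm1 (by norm_num) (by norm_num)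
    (by unfold bkCond; decide +kernel) (by decide +kernel)
  exact hn2

theorem bk_descC16 {k n m l d a : ℕ} (S : bkS k n m l d a) (hk : k ≤ 16) (hn0 : n < 2 ^ 1504) (hm : m ≤ 2299) : n < 2 ^ 283 := by
  have hl0 : l + m + 28 ≤ 4626 := by have := S.hml; omega
  have hn1 := bk_g3 (K := 16) (b := 1637) (z := 41810324662512000) (J := 89) (yb := 202) (ℓ := 1504) (h := 4626) (h' := 2 ^ 292) S (by have := S.hk'; omega) hn0 hl0 (by norm_num) (by norm_num)
    (by unfold bkCond; decide +kernel) (by decide +kernel)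
  have hn2 := bk_g3 (K := 16) (b := 421) (z := 10051657974964907) (J := 87) (yb := 196) (ℓ := 292) (h := 4626) (h' := 2 ^ 283) S (by have := S.hk'; omega) hn1 hl0 (by norm_num) (by norm_num)
    (by unfold bkCond; decide +kernel) (by decide +kernel)
  exact hn2

theorem bk_descC650 {k n m l d a : ℕ} (S : bkS k n m l d a) (hk : k ≤ 650) (hn0 : n < 2 ^ 1504) (hm : m ≤ 2299) : n < 2 ^ 369 := by
  have hl0 : l + m + 28 ≤ 4626 := by have := S.hml; omega
  have hn1 := bk_g3 (K := 650) (b := 1677) (z := 41876030269353846611239) (J := 116) (yb := 262) (ℓ := 1504) (h := 4626) (h' := 2 ^ 376) S (by have := S.hk'; omega) hn0 hl0 (by norm_num) (by norm_num)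
    (by unfold bkCond; decide +kernel) (by decide +kernel)
  have hn2 := bk_g3 (K := 650) (b := 546) (z := 13287444733169295982647) (J := 115) (yb := 257) (ℓ := 376) (h := 4626) (h' := 2 ^ 369) S (by have := S.hk'; omega) hn1 hl0 (by norm_num) (by norm_num)
    (by unfold bkCond; decide +kernel) (by decide +kernel)
  exact hn2

/-! Kernel computations: fixed point logarithms and the reduction test. -/
noncomputable def frc {β : Type} (n : Nat) (f : Nat → β) : β := Nat.rec (f 0) (fun m _ => f (Nat.succ m)) n
noncomputable def bcd {β : Type} (c : Bool) (t e : β) : β := Bool.rec e t c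

/-- Denominators of convergents, many steps at a time. -/
noncomputable def eus (X : Nat) (κ : Nat → Nat → Nat → Nat → Nat) (fuel : Nat) : Nat → Nat → Nat → Nat → Nat :=
  Nat.rec (fun _ _ _ _ => 0) (fun _ ih a b q0 q1 =>
    bcd (Nat.ble X q1) (κ a b q0 q1) ((fun r0 q2 : Nat =>
      (fun r1 q3 : Nat =>
      (fun r2 q4 : Nat =>
      (fun r3 q5 : Nat =>
      (fun r4 q6 : Nat =>
      (fun r5 q7 : Nat =>
      (fun r6 q8 : Nat =>
      (fun r7 q9 : Nat =>
      (fun r8 q10 : Nat =>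
      (fun r9 q11 : Nat =>
      (fun r10 q12 : Nat =>
      (fun r11 q13 : Nat =>
      (fun r12 q14 : Nat =>
      (fun r13 q15 : Nat =>
      (fun r14 q16 : Nat =>
      (fun r15 q17 : Nat =>
      frc r14 fun a => frc r15 fun b => frc q16 fun q0 => frc q17 fun q1 => ih a b q0 q1)
      (Nat.mod r13 r14) (Nat.add q15 (Nat.mul (Nat.div r13 r14) q16)))
      (Nat.mod r12 r13) (Nat.add q14 (Nat.mul (Nat.div r12 r13) q15)))
      (Nat.mod r11 r12) (Nat.add q13 (Nat.mul (Nat.div r11 r12) q14)))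
      (Nat.mod r10 r11) (Nat.add q12 (Nat.mul (Nat.div r10 r11) q13)))
      (Nat.mod r9 r10) (Nat.add q11 (Nat.mul (Nat.div r9 r10) q12)))
      (Nat.mod r8 r9) (Nat.add q10 (Nat.mul (Nat.div r8 r9) q11)))
      (Nat.mod r7 r8) (Nat.add q9 (Nat.mul (Nat.div r7 r8) q10)))
      (Nat.mod r6 r7) (Nat.add q8 (Nat.mul (Nat.div r6 r7) q9)))
      (Nat.mod r5 r6) (Nat.add q7 (Nat.mul (Nat.div r5 r6) q8)))
      (Nat.mod r4 r5) (Nat.add q6 (Nat.mul (Nat.div r4 r5) q7)))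
      (Nat.mod r3 r4) (Nat.add q5 (Nat.mul (Nat.div r3 r4) q6)))
      (Nat.mod r2 r3) (Nat.add q4 (Nat.mul (Nat.div r2 r3) q5)))
      (Nat.mod r1 r2) (Nat.add q3 (Nat.mul (Nat.div r1 r2) q4)))
      (Nat.mod r0 r1) (Nat.add q2 (Nat.mul (Nat.div r0 r1) q3)))
      (Nat.mod b r0) (Nat.add q1 (Nat.mul (Nat.div b r0) q2)))
      (Nat.mod a b) (Nat.add q0 (Nat.mul (Nat.div a b) q1)))) fuel

/-- Denominators of convergents, one step at a time. -/
noncomputable def eu1 (X : Nat) (fuel : Nat) : Nat → Nat → Nat → Nat → Nat :=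
  Nat.rec (fun _ _ _ _ => 0) (fun _ ih a b q0 q1 =>
    bcd (Nat.ble X q1) q1 (frc (Nat.mod a b) fun r => frc (Nat.add q0 (Nat.mul (Nat.div a b) q1)) fun q2 =>
      ih b r q1 q2)) fuel

noncomputable def atL (p x2 n : Nat) : Nat → Nat → Nat → Nat :=
  Nat.rec (fun _ _ s => s) (fun _ ih t o s =>
    bcd (Nat.beq t 0) s
    (frc (Nat.shiftRight (Nat.mul t x2) p) fun t1 => frc (Nat.add s (Nat.div t o)) fun s1 =>
      frc (Nat.add o 2) fun o1 => ih t1 o1 s1)) n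

/-- Approximates `2^p * log ((v+u)/(v-u))`. -/
noncomputable def atv (p u v : Nat) : Nat :=
    frc (Nat.div (Nat.shiftLeft u p) v) fun x => frc (Nat.shiftRight (Nat.mul x x) p) fun x2 =>
      Nat.mul 2 (atL p x2 p x 1 0)

/-- Passes on an approximation of `W + 2^p * log (a/b)`. -/
noncomputable def lgO (p W a b : Nat) (κ : Nat → Bool) : Bool :=
  frc (Nat.add a b) fun v =>
  bcd (Nat.ble b a)
    (frc (Nat.sub a b) fun u => bcd (Nat.ble (Nat.mul 2 u) v) (frc (Nat.add W (atv p u v)) κ) false)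
    (frc (Nat.sub b a) fun u => bcd (Nat.ble (Nat.mul 2 u) v)
      (frc (atv p u v) fun t => bcd (Nat.ble t W) (frc (Nat.sub W t) κ) false) false)

/-- Fixed point power (`c = 0`: rounded down, `c = 1`: rounded up). -/
noncomputable def pwr (p x c fuel : Nat) : Nat → Nat :=
  Nat.rec (fun _ => Nat.shiftLeft 1 p) (fun _ ih k =>
    frc (ih (Nat.div k 2)) fun h => frc (Nat.add (Nat.shiftRight (Nat.mul h h) p) c) fun s =>
      bcd (Nat.beq (Nat.mod k 2) 0) s (Nat.add (Nat.shiftRight (Nat.mul s x) p) c)) fuel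

noncomputable def nwt (p U k fuel : Nat) : Nat → Nat :=
  Nat.rec (fun x => x) (fun _ ih x =>
    frc (pwr p x 0 10 k) fun P =>
    frc (Nat.div (Nat.shiftLeft (Nat.sub U (Nat.shiftRight (Nat.mul P (Nat.sub (Nat.mul 2 U) x)) p)) p)
      (Nat.div (Nat.mul P (Nat.sub (Nat.mul (Nat.succ k) x) (Nat.mul (Nat.mul 2 k) U))) x)) fun st =>
    bcd (Nat.ble st 64) (Nat.sub (Nat.sub x st) 4096) (frc (Nat.sub x st) ih)) fuel

/-- Verified approximation of `2^p * α` up to 8192 units. -/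
noncomputable def alC (p U k : Nat) (κ : Nat → Bool) : Bool :=
  frc (nwt p U k 30 (Nat.mul 2 U)) fun x =>
  bcd (Nat.ble (Nat.succ U) x) (bcd (Nat.ble (Nat.add x 8192) (Nat.mul 2 U))
  (bcd (Nat.ble (Nat.mul U U) (Nat.mul (pwr p x 0 10 k) (Nat.sub (Nat.mul 2 U) x)))
  (bcd (Nat.ble (Nat.mul (pwr p (Nat.add x 8192) 1 10 k) (Nat.sub (Nat.mul 2 U) (Nat.add x 8192))) (Nat.mul U U))
    (κ x) false) false) false) false

/-- The nine tests. -/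
noncomputable def tst9 (B Y r1 r2 r3 r4 r5 r6 r7 r8 r9 v : Nat) : Bool :=
  Nat.beq
    (Nat.add (Nat.sub (Nat.mod (Nat.add r1 v) B) Y) (Nat.add (Nat.sub (Nat.mod (Nat.add r2 v) B) Y)
    (Nat.add (Nat.sub (Nat.mod (Nat.add r3 v) B) Y) (Nat.add (Nat.sub (Nat.mod (Nat.add r4 v) B) Y)
    (Nat.add (Nat.sub (Nat.mod (Nat.add r5 v) B) Y) (Nat.add (Nat.sub (Nat.mod (Nat.add r6 v) B) Y)
    (Nat.add (Nat.sub (Nat.mod (Nat.add r7 v) B) Y) (Nat.add (Nat.sub (Nat.mod (Nat.add r8 v) B) Y)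
    (Nat.sub (Nat.mod (Nat.add r9 v) B) Y))))))))) 0

/-- Builds the nine tests from the logarithms of `1, …, 9`. -/
noncomputable def mk9 (Q B S Y O l2 l3 l5 l7 : Nat) (κ : (Nat → Bool) → (Nat → Bool) → Bool) : Bool :=
  frc (Nat.add (Nat.mod (Nat.mul Q O) B) S) fun r1 =>
  frc (Nat.add (Nat.mod (Nat.mul Q (Nat.add O l2)) B) S) fun r2 =>
  frc (Nat.add (Nat.mod (Nat.mul Q (Nat.add O l3)) B) S) fun r3 =>
  frc (Nat.add (Nat.mod (Nat.mul Q (Nat.add O (Nat.mul 2 l2))) B) S) fun r4 =>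
  frc (Nat.add (Nat.mod (Nat.mul Q (Nat.add O l5)) B) S) fun r5 =>
  frc (Nat.add (Nat.mod (Nat.mul Q (Nat.add O (Nat.add l2 l3))) B) S) fun r6 =>
  frc (Nat.add (Nat.mod (Nat.mul Q (Nat.add O l7)) B) S) fun r7 =>
  frc (Nat.add (Nat.mod (Nat.mul Q (Nat.add O (Nat.mul 3 l2))) B) S) fun r8 =>
  frc (Nat.add (Nat.mod (Nat.mul Q (Nat.add O (Nat.mul 2 l3))) B) S) fun r9 =>
    κ (fun v => tst9 B Y r1 r2 r3 r4 r5 r6 r7 r8 r9 v) (fun v => tst9 B Y r1 r2 r3 r4 r5 r6 r7 r8 r8 v)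

noncomputable def prs (f : Nat → Bool) (v : Nat) (ns : List Nat) : Bool :=
  List.rec true (fun w _ ih => bcd (frc (Nat.add w v) f) ih false) ns

noncomputable def rvl (R : List Nat) : List Nat → List Nat :=
  List.rec (fun acc => acc) (fun h _ ih acc => ih (h :: acc)) R

/-- The main loop over `l`; the value `c` is `L_n + s * (n + k)`, where `sn = s * (n + k)`. -/
noncomputable def lpp (p x B W Q mf s D : Nat) (f2 : Nat → Nat → Bool) (f1 : Nat → Bool) (fuel : Nat) :
    List Nat → List Nat → Nat → Nat → Nat → List Nat → Bool :=
  Nat.rec (fun _ _ _ _ _ _ => true) (fun fu ih F R c sn A ns =>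
    let κ : List Nat → Bool := fun ns =>
      let nx : Nat → List Nat → List Nat → Bool := fun h F R =>
        frc (Nat.sub (Nat.sub (Nat.mul 2 c) h) D) fun c' => frc (Nat.add sn s) fun sn' =>
        frc (Nat.add (Nat.shiftRight (Nat.mul A x) p) sn') fun A' => ih F (c' :: R) c' sn' A' ns
      List.rec (List.rec false (fun h F' _ => nx h F' []) (rvl R [])) (fun h F' _ => nx h F' R) F
    bcd (Nat.beq (Nat.mul (Nat.mod c 16) (Nat.mod c 25)) 0) (κ ns)
      (lgO p W A (Nat.shiftLeft (Nat.sub c sn) p) fun Z => frc (Nat.mod (Nat.mul Q Z) B) fun v =>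
        bcd (f2 Z v) (bcd (Nat.ble mf fu) (κ (v :: ns)) (bcd (prs f1 v (v :: ns)) (κ (v :: ns)) false)) false)) fuel

/-- `s * (j + k)` for `j = 2 - k, …, -1`, followed by the first three values. -/
noncomputable def zrs (s k : Nat) : List Nat :=
  Nat.rec [Nat.add 2 (Nat.mul s k), Nat.add 1 (Nat.mul s (Nat.add k 1)), Nat.add 3 (Nat.mul s (Nat.add k 2))]
    (fun j ih => Nat.mul s (Nat.sub k (Nat.succ j)) :: ih) (Nat.sub k 2)

/-- The test of the second linear form, with the fallback for `k = 2`, `a = 9`. -/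
noncomputable def tsth (Q B T W : Nat) (h : Bool) (f fh : Nat → Bool) (Z v : Nat) : Bool :=
  bcd (f v) true (bcd h (bcd (fh v)
    (Nat.ble (Nat.add (Nat.mul Q (Nat.add (Nat.sub Z W) (Nat.sub W Z))) T) B) false) false)

/-- The fallback is available: `k = 2` and `Q` is large and coprime to the nearest integer to `Q * L10 / B`. -/
noncomputable def hmk (Q B s L10 xb k : Nat) : Bool :=
  bcd (Nat.beq k 2) (bcd (Nat.ble (Nat.succ (Nat.shiftLeft 1 xb)) Q)
    (bcd (Nat.ble (Nat.mul 2 s) B) (Nat.beq (Nat.gcd (Nat.div (Nat.mul Q L10) B) Q) 1)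
      (Nat.beq (Nat.gcd (Nat.succ (Nat.div (Nat.mul Q L10) B)) Q) 1)) false) false

/-- The tests once all the constants are available. -/
noncomputable def chkT (p x xb l2 l3 l5 l7 mf k nl B C L10 num den Q s T : Nat) : Bool :=
  bcd (Nat.ble (Nat.mul 2 T) B)
  (frc (Nat.sub B T) fun S => frc (Nat.sub B (Nat.mul 2 T)) fun Y =>
  bcd (Nat.ble 1 Q) (bcd (Nat.ble (Nat.mul 2 l3) (Nat.mul 8 B))
  (frc (Nat.sub (Nat.mul 8 B) (Nat.mul 2 l3)) fun O =>
  mk9 Q B S Y (Nat.add O (Nat.mul 3 C)) l2 l3 l5 l7 fun f3 f3h =>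
  bcd (tsth Q B T 0 (hmk Q B s L10 xb k) f3 f3h 0 0)
  (bcd (Nat.beq nl 0) true
  (mk9 Q B S Y (Nat.add O (Nat.mul 2 C)) l2 l3 l5 l7 fun f2 f2h =>
  mk9 Q B S Y (Nat.add O C) l2 l3 l5 l7 fun f1 _ =>
  bcd (Nat.ble l2 (Nat.mul 4 B))
  (frc (Nat.mod (Nat.mul Q (Nat.sub (Nat.mul 4 B) l2)) B) fun v0 =>
  bcd (f2 v0) (bcd (tsth Q B T 0 (hmk Q B s L10 xb k) f2 f2h 0 0)
  (frc (Nat.div (Nat.shiftLeft num p) den) fun A0 => frc (Nat.shiftRight (Nat.mul A0 x) p) fun A1 =>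
   frc (Nat.shiftRight (Nat.mul A1 x) p) fun A2 => frc (Nat.add C (Nat.mul 4 B)) fun W =>
   frc (Nat.mul 400 (Nat.add 10007 (Nat.mul 2237 k))) fun s' => frc (Nat.mul s' (Nat.sub k 1)) fun D =>
   frc (Nat.mul s' (Nat.add k 2)) fun sn => frc (Nat.add 3 sn) fun c =>
   lpp p x B W Q mf s' D (tsth Q B T W (hmk Q B s L10 xb k) f2 f2h) f1 nl (zrs s' k) [] c sn A2 [0, v0])
   false) false) false)) false) false) false) false

/-- Everything for one `k`; `nl = 0`: only the first linear form. -/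
noncomputable def chk1 (p U xb g l2 l3 l5 l7 mf k nl : Nat) : Bool :=
  alC p U k fun x =>
  lgO p l2 x (Nat.mul 2 U) fun B =>
  frc (Nat.mul (Nat.sub (Nat.mul 2 x) U) (Nat.sub x U)) fun num =>
  frc (Nat.mul x (Nat.sub (Nat.mul 2 U) (Nat.mul (Nat.succ k) (Nat.sub (Nat.mul 2 U) x)))) fun den =>
  lgO p (Nat.add (Nat.sub (Nat.mul 2 l2) l3) 1048576) (Nat.mul 3 den) (Nat.mul 4 num) fun C =>
  frc (Nat.add l2 l5) fun L10 =>
  frc (eus (Nat.shiftLeft 1 (Nat.sub (Nat.add xb g) 40))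
    (eu1 (Nat.shiftLeft 1 (Nat.add xb g)) 1000) 1000 B (Nat.mod L10 B) 0 1) fun Q =>
  frc (Nat.mod (Nat.mul Q L10) B) fun s =>
  frc (bcd (Nat.ble (Nat.mul 2 s) B) s (Nat.sub B s)) fun r =>
  frc (Nat.add (Nat.shiftLeft r xb) (Nat.mul Q (Nat.shiftLeft 1 (Nat.sub p (Nat.add xb (Nat.mul 2 g)))))) fun T =>
  chkT p x xb l2 l3 l5 l7 mf k nl B C L10 num den Q s T

/-- Constants of a level. -/
noncomputable def cst (p : Nat) (κ : Nat → Nat → Nat → Nat → Bool) : Bool :=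
  frc (atv p 1 3) fun l2 => frc (Nat.add l2 (atv p 1 5)) fun l3 => frc (Nat.add (Nat.mul 2 l2) (atv p 1 9)) fun l5 =>
  frc (atv p 1 15) fun u7 => bcd (Nat.ble u7 (Nat.mul 3 l2)) (frc (Nat.sub (Nat.mul 3 l2) u7) fun l7 =>
    κ l2 l3 l5 l7) false

/-- Check a range `k, k+1, …, k+cnt-1`. -/
noncomputable def chks (p xb g mf nl k cnt : Nat) : Bool :=
  frc (Nat.shiftLeft 1 p) fun U =>
  cst p fun l2 l3 l5 l7 =>
    (Nat.rec (fun _ => true) (fun _ ih k => bcd (chk1 p U xb g l2 l3 l5 l7 mf k nl) (frc (Nat.succ k) ih) false) cnt : Nat → Bool) k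

theorem ckA_2 : chks 9604 4748 24 0 0 2 60 = true := by decide +kernel
theorem ckA_62 : chks 9604 4748 24 0 0 62 60 = true := by decide +kernel
theorem ckA_122 : chks 9604 4748 24 0 0 122 60 = true := by decide +kernel
theorem ckA_182 : chks 9604 4748 24 0 0 182 60 = true := by decide +kernel
theorem ckA_242 : chks 9604 4748 24 0 0 242 60 = true := by decide +kernel
theorem ckA_302 : chks 9604 4748 24 0 0 302 60 = true := by decide +kernel
theorem ckA_362 : chks 9604 4748 24 0 0 362 60 = true := by decide +kernel
theorem ckA_422 : chks 9604 4748 24 0 0 422 60 = true := by decide +kernel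
theorem ckA_482 : chks 9604 4748 24 0 0 482 60 = true := by decide +kernel
theorem ckA_542 : chks 9604 4748 24 0 0 542 60 = true := by decide +kernel
theorem ckA_602 : chks 9604 4748 24 0 0 602 49 = true := by decide +kernel
theorem ckB2_2 : chks 3128 1506 28 0 2280 2 1 = true := by decide +kernel
theorem ckB3_3 : chks 3128 1506 28 0 1790 3 1 = true := by decide +kernel
theorem ckB_4 : chks 3128 1506 28 0 1697 4 24 = true := by decide +kernel
theorem ckB_28 : chks 3128 1506 28 0 1697 28 24 = true := by decide +kernel
theorem ckB_52 : chks 3128 1506 28 0 1697 52 24 = true := by decide +kernel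
theorem ckB_76 : chks 3128 1506 28 0 1697 76 24 = true := by decide +kernel
theorem ckB_100 : chks 3128 1506 28 0 1697 100 24 = true := by decide +kernel
theorem ckB_124 : chks 3128 1506 28 0 1697 124 24 = true := by decide +kernel
theorem ckB_148 : chks 3128 1506 28 0 1697 148 24 = true := by decide +kernel
theorem ckB_172 : chks 3128 1506 28 0 1697 172 24 = true := by decide +kernel
theorem ckB_196 : chks 3128 1506 28 0 1697 196 24 = true := by decide +kernel
theorem ckB_220 : chks 3128 1506 28 0 1697 220 24 = true := by decide +kernel
theorem ckB_244 : chks 3128 1506 28 0 1697 244 24 = true := by decide +kernel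
theorem ckB_268 : chks 3128 1506 28 0 1697 268 24 = true := by decide +kernel
theorem ckB_292 : chks 3128 1506 28 0 1697 292 24 = true := by decide +kernel
theorem ckB_316 : chks 3128 1506 28 0 1697 316 24 = true := by decide +kernel
theorem ckB_340 : chks 3128 1506 28 0 1697 340 24 = true := by decide +kernel
theorem ckB_364 : chks 3128 1506 28 0 1697 364 24 = true := by decide +kernel
theorem ckB_388 : chks 3128 1506 28 0 1697 388 24 = true := by decide +kernel
theorem ckB_412 : chks 3128 1506 28 0 1697 412 24 = true := by decide +kernel
theorem ckB_436 : chks 3128 1506 28 0 1697 436 24 = true := by decide +kernel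
theorem ckB_460 : chks 3128 1506 28 0 1697 460 24 = true := by decide +kernel
theorem ckB_484 : chks 3128 1506 28 0 1697 484 24 = true := by decide +kernel
theorem ckB_508 : chks 3128 1506 28 0 1697 508 24 = true := by decide +kernel
theorem ckB_532 : chks 3128 1506 28 0 1697 532 24 = true := by decide +kernel
theorem ckB_556 : chks 3128 1506 28 0 1697 556 24 = true := by decide +kernel
theorem ckB_580 : chks 3128 1506 28 0 1697 580 24 = true := by decide +kernel
theorem ckB_604 : chks 3128 1506 28 0 1697 604 24 = true := by decide +kernel
theorem ckB_628 : chks 3128 1506 28 0 1697 628 23 = true := by decide +kernel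
theorem ckC2_2 : chks 678 285 24 0 491 2 1 = true := by decide +kernel
theorem ckC3_3 : chks 678 285 24 87 386 3 1 = true := by decide +kernel
theorem ckC4_4 : chks 678 285 24 67 366 4 1 = true := by decide +kernel
theorem ckC4_5 : chks 678 285 24 67 366 5 1 = true := by decide +kernel
theorem ckC4_6 : chks 678 285 24 67 366 6 1 = true := by decide +kernel
theorem ckC4_7 : chks 678 285 24 67 366 7 1 = true := by decide +kernel
theorem ckC4_8 : chks 678 285 24 67 366 8 1 = true := by decide +kernel
theorem ckC4_9 : chks 678 285 24 67 366 9 1 = true := by decide +kernel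
theorem ckC4_10 : chks 678 285 24 67 366 10 1 = true := by decide +kernel
theorem ckC4_11 : chks 678 285 24 67 366 11 1 = true := by decide +kernel
theorem ckC4_12 : chks 678 285 24 67 366 12 1 = true := by decide +kernel
theorem ckC4_13 : chks 678 285 24 67 366 13 1 = true := by decide +kernel
theorem ckC4_14 : chks 678 285 24 67 366 14 1 = true := by decide +kernel
theorem ckC4_15 : chks 678 285 24 67 366 15 1 = true := by decide +kernel
theorem ckC4_16 : chks 678 285 24 67 366 16 1 = true := by decide +kernel
theorem ckC_17 : chks 850 371 24 160 459 17 40 = true := by decide +kernel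
theorem ckC_57 : chks 850 371 24 160 459 57 40 = true := by decide +kernel
theorem ckC_97 : chks 850 371 24 160 459 97 40 = true := by decide +kernel
theorem ckC_137 : chks 850 371 24 160 459 137 40 = true := by decide +kernel
theorem ckC_177 : chks 850 371 24 160 459 177 40 = true := by decide +kernel
theorem ckC_217 : chks 850 371 24 160 459 217 40 = true := by decide +kernel
theorem ckC_257 : chks 850 371 24 160 459 257 40 = true := by decide +kernel
theorem ckC_297 : chks 850 371 24 160 459 297 40 = true := by decide +kernel
theorem ckC_337 : chks 850 371 24 160 459 337 40 = true := by decide +kernel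
theorem ckC_377 : chks 850 371 24 160 459 377 40 = true := by decide +kernel
theorem ckC_417 : chks 850 371 24 160 459 417 40 = true := by decide +kernel
theorem ckC_457 : chks 850 371 24 160 459 457 40 = true := by decide +kernel
theorem ckC_497 : chks 850 371 24 160 459 497 40 = true := by decide +kernel
theorem ckC_537 : chks 850 371 24 160 459 537 40 = true := by decide +kernel
theorem ckC_577 : chks 850 371 24 160 459 577 40 = true := by decide +kernel
theorem ckC_617 : chks 850 371 24 160 459 617 34 = true := by decide +kernel
theorem ckD_3 : chks 700 11 24 0 75 3 60 = true := by decide +kernel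
theorem ckD_63 : chks 700 11 24 0 75 63 60 = true := by decide +kernel
theorem ckD_123 : chks 700 11 24 0 75 123 60 = true := by decide +kernel
theorem ckD_183 : chks 700 11 24 0 75 183 60 = true := by decide +kernel
theorem ckD_243 : chks 700 11 24 0 75 243 60 = true := by decide +kernel
theorem ckD_303 : chks 700 11 24 0 75 303 60 = true := by decide +kernel
theorem ckD_363 : chks 700 11 24 0 75 363 60 = true := by decide +kernel
theorem ckD_423 : chks 700 11 24 0 75 423 60 = true := by decide +kernel
theorem ckD_483 : chks 700 11 24 0 75 483 60 = true := by decide +kernel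
theorem ckD_543 : chks 700 11 24 0 75 543 60 = true := by decide +kernel
theorem ckD_603 : chks 700 11 24 0 75 603 48 = true := by decide +kernel

theorem frc_eq {β : Type} (n : Nat) (f : Nat → β) : frc n f = f n := by
  cases n <;> rfl
theorem bcd_tt {β : Type} (t e : β) : bcd true t e = t := rfl
theorem bcd_ff {β : Type} (t e : β) : bcd false t e = e := rfl
theorem bcd_and {c t : Bool} (h : bcd c t false = true) : c = true ∧ t = true := by
  cases c
  · cases h
  · exact ⟨rfl, h⟩
theorem bcd_or {c t e : Bool} (h : bcd c t e = true) : (c = true ∧ t = true) ∨ (c = false ∧ e = true) := by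
  cases c
  · exact Or.inr ⟨rfl, h⟩
  · exact Or.inl ⟨rfl, h⟩

theorem flo (a b : ℕ) (hb : 0 < b) : ((a / b : ℕ) : ℝ) ≤ (a:ℝ) / b ∧ (a:ℝ) / b < ((a / b : ℕ) : ℝ) + 1 := by
  have hb' : (0:ℝ) < b := by exact_mod_cast hb
  refine ⟨Nat.cast_div_le, ?_⟩
  rw [div_lt_iff₀ hb']
  have h := Nat.lt_div_mul_add (a := a) hb
  have h2 : a < (a / b + 1) * b := by nlinarith
  exact_mod_cast h2

theorem atL_zero (p x2 t o s : ℕ) : atL p x2 0 t o s = s := rfl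
theorem atL_succ (p x2 n t o s : ℕ) : atL p x2 (n+1) t o s =
    if t = 0 then s else atL p x2 n (t * x2 / 2 ^ p) (o + 2) (s + t / o) := by
  have : atL p x2 (n+1) t o s = bcd (Nat.beq t 0) s
    (frc (Nat.shiftRight (Nat.mul t x2) p) fun t' => frc (Nat.add s (Nat.div t o)) fun s' =>
      frc (Nat.add o 2) fun o' => atL p x2 n t' o' s') := rfl
  rw [this]
  simp only [frc_eq]
  by_cases h : t = 0
  · subst h; rfl
  · rw [if_neg h]
    have : Nat.beq t 0 = false := by
      cases t
      · exact absurd rfl h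
      · rfl
    rw [this, bcd_ff]
    change atL p x2 n ((t * x2) >>> p) (o+2) (s + t / o) = _
    rw [Nat.shiftRight_eq_div_pow]

/-- Loop invariant of the series. -/
theorem atL_inv (p x2 : ℕ) (y : ℝ) (hy0 : 0 ≤ y) (hy : y ≤ 1/2) (T R : ℕ → ℝ)
    (hT : ∀ i, T i = 2 ^ p * y ^ (2*i+1)) (hR : ∀ i, R i = T i / (2*i+1) + R (i+1))
    (hR0 : ∀ i, 0 ≤ R i) (hR1 : ∀ i, R i ≤ 4/3 * T i)
    (hx : (x2:ℝ) ≤ 2 ^ p * y^2) (hx' : 2 ^ p * y^2 - 2 ≤ x2) (n : ℕ) :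
    ∀ i t s : ℕ, (t:ℝ) ≤ T i → T i ≤ t + 3 → T i ≤ 3 * 4 ^ n →
      (atL p x2 n t (2*i+1) s : ℝ) - s ≤ R i ∧ R i - 4 * (n+1) ≤ (atL p x2 n t (2*i+1) s : ℝ) - s := by
  have hU : (0:ℝ) < 2 ^ p := by positivity
  induction n with
  | zero =>
    intro i t s h1 h2 h3
    rw [atL_zero]
    have := hR0 i; have := hR1 i
    norm_num at h3 ⊢
    constructor <;> linarith
  | succ n ih =>
    intro i t s h1 h2 h3
    rw [atL_succ]
    split_ifs with ht
    · subst ht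
      have := hR0 i; have := hR1 i
      have hn : (0:ℝ) ≤ n := Nat.cast_nonneg n
      push_cast at *
      constructor <;> linarith
    · have hy2 : y^2 ≤ 1/4 := by nlinarith
      have hy2' : 0 ≤ y^2 := sq_nonneg y
      have hTs : T (i+1) = T i * y^2 := by rw [hT, hT]; ring
      have hTu : T i ≤ 2 ^ p * (1/2) := by
        rw [hT]
        apply mul_le_mul_of_nonneg_left _ hU.le
        calc y ^ (2*i+1) ≤ y ^ 1 := pow_le_pow_of_le_one hy0 (by linarith) (by omega)
          _ ≤ 1/2 := by simpa using hy
      have hT0 : 0 ≤ T i := by rw [hT]; positivity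
      obtain ⟨f1, f2⟩ := flo (t * x2) (2 ^ p) (by positivity)
      obtain ⟨g1, g2⟩ := flo t (2*i+1) (by positivity)
      push_cast at f1 f2 g1 g2
      have ht0 : (0:ℝ) ≤ t := Nat.cast_nonneg t
      have hx0 : (0:ℝ) ≤ x2 := Nat.cast_nonneg x2
      have k1 : (t:ℝ) * x2 / 2 ^ p ≤ T i * y^2 := by
        rw [div_le_iff₀ hU]
        calc (t:ℝ) * x2 ≤ T i * (2 ^ p * y^2) := mul_le_mul h1 hx hx0 hT0
          _ = _ := by ring
      have k2 : T i * y^2 - 7/4 ≤ (t:ℝ) * x2 / 2 ^ p := by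
        rw [le_div_iff₀ hU]
        have e1 : (t:ℝ) * (2 ^ p * y^2 - 2) ≤ t * x2 := mul_le_mul_of_nonneg_left hx' ht0
        have e2 : (T i - 3) * (2 ^ p * y^2) ≤ t * (2 ^ p * y^2) :=
          mul_le_mul_of_nonneg_right (by linarith) (by positivity)
        have e3 : (2:ℝ) ^ p * y^2 ≤ 2 ^ p * (1/4) := mul_le_mul_of_nonneg_left hy2 hU.le
        nlinarith
      have := ih (i+1) (t * x2 / 2 ^ p) (s + t / (2*i+1)) (by rw [hTs]; linarith)
        (by rw [hTs]; linarith) (by rw [hTs]; rw [pow_succ] at h3; nlinarith)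
      rw [show 2 * i + 1 + 2 = 2 * (i+1) + 1 by ring]
      have hRi := hR i
      obtain ⟨a1, a2⟩ := this
      have hoc : (1:ℝ) ≤ 2 * (i:ℝ) + 1 := by have : (0:ℝ) ≤ i := Nat.cast_nonneg i; linarith
      have g3 : (t:ℝ) / (2 * i + 1) ≤ T i / (2*i+1) := by gcongr
      have g4 : T i / (2*i+1) ≤ (t:ℝ) / (2 * i + 1) + 3 := by
        rw [div_add' _ _ _ (by linarith)]
        gcongr
        nlinarith
      push_cast at a1 a2 ⊢
      constructor <;> linarith

theorem atv_eq (p u v : ℕ) : atv p u v =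
    2 * atL p ((u * 2 ^ p / v) * (u * 2 ^ p / v) / 2 ^ p) p (u * 2 ^ p / v) 1 0 := by
  unfold atv
  simp only [frc_eq]
  change 2 * atL p (((u <<< p / v) * (u <<< p / v)) >>> p) p (u <<< p / v) 1 0 = _
  rw [Nat.shiftRight_eq_div_pow, Nat.shiftLeft_eq]

theorem atv_spec (p u v : ℕ) (hv : 0 < v) (huv : 2 * u ≤ v) (hp : p ≤ 10000) :
    |(atv p u v : ℝ) - 2 ^ p * Real.log ((v + u) / (v - u))| ≤ 2 ^ 17 := by
  have hv' : (0:ℝ) < v := by exact_mod_cast hv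
  have hu0 : (0:ℝ) ≤ u := Nat.cast_nonneg u
  have huv' : 2 * (u:ℝ) ≤ v := by exact_mod_cast huv
  set y : ℝ := u / v with hyd
  have hy0 : 0 ≤ y := by positivity
  have hy : y ≤ 1/2 := by rw [hyd, div_le_iff₀ hv']; linarith
  have hU : (0:ℝ) < 2 ^ p := by positivity
  have hlog : Real.log ((v + u) / (v - u)) = Real.log (1 + y) - Real.log (1 - y) := by
    rw [← Real.log_div (by linarith) (by linarith)]
    congr 1
    rw [hyd]; field_simp
  have hs := Real.hasSum_log_sub_log_of_abs_lt_one (x := y) (by rw [abs_of_nonneg hy0]; linarith)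
  set T : ℕ → ℝ := fun i => 2 ^ p * y ^ (2*i+1) with hTd
  set G : ℕ → ℝ := fun i => T i / (2*i+1) with hGd
  have hGs : HasSum G (2 ^ p * (Real.log (1 + y) - Real.log (1 - y)) / 2) := by
    have := (hs.mul_left ((2:ℝ) ^ p / 2))
    have e1 : G = fun i : ℕ => (2:ℝ) ^ p / 2 * (2 * (1 / (2 * (i:ℝ) + 1)) * y ^ (2 * i + 1)) := by
      funext i; simp only [hGd, hTd]; ring
    rw [e1, mul_div_right_comm]
    exact this
  have hG0 : ∀ i, 0 ≤ G i := fun i => by simp only [hGd, hTd]; positivity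
  set R : ℕ → ℝ := fun i => ∑' j, G (j + i) with hRd
  have hsum : ∀ i, Summable fun j => G (j + i) := fun i => (summable_nat_add_iff i).2 hGs.summable
  have hR : ∀ i, R i = T i / (2*i+1) + R (i+1) := by
    intro i
    simp only [hRd]
    rw [(hsum i).tsum_eq_zero_add]
    congr 1
    · simp [hGd]
    · congr 1; funext j; congr 1; ring
  have hR0 : ∀ i, 0 ≤ R i := fun i => tsum_nonneg fun j => hG0 _
  have hR1 : ∀ i, R i ≤ 4/3 * T i := by
    intro i
    have hg : HasSum (fun j : ℕ => T i * (1/4:ℝ) ^ j) (T i * (1 - 1/4)⁻¹) :=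
      (hasSum_geometric_of_lt_one (by norm_num) (by norm_num)).mul_left _
    have : R i ≤ T i * (1 - 1/4)⁻¹ := by
      rw [← hg.tsum_eq]
      apply (hsum i).tsum_le_tsum _ hg.summable
      intro j
      simp only [hGd, hTd]
      have h1 : y ^ (2 * (j+i) + 1) ≤ y ^ (2*i+1) * (1/4) ^ j := by
        rw [show 2 * (j+i) + 1 = (2*i+1) + 2*j by ring, pow_add, pow_mul y 2 j]
        gcongr
        nlinarith
      have h2 : (1:ℝ) ≤ 2 * ((j+i:ℕ):ℝ) + 1 := by
        have : (0:ℝ) ≤ ((j+i:ℕ):ℝ) := Nat.cast_nonneg _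
        linarith
      rw [div_le_iff₀ (by linarith)]
      calc (2:ℝ) ^ p * y ^ (2 * (j+i) + 1) ≤ 2 ^ p * (y ^ (2*i+1) * (1/4) ^ j) := by gcongr
        _ = 2 ^ p * y ^ (2*i+1) * (1/4) ^ j * 1 := by ring
        _ ≤ _ := mul_le_mul_of_nonneg_left h2 (by positivity)
    norm_num at this; linarith
  have hR00 : R 0 = 2 ^ p * (Real.log (1 + y) - Real.log (1 - y)) / 2 := by
    simp only [hRd, add_zero]; exact hGs.tsum_eq
  set x : ℕ := u * 2 ^ p / v with hxd
  obtain ⟨f1, f2⟩ := flo (u * 2 ^ p) v hv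
  obtain ⟨g1, g2⟩ := flo (x * x) (2 ^ p) (by positivity)
  rw [← hxd] at f1 f2
  push_cast at f1 f2 g1 g2
  have e0 : (u:ℝ) * 2 ^ p / v = 2 ^ p * y := by rw [hyd]; ring
  rw [e0] at f1 f2
  have hx0 : (0:ℝ) ≤ x := Nat.cast_nonneg x
  have k1 : (x:ℝ) * x / 2 ^ p ≤ 2 ^ p * y^2 := by
    rw [div_le_iff₀ hU]
    calc (x:ℝ) * x ≤ (2 ^ p * y) * (2 ^ p * y) := mul_le_mul f1 f1 hx0 (by positivity)
      _ = _ := by ring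
  have k2 : 2 ^ p * y^2 - 1 ≤ (x:ℝ) * x / 2 ^ p := by
    rw [le_div_iff₀ hU]
    have : (2 ^ p * y - 1) * (2 ^ p * y) ≤ x * (2 ^ p * y) := mul_le_mul_of_nonneg_right (by linarith) (by positivity)
    have h3 : (x:ℝ) * (2 ^ p * y - 1) ≤ x * x := mul_le_mul_of_nonneg_left (by linarith) hx0
    have h4 : 2 ^ p * y ≤ 2 ^ p * (1/2) := mul_le_mul_of_nonneg_left hy hU.le
    nlinarith
  have hfin := atL_inv p (x * x / 2 ^ p) y hy0 hy T R (fun i => rfl) hR hR0 hR1 (by linarith) (by linarith) p 0 x 0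
    (by simp only [hTd]; simpa using f1) (by simp only [hTd]; norm_num; linarith)
    (by
      simp only [hTd]
      have : (2:ℝ) ^ p ≤ 4 ^ p := by gcongr; norm_num
      have h2 : (2:ℝ) ^ p * y ≤ 2 ^ p * 1 := mul_le_mul_of_nonneg_left (by linarith) hU.le
      simp only [mul_zero, zero_add, pow_one]
      linarith)
  rw [atv_eq, ← hxd, hlog]
  have hpr : (p:ℝ) ≤ 10000 := by exact_mod_cast hp
  obtain ⟨a1, a2⟩ := hfin
  rw [hR00] at a1 a2
  simp only [mul_zero, zero_add, Nat.cast_zero, sub_zero] at a1 a2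
  push_cast
  rw [abs_le]
  constructor <;> linarith

theorem ble_iff {a b : ℕ} (h : Nat.ble a b = true) : a ≤ b := Nat.le_of_ble_eq_true h

theorem lgO_spec {p W a b : ℕ} {κ : ℕ → Bool} (hb : 0 < b) (hp : p ≤ 10000) (h : lgO p W a b κ = true) :
    ∃ Z : ℕ, κ Z = true ∧ |(Z:ℝ) - (W + 2 ^ p * Real.log (a / b))| ≤ 2 ^ 17 := by
  unfold lgO at h
  simp only [frc_eq] at h
  change bcd (Nat.ble b a) (bcd (Nat.ble (2 * (a - b)) (a + b)) (κ (W + atv p (a - b) (a + b))) false)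
    (bcd (Nat.ble (2 * (b - a)) (a + b)) (bcd (Nat.ble (atv p (b - a) (a + b)) W)
      (κ (W - atv p (b - a) (a + b))) false) false) = true at h
  have hbr : (0:ℝ) < b := by exact_mod_cast hb
  rcases bcd_or h with ⟨h1, h2⟩ | ⟨h1, h2⟩
  · have hba := ble_iff h1
    obtain ⟨h3, h4⟩ := bcd_and h2
    refine ⟨_, h4, ?_⟩
    have := atv_spec p (a - b) (a + b) (by omega) (ble_iff h3) hp
    rw [Nat.cast_sub hba] at this
    push_cast at this ⊢
    have e : ((a:ℝ) + b + (a - b)) / (a + b - (a - b)) = a / b := by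
      rw [show (a:ℝ) + b + (a - b) = 2 * a by ring, show (a:ℝ) + b - (a - b) = 2 * b by ring]
      rw [mul_div_mul_left _ _ (by norm_num)]
    rw [e] at this
    rw [show (W:ℝ) + atv p (a - b) (a + b) - (W + 2 ^ p * Real.log (a / b)) =
      atv p (a - b) (a + b) - 2 ^ p * Real.log (a / b) by ring]
    exact this
  · have hba : a < b := by
      by_contra hh
      rw [Nat.ble_eq_true_of_le (by omega)] at h1
      cases h1
    obtain ⟨h3, h4⟩ := bcd_and h2
    obtain ⟨h5, h6⟩ := bcd_and h4
    refine ⟨_, h6, ?_⟩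
    have h3' := ble_iff h3
    have ha : 0 < a := by omega
    have har : (0:ℝ) < a := by exact_mod_cast ha
    have := atv_spec p (b - a) (a + b) (by omega) h3' hp
    rw [Nat.cast_sub hba.le] at this
    rw [Nat.cast_sub (ble_iff h5)]
    push_cast at this ⊢
    have e : ((a:ℝ) + b + (b - a)) / (a + b - (b - a)) = b / a := by
      rw [show (a:ℝ) + b + (b - a) = 2 * b by ring, show (a:ℝ) + b - (b - a) = 2 * a by ring]
      rw [mul_div_mul_left _ _ (by norm_num)]
    rw [e] at this
    have e2 : Real.log ((b:ℝ) / a) = - Real.log (a / b) := by rw [← Real.log_inv, inv_div]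
    rw [e2] at this
    rw [abs_le] at this ⊢
    constructor <;> linarith

/-- The constants. -/
structure bkK (p l2 l3 l5 l7 : ℕ) : Prop where
  h2 : |(l2:ℝ) - 2 ^ p * Real.log 2| ≤ 2 ^ 17
  h3 : |(l3:ℝ) - 2 ^ p * Real.log 3| ≤ 2 ^ 18
  h5 : |(l5:ℝ) - 2 ^ p * Real.log 5| ≤ 2 ^ 19
  h7 : |(l7:ℝ) - 2 ^ p * Real.log 7| ≤ 2 ^ 19

theorem cst_spec {p : ℕ} {κ : ℕ → ℕ → ℕ → ℕ → Bool} (hp : p ≤ 10000) (h : cst p κ = true) :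
    ∃ l2 l3 l5 l7, bkK p l2 l3 l5 l7 ∧ κ l2 l3 l5 l7 = true := by
  unfold cst at h
  simp only [frc_eq] at h
  obtain ⟨h1, h2⟩ := bcd_and h
  have h1' := ble_iff h1
  refine ⟨_, _, _, _, ?_, h2⟩
  have a2 := atv_spec p 1 3 (by norm_num) (by norm_num) hp
  have a3 := atv_spec p 1 5 (by norm_num) (by norm_num) hp
  have a5 := atv_spec p 1 9 (by norm_num) (by norm_num) hp
  have a7 := atv_spec p 1 15 (by norm_num) (by norm_num) hp
  push_cast at a2 a3 a5 a7
  rw [show ((3:ℝ) + 1) / (3 - 1) = 2 by norm_num] at a2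
  rw [show ((5:ℝ) + 1) / (5 - 1) = 3 / 2 by norm_num, Real.log_div (by norm_num) (by norm_num)] at a3
  rw [show ((9:ℝ) + 1) / (9 - 1) = 5 / 2 ^ 2 by norm_num, Real.log_div (by norm_num) (by norm_num), Real.log_pow] at a5
  rw [show ((15:ℝ) + 1) / (15 - 1) = 2 ^ 3 / 7 by norm_num, Real.log_div (by norm_num) (by norm_num), Real.log_pow] at a7
  change atv p 1 15 ≤ 3 * atv p 1 3 at h1'
  rw [abs_le] at a2 a3 a5 a7
  push_cast at a2 a3 a5 a7
  constructor
  · rw [abs_le]; exact a2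
  · change |((atv p 1 3 + atv p 1 5 : ℕ):ℝ) - _| ≤ _
    rw [abs_le]; push_cast
    constructor <;> linarith
  · change |((2 * atv p 1 3 + atv p 1 9 : ℕ):ℝ) - _| ≤ _
    rw [abs_le]; push_cast
    constructor <;> linarith
  · change |((3 * atv p 1 3 - atv p 1 15 : ℕ):ℝ) - _| ≤ _
    rw [abs_le, Nat.cast_sub h1']; push_cast
    constructor <;> linarith

theorem pwr_succ (p x c f k : ℕ) : pwr p x c (f+1) k =
    if k % 2 = 0 then pwr p x c f (k/2) * pwr p x c f (k/2) / 2 ^ p + c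
    else (pwr p x c f (k/2) * pwr p x c f (k/2) / 2 ^ p + c) * x / 2 ^ p + c := by
  have : pwr p x c (f+1) k = frc (pwr p x c f (Nat.div k 2)) fun h =>
    frc (Nat.add (Nat.shiftRight (Nat.mul h h) p) c) fun s =>
      bcd (Nat.beq (Nat.mod k 2) 0) s (Nat.add (Nat.shiftRight (Nat.mul s x) p) c) := rfl
  rw [this]
  simp only [frc_eq]
  change bcd (Nat.beq (k % 2) 0) ((pwr p x c f (k/2) * pwr p x c f (k/2)) >>> p + c)
    ((((pwr p x c f (k/2) * pwr p x c f (k/2)) >>> p + c) * x) >>> p + c) = _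
  rw [Nat.shiftRight_eq_div_pow, Nat.shiftRight_eq_div_pow]
  by_cases h : k % 2 = 0
  · rw [if_pos h, h]; rfl
  · rw [if_neg h, show k % 2 = 1 by omega]; rfl

theorem pwr_lo (p x f : ℕ) : ∀ k, k < 2 ^ f → (pwr p x 0 f k : ℝ) ≤ 2 ^ p * ((x:ℝ) / 2 ^ p) ^ k := by
  have hU : (0:ℝ) < 2 ^ p := by positivity
  induction f with
  | zero =>
    intro k hk
    have : k = 0 := by simpa using hk
    subst this
    have : pwr p x 0 0 0 = 1 <<< p := rfl
    rw [this, Nat.shiftLeft_eq]; simp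
  | succ f ih =>
    intro k hk
    have hi := ih (k/2) (by rw [pow_succ] at hk; omega)
    have hx0 : (0:ℝ) ≤ (x:ℝ) / 2 ^ p := by positivity
    set y : ℝ := (x:ℝ) / 2 ^ p with hy
    have hxy : (x:ℝ) = 2 ^ p * y := by rw [hy]; field_simp
    rw [pwr_succ]
    set h := pwr p x 0 f (k/2) with hh
    obtain ⟨f1, -⟩ := flo (h * h) (2 ^ p) (by positivity)
    push_cast at f1
    have hs : ((h * h / 2 ^ p : ℕ):ℝ) ≤ 2 ^ p * y ^ (2 * (k/2)) := by
      refine f1.trans ?_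
      rw [div_le_iff₀ hU]
      calc (h:ℝ) * h ≤ (2 ^ p * y ^ (k/2)) * (2 ^ p * y ^ (k/2)) := mul_le_mul hi hi (by positivity) (by positivity)
        _ = _ := by rw [two_mul, pow_add]; ring
    split_ifs with hk2
    · rw [show 2 * (k/2) = k by omega] at hs
      simpa using hs
    · set s := h * h / 2 ^ p with hsd
      obtain ⟨g1, -⟩ := flo (s * x) (2 ^ p) (by positivity)
      push_cast at g1
      simp only [add_zero]
      refine g1.trans ?_
      rw [div_le_iff₀ hU, hxy]
      calc (s:ℝ) * (2 ^ p * y) ≤ (2 ^ p * y ^ (2 * (k/2))) * (2 ^ p * y) := by gcongr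
        _ = 2 ^ p * y ^ (2 * (k/2) + 1) * 2 ^ p := by ring
        _ = _ := by rw [show 2 * (k/2) + 1 = k by omega]

theorem pwr_hi (p x f : ℕ) : ∀ k, k < 2 ^ f → 2 ^ p * ((x:ℝ) / 2 ^ p) ^ k ≤ (pwr p x 1 f k : ℝ) := by
  have hU : (0:ℝ) < 2 ^ p := by positivity
  induction f with
  | zero =>
    intro k hk
    have : k = 0 := by simpa using hk
    subst this
    have : pwr p x 1 0 0 = 1 <<< p := rfl
    rw [this, Nat.shiftLeft_eq]; simp
  | succ f ih =>
    intro k hk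
    have hi := ih (k/2) (by rw [pow_succ] at hk; omega)
    have hx0 : (0:ℝ) ≤ (x:ℝ) / 2 ^ p := by positivity
    set y : ℝ := (x:ℝ) / 2 ^ p with hy
    have hxy : (x:ℝ) = 2 ^ p * y := by rw [hy]; field_simp
    rw [pwr_succ]
    set h := pwr p x 1 f (k/2) with hh
    obtain ⟨-, f1⟩ := flo (h * h) (2 ^ p) (by positivity)
    push_cast at f1
    have hs : 2 ^ p * y ^ (2 * (k/2)) ≤ ((h * h / 2 ^ p + 1 : ℕ):ℝ) := by
      push_cast
      refine le_trans ?_ f1.le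
      rw [le_div_iff₀ hU]
      calc 2 ^ p * y ^ (2 * (k/2)) * 2 ^ p = (2 ^ p * y ^ (k/2)) * (2 ^ p * y ^ (k/2)) := by rw [two_mul, pow_add]; ring
        _ ≤ _ := mul_le_mul hi hi (by positivity) (by positivity)
    split_ifs with hk2
    · rw [show 2 * (k/2) = k by omega] at hs
      exact hs
    · set s := h * h / 2 ^ p + 1 with hsd
      obtain ⟨-, g1⟩ := flo (s * x) (2 ^ p) (by positivity)
      push_cast at g1
      push_cast
      refine le_trans ?_ g1.le
      rw [le_div_iff₀ hU, hxy]
      calc 2 ^ p * y ^ k * 2 ^ p = 2 ^ p * y ^ (2 * (k/2) + 1) * 2 ^ p := by rw [show 2 * (k/2) + 1 = k by omega]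
        _ = (2 ^ p * y ^ (2 * (k/2))) * (2 ^ p * y) := by ring
        _ ≤ _ := by gcongr

theorem alC_spec {p k : ℕ} {κ : ℕ → Bool} {α : ℝ} (R : bkR k α) (hk : k ≤ 650) (h : alC p (2 ^ p) k κ = true) :
    ∃ x : ℕ, κ x = true ∧ 2 ^ p < x ∧ x + 8192 ≤ 2 * 2 ^ p ∧ (x:ℝ) / 2 ^ p ≤ α ∧ α ≤ ((x:ℝ) + 8192) / 2 ^ p := by
  have hU : (0:ℝ) < 2 ^ p := by positivity
  unfold alC at h
  rw [frc_eq] at h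
  set x := nwt p (2 ^ p) k 30 (Nat.mul 2 (2 ^ p)) with hx
  clear_value x
  obtain ⟨h1, h⟩ := bcd_and h
  obtain ⟨h2, h⟩ := bcd_and h
  obtain ⟨h3, h⟩ := bcd_and h
  obtain ⟨h4, h⟩ := bcd_and h
  have h1 : 2 ^ p < x := ble_iff h1
  have h2 : x + 8192 ≤ 2 * 2 ^ p := ble_iff h2
  have h3 : 2 ^ p * 2 ^ p ≤ pwr p x 0 10 k * (2 * 2 ^ p - x) := ble_iff h3
  have h4 : pwr p (x + 8192) 1 10 k * (2 * 2 ^ p - (x + 8192)) ≤ 2 ^ p * 2 ^ p := ble_iff h4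
  refine ⟨x, h, h1, h2, ?_, ?_⟩
  · have h1r : (2:ℝ) ^ p < x := by exact_mod_cast h1
    have hl := pwr_lo p x 10 k (by norm_num; omega)
    have h3r : (2:ℝ) ^ p * 2 ^ p ≤ (pwr p x 0 10 k : ℝ) * (2 * 2 ^ p - x) := by
      have := (Nat.cast_le (α := ℝ)).2 h3
      rw [Nat.cast_mul (pwr p x 0 10 k), Nat.cast_sub (by omega)] at this
      push_cast at this; exact this
    have h2r : (x:ℝ) + 8192 ≤ 2 * 2 ^ p := by exact_mod_cast h2
    apply bkR_lo R
    · rw [lt_div_iff₀ hU]; linarith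
    · have : (2:ℝ) ^ p * 2 ^ p ≤ (2 ^ p * ((x:ℝ) / 2 ^ p) ^ k) * (2 * 2 ^ p - x) :=
        h3r.trans (mul_le_mul_of_nonneg_right hl (by linarith))
      have e : (2 ^ p * ((x:ℝ) / 2 ^ p) ^ k) * (2 * 2 ^ p - x) = 2 ^ p * 2 ^ p * (((x:ℝ) / 2 ^ p) ^ k * (2 - x / 2 ^ p)) := by
        field_simp
      rw [e] at this
      exact le_of_mul_le_mul_left (by linarith) (mul_pos hU hU)
  · have h1r : (2:ℝ) ^ p < x := by exact_mod_cast h1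
    have hl := pwr_hi p (x + 8192) 10 k (by norm_num; omega)
    have h4r : (pwr p (x + 8192) 1 10 k : ℝ) * (2 * 2 ^ p - (x + 8192)) ≤ (2:ℝ) ^ p * 2 ^ p := by
      have := (Nat.cast_le (α := ℝ)).2 h4
      rw [Nat.cast_mul (pwr p (x + 8192) 1 10 k), Nat.cast_sub h2] at this
      push_cast at this; exact this
    have h2r : (x:ℝ) + 8192 ≤ 2 * 2 ^ p := by exact_mod_cast h2
    push_cast at hl
    apply bkR_hi R
    · rw [lt_div_iff₀ hU]; linarith
    · have : (2 ^ p * (((x:ℝ) + 8192) / 2 ^ p) ^ k) * (2 * 2 ^ p - (x + 8192)) ≤ (2:ℝ) ^ p * 2 ^ p :=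
        le_trans (mul_le_mul_of_nonneg_right hl (by linarith)) h4r
      have e : (2 ^ p * (((x:ℝ) + 8192) / 2 ^ p) ^ k) * (2 * 2 ^ p - (x + 8192)) =
          2 ^ p * 2 ^ p * ((((x:ℝ) + 8192) / 2 ^ p) ^ k * (2 - (x + 8192) / 2 ^ p)) := by
        field_simp
      rw [e] at this
      exact le_of_mul_le_mul_left (by linarith) (mul_pos hU hU)

theorem log_close {y z m ε : ℝ} (hm : 0 < m) (hy : m ≤ y) (hz : m ≤ z) (h : |z - y| ≤ ε) :
    |Real.log z - Real.log y| ≤ ε / m := by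
  have key : ∀ a b : ℝ, m ≤ a → m ≤ b → |a - b| ≤ ε → Real.log a - Real.log b ≤ ε / m := by
    intro a b ha hb hab
    have ha0 : 0 < a := by linarith
    have hb0 : 0 < b := by linarith
    rw [← Real.log_div ha0.ne' hb0.ne']
    have h1 := Real.log_le_sub_one_of_pos (div_pos ha0 hb0)
    have h2 : a / b - 1 = (a - b) / b := by field_simp
    have h3 : (a - b) / b ≤ ε / m := by
      have h0 := (le_abs_self (a - b)).trans hab
      have he := (abs_nonneg _).trans hab
      rw [div_le_div_iff₀ hb0 hm]
      nlinarith
    linarith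
  rw [abs_le]
  have h1 := key z y hz hy h
  have h2 := key y z hy hz (by rw [abs_sub_comm]; exact h)
  constructor <;> linarith

/-- Approximations of `α` and of the logarithms of `α` and `c`. -/
structure bkP (p k : ℕ) (α : ℝ) (x B C num den : ℕ) : Prop where
  hx1 : (x:ℝ) / 2 ^ p ≤ α
  hx2 : α ≤ ((x:ℝ) + 8192) / 2 ^ p
  hB : |(B:ℝ) - 2 ^ p * Real.log α| ≤ 2 ^ 19
  hC : |(C:ℝ) + 2 ^ p * Real.log (bkc k α)| ≤ 2 ^ 24
  hden : 0 < den
  hnd : |Real.log ((num:ℝ) / den) - Real.log (bkc k α)| ≤ 2 ^ 24 / 2 ^ p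
  hnum : (1/4:ℝ) ≤ (num:ℝ) / den

set_option maxHeartbeats 1000000 in
theorem chk_approx {p k l2 l3 l5 l7 : ℕ} {α : ℝ} (R : bkR k α) (hk : k ≤ 650) (hp : p ≤ 10000) (hp2 : 100 ≤ p)
    (K : bkK p l2 l3 l5 l7) {κ : ℕ → ℕ → ℕ → ℕ → ℕ → Bool}
    (h : (alC p (2 ^ p) k fun x =>
  lgO p l2 x (Nat.mul 2 (2 ^ p)) fun B =>
  frc (Nat.mul (Nat.sub (Nat.mul 2 x) (2 ^ p)) (Nat.sub x (2 ^ p))) fun num =>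
  frc (Nat.mul x (Nat.sub (Nat.mul 2 (2 ^ p)) (Nat.mul (Nat.succ k) (Nat.sub (Nat.mul 2 (2 ^ p)) x)))) fun den =>
  lgO p (Nat.add (Nat.sub (Nat.mul 2 l2) l3) 1048576) (Nat.mul 3 den) (Nat.mul 4 num) fun C =>
    κ x B C num den) = true) :
    ∃ x B C num den, bkP p k α x B C num den ∧ κ x B C num den = true := by
  have hU : (0:ℝ) < 2 ^ p := by positivity
  obtain ⟨x, h, hx3, hx4, hx1, hx2⟩ := alC_spec R hk h
  obtain ⟨B, h, hB⟩ := lgO_spec (by change 0 < 2 * 2 ^ p; positivity) hp h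
  rw [frc_eq, frc_eq] at h
  have hUb : (2:ℝ) ^ 100 ≤ 2 ^ p := pow_le_pow_right₀ (by norm_num) hp2
  have hx3r : (2:ℝ) ^ p < x := by exact_mod_cast hx3
  have hx4r : (x:ℝ) + 8192 ≤ 2 * 2 ^ p := by exact_mod_cast hx4
  set U : ℝ := 2 ^ p with hUd
  set y : ℝ := (x:ℝ) / U with hyd
  have hxy : (x:ℝ) = U * y := by rw [hyd]; field_simp
  set ε : ℝ := 8192 / U with hε
  have hε0 : 0 < ε := by positivity
  have hε1 : ε ≤ 1/10^9 := by
    rw [hε, div_le_iff₀ hU]; norm_num at hUb; linarith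
  have hUε : U * ε = 8192 := by rw [hε]; field_simp
  have hα2 : α ≤ y + ε := by rw [hyd, hε, ← add_div]; exact hx2
  have hk3 : (k:ℝ) ≤ 650 := by exact_mod_cast hk
  have hk0 : (0:ℝ) ≤ k := Nat.cast_nonneg k
  obtain ⟨hδ1, hδ2⟩ := bkR_δ R
  obtain ⟨hc1, hc2⟩ := bkR_c R
  have hα := R.hl2
  have hα' := R.h2
  set δy : ℝ := 2 + (k+1) * (y - 2) with hδy
  have hδd : |δy - bkδ k α| ≤ 651 * ε := by
    rw [hδy]; unfold bkδ
    rw [show (2:ℝ) + (k+1) * (y - 2) - (2 + (k+1) * (α - 2)) = -((k+1) * (α - y)) by ring, abs_neg,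
      abs_of_nonneg (mul_nonneg (by linarith) (by linarith))]
    exact mul_le_mul (by linarith) (by linarith) (by linarith) (by norm_num)
  have hδ3 : 0.79 ≤ δy := by
    have := (abs_le.1 hδd).1
    linarith only [this, hε1, hδ1]
  -- logs
  have g1 : |Real.log y - Real.log α| ≤ ε / 1 :=
    log_close (by norm_num) (by linarith) (by linarith) (by rw [abs_le]; constructor <;> linarith)
  have g2 : |Real.log (2*y-1) - Real.log (2*α-1)| ≤ 2*ε / 1 :=
    log_close (by norm_num) (by linarith) (by linarith) (by rw [abs_le]; constructor <;> linarith)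
  have g3 : |Real.log (y-1) - Real.log (α-1)| ≤ ε / (1/2) :=
    log_close (by norm_num) (by linarith) (by linarith) (by rw [abs_le]; constructor <;> linarith)
  have g4 : |Real.log δy - Real.log (bkδ k α)| ≤ (651 * ε) / (1/2) :=
    log_close (by norm_num) (by linarith) (by linarith) hδd
  have hlc : Real.log (bkc k α) = Real.log (2*α-1) + Real.log (α-1) - Real.log α - Real.log (bkδ k α) := by
    unfold bkc
    have h1 : (2*α-1) ≠ 0 := by linarith
    have h2 : (α-1) ≠ 0 := by linarith
    have h3 : α ≠ 0 := by linarith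
    have h4 : bkδ k α ≠ 0 := by linarith
    rw [Real.log_div (mul_ne_zero h1 h2) (mul_ne_zero h3 h4), Real.log_mul h1 h2, Real.log_mul h3 h4]
    ring
  set num : ℕ := Nat.mul (Nat.sub (Nat.mul 2 x) (2 ^ p)) (Nat.sub x (2 ^ p)) with hnum
  set den : ℕ := Nat.mul x (Nat.sub (Nat.mul 2 (2 ^ p)) (Nat.mul (Nat.succ k) (Nat.sub (Nat.mul 2 (2 ^ p)) x))) with hden
  have hnumr : (num:ℝ) = U * U * ((2*y-1) * (y-1)) := by
    have : num = (2 * x - 2 ^ p) * (x - 2 ^ p) := rfl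
    rw [this, Nat.cast_mul, Nat.cast_sub (by omega), Nat.cast_sub hx3.le]
    push_cast
    rw [← hUd, hxy]; ring
  have hle : (k+1) * (2 * 2 ^ p - x) ≤ 2 * 2 ^ p := by
    have : (((k+1) * (2 * 2 ^ p - x) : ℕ):ℝ) ≤ ((2 * 2 ^ p : ℕ):ℝ) := by
      rw [Nat.cast_mul, Nat.cast_sub (by omega)]
      push_cast
      rw [← hUd, hxy]
      have : (k+1:ℝ) * (2 * U - U * y) = U * (2 - δy) := by rw [hδy]; ring
      rw [this]; nlinarith
    exact_mod_cast this
  have hdenr : (den:ℝ) = U * U * (y * δy) := by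
    have : den = x * (2 * 2 ^ p - (k+1) * (2 * 2 ^ p - x)) := rfl
    rw [this, Nat.cast_mul, Nat.cast_sub hle, Nat.cast_mul (k+1), Nat.cast_sub (by omega)]
    push_cast
    rw [← hUd, hxy, hδy]; ring
  have hy1 : 1.61 ≤ y := by linarith
  have hnp : 0 < (2*y-1) * (y-1) := mul_pos (by linarith) (by linarith)
  have hdp : 0 < y * δy := mul_pos (by linarith) (by linarith)
  have hnum0 : 0 < num := by
    have : (0:ℝ) < num := by rw [hnumr]; exact mul_pos (mul_pos hU hU) hnp
    exact_mod_cast this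
  have hden0 : 0 < den := by
    have : (0:ℝ) < den := by rw [hdenr]; exact mul_pos (mul_pos hU hU) hdp
    exact_mod_cast this
  have hnumr0 : (num:ℝ) ≠ 0 := by positivity
  have hdenr0 : (den:ℝ) ≠ 0 := by positivity
  have hq : (num:ℝ) / den = ((2*y-1) * (y-1)) / (y * δy) := by
    rw [hnumr, hdenr, mul_div_mul_left _ _ (mul_pos hU hU).ne']
  have hlq : Real.log ((num:ℝ)/den) = Real.log (2*y-1) + Real.log (y-1) - Real.log y - Real.log δy := by
    have h1 : (2*y-1) ≠ 0 := by linarith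
    have h2 : (y-1) ≠ 0 := by linarith
    have h3 : y ≠ 0 := by linarith
    have h4 : δy ≠ 0 := by linarith
    rw [hq, Real.log_div (mul_ne_zero h1 h2) (mul_ne_zero h3 h4), Real.log_mul h1 h2, Real.log_mul h3 h4]
    ring
  have hnd : |Real.log ((num:ℝ) / den) - Real.log (bkc k α)| ≤ 1400 * ε := by
    rw [hlq, hlc]
    rw [abs_le] at g1 g2 g3 g4 ⊢
    constructor <;> linarith only [g1.1, g1.2, g2.1, g2.2, g3.1, g3.2, g4.1, g4.2, hε0]
  clear_value num den
  obtain ⟨C, h, hC⟩ := lgO_spec (by change 0 < 4 * num; positivity) hp h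
  refine ⟨x, B, C, num, den, ⟨hx1, hx2, ?_, ?_, hden0, ?_, ?_⟩, h⟩
  · have e1 : Real.log ((x:ℝ) / ((Nat.mul 2 (2 ^ p) : ℕ):ℝ)) = Real.log y - Real.log 2 := by
      have : ((Nat.mul 2 (2 ^ p) : ℕ):ℝ) = 2 * U := by
        change ((2 * 2 ^ p : ℕ):ℝ) = _; push_cast; rfl
      rw [this, ← Real.log_div (by linarith) (by norm_num), hyd]
      congr 1; field_simp
    rw [e1] at hB
    have := K.h2
    have g1' : |U * Real.log y - U * Real.log α| ≤ 8192 := by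
      rw [← mul_sub, abs_mul, abs_of_pos hU, ← hUε]
      exact mul_le_mul_of_nonneg_left (by simpa using g1) hU.le
    rw [← hUd] at this
    rw [abs_le] at hB this g1' ⊢
    obtain ⟨q1, q2⟩ := hB
    obtain ⟨q3, q4⟩ := this
    obtain ⟨q5, q6⟩ := g1'
    constructor <;> linarith only [q1, q2, q3, q4, q5, q6]
  · have h32 : l3 ≤ 2 * l2 := by
      have a2 := K.h2
      have a3 := K.h3
      rw [← hUd] at a2 a3
      rw [abs_le] at a2 a3
      have hl43 : Real.log 3 + 1/10 ≤ 2 * Real.log 2 := by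
        have : Real.log (3/4) ≤ 3/4 - 1 := Real.log_le_sub_one_of_pos (by norm_num)
        rw [Real.log_div (by norm_num) (by norm_num), show (4:ℝ) = 2^2 by norm_num, Real.log_pow] at this
        push_cast at this; linarith
      have : (l3:ℝ) ≤ 2 * l2 := by
        have hm := mul_le_mul_of_nonneg_left hl43 hU.le
        norm_num at hUb
        linarith only [hm, hUb, a2.1, a2.2, a3.1, a3.2]
      exact_mod_cast this
    have e1 : ((Nat.add (Nat.sub (Nat.mul 2 l2) l3) 1048576 : ℕ):ℝ) = 2 * l2 - l3 + 1048576 := by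
      change ((2 * l2 - l3 + 1048576 : ℕ):ℝ) = _
      rw [Nat.cast_add, Nat.cast_sub h32]; push_cast; ring
    have e2 : Real.log (((Nat.mul 3 den : ℕ):ℝ) / ((Nat.mul 4 num : ℕ):ℝ)) =
        Real.log 3 - 2 * Real.log 2 - Real.log ((num:ℝ)/den) := by
      change Real.log (((3 * den : ℕ):ℝ) / ((4 * num : ℕ):ℝ)) = _
      push_cast
      rw [Real.log_div (by positivity) (by positivity), Real.log_mul (by norm_num) hdenr0,
        Real.log_mul (by norm_num) hnumr0, Real.log_div hnumr0 hdenr0, show (4:ℝ) = 2^2 by norm_num, Real.log_pow]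
      push_cast; ring
    rw [e1, e2] at hC
    have a2 := K.h2
    have a3 := K.h3
    rw [← hUd] at a2 a3
    have g1' : |U * Real.log ((num:ℝ)/den) - U * Real.log (bkc k α)| ≤ 1400 * 8192 := by
      rw [← mul_sub, abs_mul, abs_of_pos hU, ← hUε]
      have := mul_le_mul_of_nonneg_left hnd hU.le
      linarith
    rw [abs_le] at hC a2 a3 g1' ⊢
    obtain ⟨q1, q2⟩ := hC
    obtain ⟨q3, q4⟩ := a2
    obtain ⟨q5, q6⟩ := a3
    obtain ⟨q7, q8⟩ := g1'
    constructor <;> linarith only [q1, q2, q3, q4, q5, q6, q7, q8]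
  · refine hnd.trans ?_
    rw [hε, ← mul_div_assoc]
    gcongr
    norm_num
  · rw [hq, le_div_iff₀ hdp]
    have h2 := (abs_le.1 hδd).2
    have : δy ≤ 2.1 := by linarith only [h2, hε1, hδ2, hα']
    nlinarith only [this, hy1, hδ3, hα', hx1]

def bkRep (p Q B : ℕ) (ρ : ℕ) (γ η : ℝ) : Prop := ∃ q : ℤ, |(ρ:ℝ) - Q * 2 ^ p * γ - q * B| ≤ Q * η

theorem bkRep_add {p Q B ρ₁ ρ₂ : ℕ} {γ₁ γ₂ η₁ η₂ : ℝ} (h₁ : bkRep p Q B ρ₁ γ₁ η₁) (h₂ : bkRep p Q B ρ₂ γ₂ η₂) :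
    bkRep p Q B (ρ₁ + ρ₂) (γ₁ + γ₂) (η₁ + η₂) := by
  obtain ⟨q₁, h₁⟩ := h₁
  obtain ⟨q₂, h₂⟩ := h₂
  refine ⟨q₁ + q₂, ?_⟩
  push_cast
  rw [abs_le] at *
  constructor <;> linarith

theorem bkRep_mod {p Q B X : ℕ} {γ η : ℝ} (q : ℤ) (h : |(X:ℝ) - 2 ^ p * γ - q * B| ≤ η) :
    bkRep p Q B ((Q * X) % B) γ η := by
  refine ⟨q * Q - ((Q * X / B : ℕ) : ℤ), ?_⟩
  have e : (((Q * X) % B : ℕ):ℝ) = Q * X - B * ((Q * X / B : ℕ):ℝ) := by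
    have := Nat.div_add_mod (Q * X) B
    have h2 : ((B * (Q * X / B) + (Q * X) % B : ℕ):ℝ) = ((Q * X : ℕ):ℝ) := by rw [this]
    rw [Nat.cast_add, Nat.cast_mul, Nat.cast_mul] at h2
    linarith
  rw [e]
  generalize (Q * X / B : ℕ) = t
  have : (Q:ℝ) * X - B * (t:ℝ) - Q * 2 ^ p * γ - ((q * Q - (t:ℤ) : ℤ):ℝ) * B
      = Q * (X - 2 ^ p * γ - q * B) := by push_cast; ring
  rw [this, abs_mul, Nat.abs_cast]
  exact mul_le_mul_of_nonneg_left h (Nat.cast_nonneg _)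

theorem bk_sep {B T ρ v : ℕ} (h2 : 2 * T ≤ B) (hB : 0 < B) (h : (ρ + (B - T) + v) % B ≤ B - 2 * T) (j : ℤ) :
    (T:ℝ) ≤ |((ρ + v : ℕ):ℝ) - j * B| := by
  have hdm := Nat.div_add_mod (ρ + (B - T) + v) B
  set t := (ρ + (B - T) + v) / B
  set m := (ρ + (B - T) + v) % B
  have h3 : B * t + m + T = ρ + v + B := by omega
  have h4 : m + 2 * T ≤ B := by omega
  have h3r : (B:ℝ) * t + m + T = ((ρ + v : ℕ):ℝ) + B := by exact_mod_cast h3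
  have h4r : (m:ℝ) + 2 * T ≤ B := by exact_mod_cast h4
  have hBr : (0:ℝ) < B := by exact_mod_cast hB
  have hm0 : (0:ℝ) ≤ m := Nat.cast_nonneg _
  have e : ((ρ + v : ℕ):ℝ) - j * B = ((t:ℤ) - 1 - j : ℤ) * (B:ℝ) + (m + T) := by push_cast; push_cast at h3r; linarith
  rw [e]
  rcases le_or_gt 0 ((t:ℤ) - 1 - j) with hz | hz
  · have : (0:ℝ) ≤ (((t:ℤ) - 1 - j : ℤ) : ℝ) := by exact_mod_cast hz
    have h5 := mul_nonneg this hBr.le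
    have hT0 : (0:ℝ) ≤ T := Nat.cast_nonneg _
    rw [abs_of_nonneg (by linarith)]; linarith
  · have h1 : (t:ℤ) - 1 - j ≤ -1 := by omega
    have : (((t:ℤ) - 1 - j : ℤ) : ℝ) ≤ -1 := by exact_mod_cast h1
    have h5 : (((t:ℤ) - 1 - j : ℤ) : ℝ) * B ≤ -1 * B := mul_le_mul_of_nonneg_right this hBr.le
    refine le_trans ?_ (neg_le_abs _)
    linarith

structure bkT (p xb e : ℕ) (α : ℝ) (B Q L10 T r : ℕ) (P : ℕ) : Prop where
  hB0 : 0 < B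
  hB : |(B:ℝ) - 2 ^ p * Real.log α| ≤ 2 ^ 19
  hL : |(L10:ℝ) - 2 ^ p * Real.log 10| ≤ 2 ^ 20
  hr : |(Q:ℝ) * L10 - P * B| ≤ r
  hT : T = r * 2 ^ xb + Q * 2 ^ e
  hQ : 1 ≤ Q
  h2 : 2 * T ≤ B
  he : xb + 60 ≤ e
  hxb : 11 ≤ xb

/-- The common final estimate. -/
theorem bk_fin {p xb e : ℕ} {α : ℝ} {B Q L10 T r P : ℕ} (H : bkT p xb e α B Q L10 T r P) {d N : ℕ} {γ w : ℝ} {j : ℤ}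
    (hd : d ≤ 2 ^ xb) (hN : N ≤ 2 ^ xb) (h1 : |w - Q * 2 ^ p * γ - j * B| ≤ Q * 2 ^ 62)
    (h2 : (T:ℝ) ≤ |w - (j - d * P + N * Q) * B|) :
    2 ^ e / 2 ≤ 2 ^ p * |γ + d * Real.log 10 - N * Real.log α| := by
  have hdr : (d:ℝ) ≤ 2 ^ xb := by exact_mod_cast hd
  have hNr : (N:ℝ) ≤ 2 ^ xb := by exact_mod_cast hN
  have hd0 : (0:ℝ) ≤ d := Nat.cast_nonneg _
  have hN0 : (0:ℝ) ≤ N := Nat.cast_nonneg _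
  have hQ : (1:ℝ) ≤ Q := by exact_mod_cast H.hQ
  have hQ0 : (0:ℝ) < Q := by linarith
  have hU : (0:ℝ) < 2 ^ p := by positivity
  set X : ℝ := 2 ^ p * (γ + d * Real.log 10 - N * Real.log α) with hX
  have hTr : (T:ℝ) = r * 2 ^ xb + Q * 2 ^ e := by exact_mod_cast H.hT
  set eB : ℝ := (B:ℝ) - 2 ^ p * Real.log α with heB
  set eL : ℝ := (L10:ℝ) - 2 ^ p * Real.log 10 with heL
  set eR : ℝ := (Q:ℝ) * L10 - P * B with heR
  set eW : ℝ := w - Q * 2 ^ p * γ - j * B with heW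
  have key : w - (j - d * P + N * Q) * B = Q * X + (eW - d * eR + d * (Q * eL) - N * (Q * eB)) := by
    rw [hX, heB, heL, heR, heW]; ring
  have b1 : |(d:ℝ) * eR| ≤ r * 2 ^ xb := by
    rw [abs_mul, abs_of_nonneg hd0, mul_comm]
    exact mul_le_mul H.hr hdr hd0 (Nat.cast_nonneg _)
  have b2 : |(d:ℝ) * (Q * eL)| ≤ 2 ^ xb * (Q * 2 ^ 20) := by
    rw [abs_mul, abs_of_nonneg hd0, abs_mul, abs_of_pos hQ0]
    exact mul_le_mul hdr (mul_le_mul_of_nonneg_left H.hL hQ0.le) (by positivity) (by positivity)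
  have b3 : |(N:ℝ) * (Q * eB)| ≤ 2 ^ xb * (Q * 2 ^ 19) := by
    rw [abs_mul, abs_of_nonneg hN0, abs_mul, abs_of_pos hQ0]
    exact mul_le_mul hNr (mul_le_mul_of_nonneg_left H.hB hQ0.le) (by positivity) (by positivity)
  have hx2 : (2:ℝ) ^ 11 ≤ 2 ^ xb := pow_le_pow_right₀ (by norm_num) H.hxb
  have he2 : (2:ℝ) ^ xb * 2 ^ 60 ≤ 2 ^ e := by
    rw [← pow_add]; exact pow_le_pow_right₀ (by norm_num) H.he
  have hsum : |w - (j - d * P + N * Q) * B| ≤ Q * |X| + (Q * 2 ^ 62 + r * 2 ^ xb + 2 ^ xb * (Q * 2 ^ 20) + 2 ^ xb * (Q * 2 ^ 19)) := by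
    rw [key]
    refine (abs_add_le _ _).trans ?_
    rw [abs_mul, abs_of_pos hQ0]
    gcongr
    have := abs_add_le (eW - d * eR + d * (Q * eL)) (-(N * (Q * eB)))
    have h3 := abs_add_le (eW - d * eR) (d * (Q * eL))
    have h4 := abs_sub eW (d * eR)
    rw [abs_neg, ← sub_eq_add_neg] at this
    linarith
  have hnum : (2:ℝ) ^ 62 + 2 ^ xb * 2 ^ 20 + 2 ^ xb * 2 ^ 19 ≤ 2 ^ e / 2 := by
    norm_num at hx2 he2 ⊢
    linarith
  have h5 : Q * (2 ^ e / 2) ≤ Q * |X| := by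
    have h6 := mul_le_mul_of_nonneg_left hnum hQ0.le
    have h7 := h2.trans hsum
    rw [hTr] at h7
    nlinarith only [h6, h7]
  have h8 := le_of_mul_le_mul_left h5 hQ0
  rw [hX, abs_mul, abs_of_pos hU] at h8
  exact h8

theorem bk_lower {p xb e : ℕ} {α : ℝ} {B Q L10 T r P : ℕ} (H : bkT p xb e α B Q L10 T r P) {ρ v d N : ℕ} {γ η : ℝ}
    (hρ : bkRep p Q B (ρ + v) γ η) (hη : η ≤ 2 ^ 62) (h : (ρ + (B - T) + v) % B ≤ B - 2 * T)
    (hd : d ≤ 2 ^ xb) (hN : N ≤ 2 ^ xb) :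
    2 ^ e / 2 ≤ 2 ^ p * |γ + d * Real.log 10 - N * Real.log α| := by
  obtain ⟨q, hq⟩ := hρ
  refine bk_fin H (w := ((ρ + v : ℕ):ℝ)) (j := q) hd hN (hq.trans (mul_le_mul_of_nonneg_left hη (Nat.cast_nonneg _))) ?_
  have := bk_sep H.h2 H.hB0 h (q - d * P + N * Q)
  push_cast at this ⊢
  exact this

theorem bk_lowerh {p xb e : ℕ} {α : ℝ} {B Q L10 T r P : ℕ} (H : bkT p xb e α B Q L10 T r P) {w d N : ℕ} {θ : ℝ}
    (hc : Nat.Coprime P Q) (hxQ : 2 ^ xb < Q) (hw : Q * w + T ≤ B) (hθ : |2 ^ p * θ| ≤ w + 2 ^ 62)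
    (hd1 : 1 ≤ d) (hd : d ≤ 2 ^ xb) (hN : N ≤ 2 ^ xb) :
    2 ^ e / 2 ≤ 2 ^ p * |θ + d * Real.log 10 - N * Real.log α| := by
  have hQ0 : (0:ℝ) ≤ Q := Nat.cast_nonneg _
  have hwr : (Q:ℝ) * w + T ≤ B := by exact_mod_cast hw
  have hne : ((N:ℤ) * Q - d * P) ≠ 0 := by
    intro h0
    have h1 : d * P = N * Q := by
      have : (d:ℤ) * P = N * Q := by linarith
      exact_mod_cast this
    have h2 : Q ∣ d * P := ⟨N, by rw [h1, mul_comm]⟩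
    have h3 : Q ∣ d := (Nat.Coprime.dvd_of_dvd_mul_right hc.symm h2)
    have := Nat.le_of_dvd hd1 h3
    omega
  have hone : (1:ℝ) ≤ |(((N:ℤ) * Q - d * P : ℤ):ℝ)| := by
    rw [← Int.cast_abs]
    exact_mod_cast Int.one_le_abs hne
  -- choose the representative of `Q 2^p θ` closest to `[-Qw, Qw]`
  set u : ℝ := max (-(Q * w)) (min (Q * 2 ^ p * θ) (Q * w)) with hu
  have hQw : (0:ℝ) ≤ Q * w := by positivity
  have hu1 : |u| ≤ Q * w := by
    rw [abs_le, hu]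
    refine ⟨le_max_left _ _, max_le (by linarith) (min_le_right _ _)⟩
  have hQθ : |(Q:ℝ) * 2 ^ p * θ| ≤ Q * w + Q * 2 ^ 62 := by
    rw [mul_assoc, abs_mul, abs_of_nonneg hQ0, ← mul_add]
    exact mul_le_mul_of_nonneg_left hθ hQ0
  have hu2 : |u - Q * 2 ^ p * θ| ≤ Q * 2 ^ 62 := by
    have hQ2 : (0:ℝ) ≤ Q * 2 ^ 62 := by positivity
    rw [abs_le] at hQθ ⊢
    rw [hu]
    constructor
    · rcases min_cases ((Q:ℝ) * 2 ^ p * θ) (Q * w) with ⟨h1, h2⟩ | ⟨h1, h2⟩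
      · have := le_max_right (-((Q:ℝ) * w)) (min (Q * 2 ^ p * θ) (Q * w)); linarith
      · have := le_max_right (-((Q:ℝ) * w)) (min (Q * 2 ^ p * θ) (Q * w)); linarith
    · rw [sub_le_iff_le_add]
      refine max_le (by linarith) ?_
      have := min_le_left ((Q:ℝ) * 2 ^ p * θ) (Q * w)
      linarith
  refine bk_fin H (w := u) (j := 0) hd hN (by push_cast; rw [zero_mul, sub_zero]; exact hu2) ?_
  have e : u - (((0:ℤ):ℝ) - d * P + N * Q) * B = u - (((N:ℤ) * Q - d * P : ℤ):ℝ) * B := by push_cast; ring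
  rw [e]
  have h3 : |(((N:ℤ) * Q - d * P : ℤ):ℝ) * B| - |u| ≤ |(((N:ℤ) * Q - d * P : ℤ):ℝ) * B - u| := abs_sub_abs_le_abs_sub _ _
  rw [abs_sub_comm] at h3
  refine le_trans ?_ h3
  rw [abs_mul, Nat.abs_cast]
  have hB0 : (0:ℝ) ≤ B := Nat.cast_nonneg _
  have := mul_le_mul_of_nonneg_right hone hB0
  linarith

def lav (l2 l3 l5 l7 a : ℕ) : ℕ :=
  match a with
  | 2 => l2 | 3 => l3 | 4 => 2 * l2 | 5 => l5 | 6 => l2 + l3 | 7 => l7 | 8 => 3 * l2 | 9 => 2 * l3 | _ => 0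

theorem lav_spec {p l2 l3 l5 l7 a : ℕ} (K : bkK p l2 l3 l5 l7) (ha : 1 ≤ a) (ha9 : a ≤ 9) :
    |(lav l2 l3 l5 l7 a : ℝ) - 2 ^ p * Real.log a| ≤ 2 ^ 20 := by
  obtain ⟨h2, h3, h5, h7⟩ := K
  rw [abs_le] at *
  have e4 : Real.log 4 = 2 * Real.log 2 := by rw [show (4:ℝ) = 2^2 by norm_num, Real.log_pow]; norm_num
  have e8 : Real.log 8 = 3 * Real.log 2 := by rw [show (8:ℝ) = 2^3 by norm_num, Real.log_pow]; norm_num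
  have e9 : Real.log 9 = 2 * Real.log 3 := by rw [show (9:ℝ) = 3^2 by norm_num, Real.log_pow]; norm_num
  have e6 : Real.log 6 = Real.log 2 + Real.log 3 := by
    rw [← Real.log_mul (by norm_num) (by norm_num)]; norm_num
  interval_cases a <;> simp only [lav, Nat.cast_ofNat, Nat.cast_mul, Nat.cast_add, Nat.cast_one, Nat.cast_zero,
    Real.log_one, e4, e8, e9, e6] <;> constructor <;> linarith

theorem tst9_spec {B Y r1 r2 r3 r4 r5 r6 r7 r8 r9 v : ℕ} (h : tst9 B Y r1 r2 r3 r4 r5 r6 r7 r8 r9 v = true) :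
    (r1 + v) % B ≤ Y ∧ (r2 + v) % B ≤ Y ∧ (r3 + v) % B ≤ Y ∧ (r4 + v) % B ≤ Y ∧ (r5 + v) % B ≤ Y ∧
    (r6 + v) % B ≤ Y ∧ (r7 + v) % B ≤ Y ∧ (r8 + v) % B ≤ Y ∧ (r9 + v) % B ≤ Y := by
  have h' := Nat.eq_of_beq_eq_true h
  change ((r1 + v) % B - Y) + (((r2 + v) % B - Y) + (((r3 + v) % B - Y) + (((r4 + v) % B - Y) + (((r5 + v) % B - Y) +
    (((r6 + v) % B - Y) + (((r7 + v) % B - Y) + (((r8 + v) % B - Y) + ((r9 + v) % B - Y)))))))) = 0 at h'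
  generalize (r1 + v) % B = x1 at *
  generalize (r2 + v) % B = x2 at *
  generalize (r3 + v) % B = x3 at *
  generalize (r4 + v) % B = x4 at *
  generalize (r5 + v) % B = x5 at *
  generalize (r6 + v) % B = x6 at *
  generalize (r7 + v) % B = x7 at *
  generalize (r8 + v) % B = x8 at *
  generalize (r9 + v) % B = x9 at *
  omega

theorem mk9_spec {Q B S Y O l2 l3 l5 l7 : ℕ} {κ : (ℕ → Bool) → (ℕ → Bool) → Bool}
    (h : mk9 Q B S Y O l2 l3 l5 l7 κ = true) : ∃ f fh, κ f fh = true ∧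
      (∀ v a, 1 ≤ a → a ≤ 9 → f v = true → ((Q * (O + lav l2 l3 l5 l7 a)) % B + S + v) % B ≤ Y) ∧
      (∀ v a, 1 ≤ a → a ≤ 8 → fh v = true → ((Q * (O + lav l2 l3 l5 l7 a)) % B + S + v) % B ≤ Y) := by
  unfold mk9 at h
  simp only [frc_eq] at h
  refine ⟨_, _, h, ?_, ?_⟩
  · intro v a ha ha9 hf
    obtain ⟨t1, t2, t3, t4, t5, t6, t7, t8, t9⟩ := tst9_spec hf
    interval_cases a
    · exact t1
    · exact t2
    · exact t3
    · exact t4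
    · exact t5
    · exact t6
    · exact t7
    · exact t8
    · exact t9
  · intro v a ha ha9 hf
    obtain ⟨t1, t2, t3, t4, t5, t6, t7, t8, t9⟩ := tst9_spec hf
    interval_cases a
    · exact t1
    · exact t2
    · exact t3
    · exact t4
    · exact t5
    · exact t6
    · exact t7
    · exact t8

theorem prs_spec {f : ℕ → Bool} {v : ℕ} : ∀ {ns : List ℕ}, prs f v ns = true → ∀ w ∈ ns, f (w + v) = true
  | [], _ => by simp
  | w :: ns, h => by
    have h' : bcd (frc (Nat.add w v) f) (prs f v ns) false = true := h
    obtain ⟨h1, h2⟩ := bcd_and h'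
    rw [frc_eq] at h1
    intro u hu
    rcases List.mem_cons.1 hu with rfl | hu
    · exact h1
    · exact prs_spec h2 u hu

theorem rvl_spec : ∀ (R acc : List ℕ), rvl R acc = R.reverse ++ acc
  | [], acc => rfl
  | h :: R, acc => by
    have : rvl (h :: R) acc = rvl R (h :: acc) := rfl
    rw [this, rvl_spec R]
    simp

noncomputable def lppK (p x s D : ℕ) (ih : List ℕ → List ℕ → ℕ → ℕ → ℕ → List ℕ → Bool) (F R : List ℕ) (c sn A : ℕ) (ns : List ℕ) : Bool :=
  match F with
  | h :: F' => ih F' ((2 * c - h - D) :: R) (2 * c - h - D) (sn + s) ((A * x) >>> p + (sn + s)) ns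
  | [] => match R.reverse with
    | h :: F' => ih F' [2 * c - h - D] (2 * c - h - D) (sn + s) ((A * x) >>> p + (sn + s)) ns
    | [] => false

theorem lpp_succ (p x B W Q mf s D : ℕ) (f2 : ℕ → ℕ → Bool) (f1 : ℕ → Bool) (fu : ℕ) (F R : List ℕ) (c sn A : ℕ) (ns : List ℕ) :
    lpp p x B W Q mf s D f2 f1 (fu + 1) F R c sn A ns =
    bcd (Nat.beq ((c % 16) * (c % 25)) 0) (lppK p x s D (lpp p x B W Q mf s D f2 f1 fu) F R c sn A ns)
      (lgO p W A ((c - sn) <<< p) fun Z =>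
        bcd (f2 Z ((Q * Z) % B)) (bcd (Nat.ble mf fu)
            (lppK p x s D (lpp p x B W Q mf s D f2 f1 fu) F R c sn A ((Q * Z) % B :: ns))
          (bcd (prs f1 ((Q * Z) % B) ((Q * Z) % B :: ns))
            (lppK p x s D (lpp p x B W Q mf s D f2 f1 fu) F R c sn A ((Q * Z) % B :: ns)) false)) false) := by
  have key : ∀ ns : List ℕ, (List.rec (List.rec false (fun h F' _ => 
        frc (Nat.sub (Nat.sub (Nat.mul 2 c) h) D) fun c' => frc (Nat.add sn s) fun sn' =>
        frc (Nat.add (Nat.shiftRight (Nat.mul A x) p) sn') fun A' => lpp p x B W Q mf s D f2 f1 fu F' (c' :: []) c' sn' A' ns) (rvl R [])) (fun h F' _ => 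
        frc (Nat.sub (Nat.sub (Nat.mul 2 c) h) D) fun c' => frc (Nat.add sn s) fun sn' =>
        frc (Nat.add (Nat.shiftRight (Nat.mul A x) p) sn') fun A' => lpp p x B W Q mf s D f2 f1 fu F' (c' :: R) c' sn' A' ns) F : Bool)
      = lppK p x s D (lpp p x B W Q mf s D f2 f1 fu) F R c sn A ns := by
    intro ns
    rw [rvl_spec, List.append_nil]
    unfold lppK
    cases F with
    | cons h F' => simp only [frc_eq]; rfl
    | nil =>
      cases R.reverse with
      | nil => rfl
      | cons h F' => simp only [frc_eq]; rfl
  simp only [← key]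
  unfold lpp
  simp only [frc_eq]
  rfl

def bkH (k s i : ℕ) : ℕ := (if i < k then 0 else lucasK k (i - k)) + s * i

def bkG (k n : ℕ) : Prop := ¬ 16 ∣ lucasK k n ∧ ¬ 25 ∣ lucasK k n

theorem bkH_step {k s n : ℕ} (hk : 2 ≤ k) (hn : 2 ≤ n) :
    2 * bkH k s (n + k) - bkH k s n - s * (k - 1) = bkH k s (n + 1 + k) := by
  unfold bkH
  have h := lk_rec hk n hn
  rw [if_neg (show ¬ (n + k < k) by omega), if_neg (show ¬ (n + 1 + k < k) by omega), show n + k - k = n by omega, show n + 1 + k - k = n + 1 by omega]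
  obtain ⟨q, rfl⟩ := Nat.exists_eq_add_of_le' hk
  have e : q + 2 - 1 = q + 1 := by omega
  rw [e]
  by_cases h1 : q + 2 ≤ n
  · rw [if_pos h1] at h
    rw [if_neg (by omega)]
    have : 2 * (lucasK (q+2) n + s * (n + (q + 2))) = (lucasK (q+2) (n + 1) + s * (n + 1 + (q + 2))) + s * (q + 1) + (lucasK (q+2) (n - (q + 2)) + s * n) := by
      have : 2 * (lucasK (q+2) n + s * (n + (q + 2))) = 2 * lucasK (q+2) n + 2 * s * (n + (q + 2)) := by ring
      rw [this, ← h]; ring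
    omega
  · rw [if_neg h1] at h
    rw [if_pos (by omega)]
    have : 2 * (lucasK (q+2) n + s * (n + (q + 2))) = (lucasK (q+2) (n + 1) + s * (n + 1 + (q + 2))) + s * (q + 1) + (0 + s * n) := by
      have : 2 * (lucasK (q+2) n + s * (n + (q + 2))) = 2 * lucasK (q+2) n + 2 * s * (n + (q + 2)) := by ring
      rw [this, ← h]; ring
    omega

theorem lppK_spec {k p x s n c sn A : ℕ} {ih : List ℕ → List ℕ → ℕ → ℕ → ℕ → List ℕ → Bool} {F R ns : List ℕ}
    (hk : 2 ≤ k) (hn : 2 ≤ n) (hF : F ++ R.reverse = (List.range' n (k+1)).map (bkH k s)) (hc : c = bkH k s (n + k))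
    (hsn : sn = s * (n + k))
    (h : lppK p x s (s * (k - 1)) ih F R c sn A ns = true) :
    ∃ F' R', F' ++ R'.reverse = (List.range' (n+1) (k+1)).map (bkH k s) ∧
      ih F' R' (bkH k s (n + 1 + k)) (s * (n + 1 + k)) ((A * x) >>> p + s * (n + 1 + k)) ns = true := by
  have e1 : List.range' n (k+1) = n :: List.range' (n+1) k := by rw [List.range'_succ]
  have e2 : List.range' (n+1) (k+1) = List.range' (n+1) k ++ [n + 1 + k] := by
    rw [List.range'_1_concat]
  have e3 : sn + s = s * (n + 1 + k) := by rw [hsn]; ring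
  rw [e1, List.map_cons] at hF
  rw [e2, List.map_append, List.map_cons, List.map_nil]
  unfold lppK at h
  rw [e3, hc] at h
  cases F with
  | cons a F' =>
    rw [List.cons_append, List.cons.injEq] at hF
    obtain ⟨rfl, hF⟩ := hF
    simp only [bkH_step hk hn] at h
    refine ⟨_, _, ?_, h⟩
    rw [List.reverse_cons, ← List.append_assoc, hF]
  | nil =>
    rw [List.nil_append] at hF
    rw [hF] at h
    simp only [bkH_step hk hn] at h
    exact ⟨_, _, by simp, h⟩

theorem lg_step0 {p x A A' : ℕ} {α η : ℝ} (hp : 100 ≤ p) (hα : 1.6 ≤ α) (hx1 : (x:ℝ) / 2 ^ p ≤ α)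
    (hx2 : α ≤ ((x:ℝ) + 8192) / 2 ^ p) (hA : (2:ℝ) ^ p / 8 ≤ A) (hA' : (2:ℝ) ^ p / 8 ≤ A')
    (h : |(A':ℝ) - A * x / 2 ^ p| ≤ η) :
    |Real.log A' - Real.log A - Real.log α| ≤ (8192 + 8 * η) / 2 ^ p := by
  have hU : (0:ℝ) < 2 ^ p := by positivity
  have hUb : (2:ℝ) ^ 100 ≤ 2 ^ p := pow_le_pow_right₀ (by norm_num) hp
  set U : ℝ := 2 ^ p with hUd
  set y : ℝ := (x:ℝ) / U with hy
  have hε : ((x:ℝ) + 8192) / U = y + 8192 / U := by rw [hy]; ring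
  rw [hε] at hx2
  have hε1 : 8192 / U ≤ 1/10 := by rw [div_le_iff₀ hU]; norm_num at hUb; linarith
  have hε0 : 0 < 8192 / U := by positivity
  have h1 : |Real.log y - Real.log α| ≤ (8192 / U) / 1 :=
    log_close (by norm_num) (by linarith) (by linarith) (by rw [abs_le]; constructor <;> linarith)
  have hA0 : (0:ℝ) < A := by linarith
  have e : (A:ℝ) * x / U = A * y := by rw [hy]; ring
  rw [e] at h
  have h2 : |Real.log A' - Real.log (A * y)| ≤ η / (U / 8) :=
    log_close (by linarith) (by nlinarith) hA' h
  rw [Real.log_mul (by linarith) (by linarith)] at h2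
  have e2 : η / (U / 8) = 8 * η / U := by field_simp
  have e3 : (8192 / U) / 1 = 8192 / U := div_one _
  have e4 : (8192 + 8 * η) / U = 8192 / U + 8 * η / U := by ring
  rw [e2] at h2
  rw [e3] at h1
  rw [e4]
  rw [abs_le] at *
  constructor <;> linarith

theorem lg_step {p x A A' : ℕ} {α : ℝ} (hp : 100 ≤ p) (hα : 1.6 ≤ α) (hx1 : (x:ℝ) / 2 ^ p ≤ α)
    (hx2 : α ≤ ((x:ℝ) + 8192) / 2 ^ p) (hA : (2:ℝ) ^ p / 8 ≤ A) (hA' : (2:ℝ) ^ p / 8 ≤ A')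
    (h : |(A':ℝ) - A * x / 2 ^ p| ≤ 2 ^ 42) :
    |Real.log A' - Real.log A - Real.log α| ≤ 2 ^ 46 / 2 ^ p := by
  refine (lg_step0 hp hα hx1 hx2 hA hA' h).trans ?_
  gcongr
  norm_num

def bkZ (p k : ℕ) (α : ℝ) (B m Z : ℕ) : Prop :=
  |(Z:ℝ) - (4 * B + 2 ^ p * (m * Real.log α - Real.log (lucasK k m)))| ≤ 2 ^ 59

theorem bkZ_rep {p k B Q m Z : ℕ} {α : ℝ} (hB : |(B:ℝ) - 2 ^ p * Real.log α| ≤ 2 ^ 19) (hm : m ≤ 2 ^ 12)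
    (h : bkZ p k α B m Z) : bkRep p Q B ((Q * Z) % B) (- Real.log (lucasK k m)) (2 ^ 60) := by
  refine bkRep_mod ((m:ℤ) + 4) ?_
  unfold bkZ at h
  have hm' : (m:ℝ) ≤ 2 ^ 12 := by exact_mod_cast hm
  have e : (Z:ℝ) - 2 ^ p * (- Real.log (lucasK k m)) - (((m:ℤ) + 4 : ℤ):ℝ) * B
     = ((Z:ℝ) - (4 * B + 2 ^ p * (m * Real.log α - Real.log (lucasK k m)))) - m * ((B:ℝ) - 2 ^ p * Real.log α) := by
    push_cast; ring
  rw [e]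
  refine (abs_sub _ _).trans ?_
  have : |(m:ℝ) * ((B:ℝ) - 2 ^ p * Real.log α)| ≤ 2 ^ 12 * 2 ^ 19 := by
    rw [abs_mul, Nat.abs_cast]
    exact mul_le_mul hm' hB (abs_nonneg _) (by norm_num)
  norm_num at *
  linarith

set_option maxHeartbeats 1000000 in
theorem lpp_sound {p k x B C Q mf s W : ℕ} {num den : ℕ} {α : ℝ} {f2 : ℕ → ℕ → Bool} {f1 : ℕ → Bool}
    (R0 : bkR k α) (hp : p ≤ 10000) (hp2 : 100 ≤ p) (P : bkP p k α x B C num den)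
    (hW : W = C + 4 * B) (hs : 400 ∣ s) (hs1 : 1 ≤ s) :
    ∀ (fuel n : ℕ) (F R : List ℕ) (c sn A : ℕ) (ns : List ℕ), 2 ≤ n → n + fuel ≤ 2 ^ 12 → s * (n + fuel + k) ≤ 2 ^ 41 →
      F ++ R.reverse = (List.range' n (k+1)).map (bkH k s) → c = bkH k s (n + k) → sn = s * (n + k) →
      (2:ℝ) ^ p / 8 ≤ A →
      |Real.log A - p * Real.log 2 - Real.log (bkc k α) - n * Real.log α| ≤ n * (2 ^ 46 / 2 ^ p) →
      (∀ l < n, bkG k l → ∃ w ∈ ns, bkRep p Q B w (- Real.log (lucasK k l)) (2 ^ 60)) →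
      lpp p x B W Q mf s (s * (k - 1)) f2 f1 fuel F R c sn A ns = true →
      ∀ m, n ≤ m → m < n + fuel → bkG k m → ∃ Z, f2 Z ((Q * Z) % B) = true ∧ bkZ p k α B m Z ∧
        (n + fuel ≤ m + mf → ∀ l ≤ m, bkG k l → ∃ w, bkRep p Q B w (- Real.log (lucasK k l)) (2 ^ 60) ∧
          f1 (w + (Q * Z) % B) = true) := by
  have hk := R0.hk
  have hU : (0:ℝ) < 2 ^ p := by positivity
  intro fuel
  induction fuel with
  | zero => intros; omega
  | succ fu ih =>
    intro n F R c sn A ns hn hn2 hsb hF hc hsn hA hlog hns h m hnm hmn hg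
    rw [lpp_succ] at h
    -- the continuation
    have step : ∀ ns', (∀ l < n + 1, bkG k l → ∃ w ∈ ns', bkRep p Q B w (- Real.log (lucasK k l)) (2 ^ 60)) →
        lppK p x s (s * (k - 1)) (lpp p x B W Q mf s (s * (k - 1)) f2 f1 fu) F R c sn A ns' = true → n + 1 ≤ m →
        ∃ Z, f2 Z ((Q * Z) % B) = true ∧ bkZ p k α B m Z ∧
        (n + (fu + 1) ≤ m + mf → ∀ l ≤ m, bkG k l → ∃ w, bkRep p Q B w (- Real.log (lucasK k l)) (2 ^ 60) ∧
          f1 (w + (Q * Z) % B) = true) := by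
      intro ns' hns' hK hm1
      obtain ⟨F', R', hF', hK⟩ := lppK_spec hk hn hF hc hsn hK
      have hsb' : s * (n + 1 + k) ≤ 2 ^ 41 := le_trans (Nat.mul_le_mul_left _ (by omega)) hsb
      have hs' : 1 ≤ s * (n + 1 + k) := Nat.mul_pos hs1 (by omega)
      set sn' := s * (n + 1 + k) with hsn'
      clear_value sn'
      have hfl := flo (A * x) (2 ^ p) (by positivity)
      rw [← Nat.shiftRight_eq_div_pow] at hfl
      set t := (A * x) >>> p with ht
      clear_value t
      push_cast at hfl
      have hsbr : (sn':ℝ) ≤ 2199023255552 := by norm_num at hsb'; exact_mod_cast hsb'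
      have hsr : (1:ℝ) ≤ sn' := by exact_mod_cast hs'
      have hα := R0.hl2
      have hxy : (1:ℝ) ≤ (x:ℝ) / 2 ^ p := by
        have h1 := P.hx2
        have hUb : (2:ℝ) ^ 100 ≤ 2 ^ p := pow_le_pow_right₀ (by norm_num) hp2
        rw [le_div_iff₀ hU] at h1 ⊢
        norm_num at hUb
        have := mul_le_mul_of_nonneg_right hα hU.le
        linarith
      have hAx : (A:ℝ) ≤ A * x / 2 ^ p := by
        rw [mul_div_assoc]; exact le_mul_of_one_le_right (Nat.cast_nonneg _) hxy
      have hA' : (2:ℝ) ^ p / 8 ≤ ((t + sn' : ℕ):ℝ) := by push_cast; linarith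
      have hl1 := lg_step (A := A) (A' := t + sn') hp2 (by linarith) P.hx1 P.hx2 hA hA'
        (by push_cast; rw [abs_le]; constructor <;> norm_num <;> linarith)
      have := ih (n+1) F' R' _ _ _ ns' (by omega) (by omega) (by rw [show n + 1 + fu + k = n + (fu + 1) + k by ring]; exact hsb) hF' rfl hsn' hA'
        (by
          push_cast at hl1 ⊢
          rw [abs_le] at hl1 hlog ⊢
          constructor <;> linarith) hns' hK m hm1 (by omega) hg
      rw [show n + 1 + fu = n + (fu + 1) by ring] at this
      exact this
    have hcL : c = lucasK k n + s * (n + k) := by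
      rw [hc]; unfold bkH; rw [if_neg (by omega), Nat.add_sub_cancel]
    have hmod16 : c % 16 = lucasK k n % 16 := by
      obtain ⟨u, rfl⟩ := hs
      rw [hcL, show lucasK k n + 400 * u * (n + k) = lucasK k n + 16 * (25 * u * (n + k)) by ring, Nat.add_mul_mod_self_left]
    have hmod25 : c % 25 = lucasK k n % 25 := by
      obtain ⟨u, rfl⟩ := hs
      rw [hcL, show lucasK k n + 400 * u * (n + k) = lucasK k n + 25 * (16 * u * (n + k)) by ring, Nat.add_mul_mod_self_left]
    rcases bcd_or h with ⟨h1, h2⟩ | ⟨h1, h2⟩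
    · have h1' := Nat.eq_of_beq_eq_true h1
      have hbad : ¬ bkG k n := by
        rintro ⟨g1, g2⟩
        rw [hmod16, hmod25] at h1'
        rcases Nat.mul_eq_zero.1 h1' with h | h
        · exact g1 (Nat.dvd_of_mod_eq_zero h)
        · exact g2 (Nat.dvd_of_mod_eq_zero h)
      have hne : n ≠ m := by rintro rfl; exact hbad hg
      refine step ns ?_ h2 (by omega)
      intro l hl hgl
      have : l ≠ n := by rintro rfl; exact hbad hgl
      exact hns l (by omega) hgl
    · have hLpos := lk_pos hk n
      have hcs : c - sn = lucasK k n := by rw [hcL, hsn]; omega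
      rw [hcs] at h2
      obtain ⟨Z, hZ, hZe⟩ := lgO_spec (by rw [Nat.shiftLeft_eq]; positivity) hp h2
      have hZZ : bkZ p k α B n Z := by
        unfold bkZ
        have hA0 : (0:ℝ) < A := by linarith [div_pos hU (by norm_num : (0:ℝ) < 8)]
        have hL0 : (0:ℝ) < lucasK k n := by exact_mod_cast hLpos
        have e : Real.log ((A:ℝ) / ((lucasK k n <<< p : ℕ):ℝ)) = Real.log A - p * Real.log 2 - Real.log (lucasK k n) := by
          rw [Nat.shiftLeft_eq]; push_cast
          rw [Real.log_div hA0.ne' (by positivity), Real.log_mul hL0.ne' (by positivity), Real.log_pow]; ring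
        rw [e, hW] at hZe
        have hC := P.hC
        have hnn : (n:ℝ) ≤ 2 ^ 12 := by
          have : n ≤ 2 ^ 12 := by omega
          exact_mod_cast this
        set E := Real.log A - p * Real.log 2 - Real.log (bkc k α) - n * Real.log α with hE
        have hE2 : |2 ^ p * E| ≤ 2 ^ 12 * 2 ^ 46 := by
          rw [abs_mul, abs_of_pos hU]
          calc 2 ^ p * |E| ≤ 2 ^ p * (n * (2 ^ 46 / 2 ^ p)) := mul_le_mul_of_nonneg_left hlog hU.le
            _ = n * 2 ^ 46 := by field_simp
            _ ≤ _ := by gcongr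
        have e2 : (Z:ℝ) - (4 * B + 2 ^ p * (n * Real.log α - Real.log (lucasK k n)))
          = ((Z:ℝ) - (((C + 4 * B : ℕ):ℝ) + 2 ^ p * (Real.log A - p * Real.log 2 - Real.log (lucasK k n))))
            + ((C:ℝ) + 2 ^ p * Real.log (bkc k α)) + 2 ^ p * E := by rw [hE]; push_cast; ring
        rw [e2]
        refine (abs_add_three _ _ _).trans ?_
        norm_num at hZe hC hE2 ⊢
        linarith
      obtain ⟨hf2, hK⟩ := bcd_and hZ
      have hv := bkZ_rep (Q := Q) P.hB (by omega) hZZ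
      have hns' : ∀ l < n + 1, bkG k l → ∃ w ∈ (Q * Z) % B :: ns, bkRep p Q B w (- Real.log (lucasK k l)) (2 ^ 60) := by
        intro l hl hgl
        rcases Nat.lt_succ_iff_lt_or_eq.1 hl with h | rfl
        · obtain ⟨w, hw, hw2⟩ := hns l h hgl
          exact ⟨w, List.mem_cons_of_mem _ hw, hw2⟩
        · exact ⟨_, List.mem_cons_self, hv⟩
      have hKK : lppK p x s (s * (k - 1)) (lpp p x B W Q mf s (s * (k - 1)) f2 f1 fu) F R c sn A ((Q * Z) % B :: ns) = true := by
        rcases bcd_or hK with ⟨h3, h4⟩ | ⟨h3, h4⟩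
        · exact h4
        · exact (bcd_and h4).2
      rcases Nat.eq_or_lt_of_le hnm with rfl | hlt
      · refine ⟨Z, hf2, hZZ, ?_⟩
        intro hmf l hl hgl
        rcases bcd_or hK with ⟨h3, h4⟩ | ⟨h3, h4⟩
        · have := ble_iff h3; omega
        · obtain ⟨w, hw, hw2⟩ := hns' l (by omega) hgl
          exact ⟨w, hw2, prs_spec (bcd_and h4).1 w hw⟩
      · exact step _ hns' hKK hlt

theorem zrs_spec {s k : ℕ} (hk : 2 ≤ k) : zrs s k = (List.range' 2 (k+1)).map (bkH k s) := by
  have key : ∀ j, j + 2 ≤ k → (Nat.rec [Nat.add 2 (Nat.mul s k), Nat.add 1 (Nat.mul s (Nat.add k 1)), Nat.add 3 (Nat.mul s (Nat.add k 2))]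
    (fun j ih => Nat.mul s (Nat.sub k (Nat.succ j)) :: ih) j : List ℕ) = (List.range' (k - j) (j + 3)).map (bkH k s) := by
    intro j
    induction j with
    | zero =>
      intro _
      change [2 + s * k, 1 + s * (k + 1), 3 + s * (k + 2)] = _
      have e : List.range' (k - 0) (0 + 3) = [k, k+1, k+2] := by simp [List.range'_succ]
      rw [e]
      simp [bkH, lk_zero, lk_one, lk_two hk]
    | succ j ih =>
      intro hj
      have := ih (by omega)
      rw [show j + 1 + 3 = (j + 3) + 1 by ring, List.range'_succ, List.map_cons, show k - (j+1) + 1 = k - j by omega, ← this]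
      change (s * (k - (j+1))) :: _ = _
      congr 1
      unfold bkH
      rw [if_pos (by omega), zero_add]
  have := key (k - 2) (by omega)
  rw [show k - (k - 2) = 2 by omega, show k - 2 + 3 = k + 1 by omega] at this
  exact this

theorem tsth_spec {Q B T W Z v : ℕ} {h : Bool} {f fh : ℕ → Bool} (ht : tsth Q B T W h f fh Z v = true) :
    f v = true ∨ (h = true ∧ fh v = true ∧ Q * ((Z - W) + (W - Z)) + T ≤ B) := by
  unfold tsth at ht
  rcases bcd_or ht with ⟨h1, _⟩ | ⟨_, h2⟩
  · exact Or.inl h1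
  · obtain ⟨h3, h4⟩ := bcd_and h2
    obtain ⟨h5, h6⟩ := bcd_and h4
    exact Or.inr ⟨h3, h5, ble_iff h6⟩

theorem bkL_eq {k : ℕ} {α : ℝ} (R : bkR k α) {a A i d N : ℕ} (ha : 1 ≤ a) (hA : 1 ≤ A) :
    bkL k α a A i d N = (Real.log a - Real.log 9 - i * Real.log (bkc k α)) + (- Real.log A) + d * Real.log 10 - N * Real.log α := by
  have hc := bkR_c R
  have hc0 : 0 < bkc k α := by linarith
  have ha0 : (0:ℝ) < a := by exact_mod_cast ha
  have hA0 : (0:ℝ) < A := by exact_mod_cast hA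
  unfold bkL
  rw [Real.log_div ha0.ne' (by positivity), Real.log_mul (by positivity) (by positivity), Real.log_mul (by norm_num) hA0.ne',
    Real.log_pow]
  ring

/-- The representation of the constant part of the linear form. -/
theorem bk_rep0 {p k : ℕ} {α : ℝ} {x B C num den l2 l3 l5 l7 Q a : ℕ} (P : bkP p k α x B C num den) (K : bkK p l2 l3 l5 l7)
    (hl : 2 * l3 ≤ 8 * B) (i : ℕ) (hi : i ≤ 3) (ha : 1 ≤ a) (ha9 : a ≤ 9) :
    bkRep p Q B ((Q * ((8 * B - 2 * l3) + i * C + lav l2 l3 l5 l7 a)) % B)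
      (Real.log a - Real.log 9 - i * Real.log (bkc k α)) (2 ^ 27) := by
  refine bkRep_mod 8 ?_
  have h1 := lav_spec K ha ha9
  have h3 := K.h3
  have hC := P.hC
  have e9 : Real.log 9 = 2 * Real.log 3 := by rw [show (9:ℝ) = 3^2 by norm_num, Real.log_pow]; norm_num
  have hir : (i:ℝ) ≤ 3 := by exact_mod_cast hi
  have hi0 : (0:ℝ) ≤ i := Nat.cast_nonneg _
  have hiC : |(i:ℝ) * ((C:ℝ) + 2 ^ p * Real.log (bkc k α))| ≤ 3 * 2 ^ 24 := by
    rw [abs_mul, abs_of_nonneg hi0]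
    exact mul_le_mul hir hC (abs_nonneg _) (by norm_num)
  push_cast [Nat.cast_sub hl]
  rw [e9]
  rw [abs_le] at *
  norm_num at *
  constructor <;> linarith

structure bkU (p e xb mf nl k : ℕ) (α : ℝ) : Prop where
  f1 : ∀ a d N : ℕ, 1 ≤ a → a ≤ 9 → 1 ≤ d → d ≤ 2 ^ xb → N ≤ 2 ^ xb → (2:ℝ) ^ e / 2 ≤ 2 ^ p * |bkL k α a 1 3 d N|
  f2 : nl ≠ 0 → ∀ a d N l : ℕ, 1 ≤ a → a ≤ 9 → 1 ≤ d → d ≤ 2 ^ xb → N + l ≤ 2 ^ xb → l ≤ nl + 1 → bkG k l →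
    (2:ℝ) ^ e / 2 ≤ 2 ^ p * |bkL k α a (lucasK k l) 2 d N|
  f3 : nl ≠ 0 → ∀ a d N l m : ℕ, 1 ≤ a → a ≤ 9 → 1 ≤ d → d ≤ 2 ^ xb → N ≤ 2 ^ xb → l ≤ m → 2 ≤ m → m ≤ nl + 1 →
    nl + 2 ≤ m + mf → bkG k l → bkG k m → (2:ℝ) ^ e / 2 ≤ 2 ^ p * |bkL k α a (lucasK k l * lucasK k m) 1 d N|

set_option maxHeartbeats 2000000 in
theorem chkT_sound {p k x xb e mf nl B C L10 num den l2 l3 l5 l7 Q s T r Pn : ℕ} {α : ℝ} (R : bkR k α) (hk : k ≤ 650)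
    (hp : p ≤ 10000) (hp2 : 100 ≤ p) (hnl : nl ≤ 2300) (P : bkP p k α x B C num den) (K : bkK p l2 l3 l5 l7)
    (H : 2 * T ≤ B → 1 ≤ Q → bkT p xb e α B Q L10 T r Pn)
    (hh : hmk Q B s L10 xb k = true → k = 2 ∧ 2 ^ xb < Q ∧ Nat.Coprime Pn Q)
    (h : chkT p x xb l2 l3 l5 l7 mf k nl B C L10 num den Q s T = true) : bkU p e xb mf nl k α := by
  unfold chkT at h
  simp only [frc_eq] at h
  obtain ⟨hT, h⟩ := bcd_and h
  obtain ⟨hQ, h⟩ := bcd_and h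
  obtain ⟨hl3, h⟩ := bcd_and h
  replace H := H (ble_iff hT) (ble_iff hQ)
  have hl3' : 2 * l3 ≤ 8 * B := ble_iff hl3
  obtain ⟨f3, f3h, h, hf3, hf3h⟩ := mk9_spec h
  obtain ⟨ht3, h⟩ := bcd_and h
  have hk2 := R.hk
  have e9 : ((9:ℕ):ℝ) = 9 := by norm_num
  constructor
  · intro a d N ha ha9 hd1 hd hN
    rw [bkL_eq R ha le_rfl]
    push_cast
    rw [Real.log_one, neg_zero, add_zero]
    have main : (((Q * ((8 * B - 2 * l3) + 3 * C + lav l2 l3 l5 l7 a)) % B) + (B - T) + 0) % B ≤ B - 2 * T →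
        (2:ℝ) ^ e / 2 ≤ 2 ^ p * |(Real.log a - Real.log 9 - (3:ℕ) * Real.log (bkc k α)) + d * Real.log 10 - N * Real.log α| := by
      intro ht
      exact bk_lower H (by rw [add_zero]; exact bk_rep0 P K hl3' 3 le_rfl ha ha9) (by norm_num) ht hd hN
    push_cast at main
    rcases tsth_spec ht3 with h1 | ⟨h1, h2, h3⟩
    · exact main (hf3 0 a ha ha9 h1)
    · rcases Nat.lt_or_ge a 9 with ha8 | ha8
      · exact main (hf3h 0 a ha (by omega) h2)
      · obtain rfl : a = 9 := by omega
        obtain ⟨rfl, hxQ, hcop⟩ := hh h1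
        rw [bkR_c_two R, Real.log_one]
        have := bk_lowerh H (θ := 0) (w := 0) hcop hxQ (by simpa using h3) (by norm_num) hd1 hd hN
        simpa using this
  all_goals
    intro hnl0
    rcases bcd_or h with ⟨h1, _⟩ | ⟨_, h⟩
    · exact absurd (Nat.eq_of_beq_eq_true h1) hnl0
    obtain ⟨f2, f2h, h, hf2, hf2h⟩ := mk9_spec h
    obtain ⟨f1, _, h, hf1, -⟩ := mk9_spec h
    obtain ⟨hl2, h⟩ := bcd_and h
    obtain ⟨hv0, h⟩ := bcd_and h
    obtain ⟨ht2, h⟩ := bcd_and h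
    have hl2' : l2 ≤ 4 * B := ble_iff hl2
    have hU : (0:ℝ) < 2 ^ p := by positivity
    have hUb : (2:ℝ) ^ 100 ≤ 2 ^ p := pow_le_pow_right₀ (by norm_num) hp2
    have rep1 : bkRep p Q B 0 (- Real.log (lucasK k 1)) (2 ^ 60) := by
      refine ⟨0, ?_⟩
      rw [lk_one]; simp
    have rep0 : bkRep p Q B ((Q * (4 * B - l2)) % B) (- Real.log (lucasK k 0)) (2 ^ 60) := by
      refine bkRep_mod 4 ?_
      rw [lk_zero]
      push_cast [Nat.cast_sub hl2']
      have := K.h2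
      rw [abs_le] at *
      norm_num at *
      constructor <;> linarith
    have hs400 : 400 ∣ Nat.mul 400 (Nat.add 10007 (Nat.mul 2237 k)) := Dvd.intro _ rfl
    have hs1 : 1 ≤ Nat.mul 400 (Nat.add 10007 (Nat.mul 2237 k)) := by
      change 1 ≤ 400 * (10007 + 2237 * k); omega
    have hsz : Nat.mul 400 (Nat.add 10007 (Nat.mul 2237 k)) ≤ 400 * (10007 + 2237 * 650) := by
      change 400 * (10007 + 2237 * k) ≤ _; omega
    generalize Nat.mul 400 (Nat.add 10007 (Nat.mul 2237 k)) = s' at h hs400 hs1 hsz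
    -- initial values
    have hα := R.hl2
    have hxy : (1.6:ℝ) ≤ (x:ℝ) / 2 ^ p := by
      have h1 := P.hx2
      rw [le_div_iff₀ hU] at h1 ⊢
      norm_num at hUb
      have := mul_le_mul_of_nonneg_right hα hU.le
      linarith
    have g0 := flo (num <<< p) den P.hden
    have hq : ((num <<< p : ℕ):ℝ) / den = 2 ^ p * ((num:ℝ) / den) := by rw [Nat.shiftLeft_eq]; push_cast; ring
    rw [hq] at g0
    have hqn := P.hnum
    have hqU : (2:ℝ) ^ p * (1/4) ≤ 2 ^ p * ((num:ℝ) / den) := mul_le_mul_of_nonneg_left hqn hU.le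
    change lpp p x B (C + 4 * B) Q mf s' (s' * (k - 1)) _ f1 nl (zrs s' k) [] (3 + s' * (k + 2)) (s' * (k + 2))
      ((((((num <<< p) / den) * x) >>> p) * x) >>> p) [0, (Q * (4 * B - l2)) % B] = true at h
    generalize num <<< p / den = A0 at h g0
    have g1 := flo (A0 * x) (2 ^ p) (by positivity)
    rw [← Nat.shiftRight_eq_div_pow] at g1
    generalize (A0 * x) >>> p = A1 at h g1
    have g2 := flo (A1 * x) (2 ^ p) (by positivity)
    rw [← Nat.shiftRight_eq_div_pow] at g2
    generalize (A1 * x) >>> p = A2 at h g2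
    push_cast at g1 g2
    obtain ⟨g0a, g0b⟩ := g0
    obtain ⟨g1a, g1b⟩ := g1
    obtain ⟨g2a, g2b⟩ := g2
    have hUb' : (1000:ℝ) ≤ 2 ^ p := by norm_num at hUb; linarith
    have hA0 : (2:ℝ) ^ p / 8 ≤ A0 := by linarith
    have hAx0 : (A0:ℝ) * 1.6 ≤ A0 * x / 2 ^ p := by
      rw [mul_div_assoc]; exact mul_le_mul_of_nonneg_left hxy (Nat.cast_nonneg _)
    have hA1 : (2:ℝ) ^ p / 8 ≤ A1 := by linarith
    have hAx1 : (A1:ℝ) * 1.6 ≤ A1 * x / 2 ^ p := by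
      rw [mul_div_assoc]; exact mul_le_mul_of_nonneg_left hxy (Nat.cast_nonneg _)
    have hA2 : (2:ℝ) ^ p / 8 ≤ A2 := by linarith
    have s1 := lg_step0 (η := 1) hp2 (by linarith) P.hx1 P.hx2 hA0 hA1 (by rw [abs_le]; constructor <;> linarith)
    have s2 := lg_step0 (η := 1) hp2 (by linarith) P.hx1 P.hx2 hA1 hA2 (by rw [abs_le]; constructor <;> linarith)
    have s0 : |Real.log A0 - Real.log (2 ^ p * ((num:ℝ) / den))| ≤ 1 / (2 ^ p / 8) :=
      log_close (by linarith) (by linarith) hA0 (by rw [abs_le]; constructor <;> linarith)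
    rw [Real.log_mul hU.ne' (by linarith), Real.log_pow] at s0
    have s3 := P.hnd
    have hlog : |Real.log A2 - p * Real.log 2 - Real.log (bkc k α) - (2:ℕ) * Real.log α| ≤ (2:ℕ) * (2 ^ 46 / 2 ^ p) := by
      have e1 : (8192 + 8 * 1) / (2:ℝ) ^ p = 8200 * (1 / 2 ^ p) := by ring
      have e2 : 1 / ((2:ℝ) ^ p / 8) = 8 * (1 / 2 ^ p) := by field_simp
      have e3 : (2:ℝ) ^ 24 / 2 ^ p = 2 ^ 24 * (1 / 2 ^ p) := by ring
      have e4 : (2:ℝ) ^ 46 / 2 ^ p = 2 ^ 46 * (1 / 2 ^ p) := by ring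
      rw [e1] at s1 s2
      rw [e2] at s0
      rw [e3] at s3
      rw [e4]
      have hi : 0 < 1 / (2:ℝ) ^ p := by positivity
      generalize 1 / (2:ℝ) ^ p = ι at s0 s1 s2 s3 hi ⊢
      rw [abs_le] at s0 s1 s2 s3 ⊢
      push_cast
      norm_num at s0 s1 s2 s3 ⊢
      constructor <;> linarith
    have hsb : s' * (2 + nl + k) ≤ 2 ^ 41 := by
      calc s' * (2 + nl + k) ≤ 400 * (10007 + 2237 * 650) * 2952 := Nat.mul_le_mul hsz (by omega)
        _ ≤ _ := by norm_num
    have sound := lpp_sound R hp hp2 P rfl hs400 hs1 nl 2 (zrs s' k) [] _ _ _ _ le_rfl (by omega) hsb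
      (by rw [List.reverse_nil, List.append_nil]; exact zrs_spec hk2)
      (by unfold bkH; rw [if_neg (by omega), show 2 + k - k = 2 by omega, lk_two hk2, add_comm 2 k])
      (by rw [add_comm 2 k]) hA2 hlog
      (by
        intro l hl _
        interval_cases l
        · exact ⟨_, by simp, rep0⟩
        · exact ⟨_, by simp, rep1⟩) h
    clear h hlog s0 s1 s2 s3 g0a g0b g1a g1b g2a g2b
  · intro a d N l ha ha9 hd1 hd hN hl hg
    rw [bkL_eq R ha (lk_pos hk2 l)]
    have main : ∀ v, bkRep p Q B v (- Real.log (lucasK k l)) (2 ^ 60) →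
        (((Q * ((8 * B - 2 * l3) + 2 * C + lav l2 l3 l5 l7 a)) % B) + (B - T) + v) % B ≤ B - 2 * T →
        (2:ℝ) ^ e / 2 ≤ 2 ^ p * |(Real.log a - Real.log 9 - (2:ℕ) * Real.log (bkc k α)) + (- Real.log (lucasK k l)) + d * Real.log 10 - N * Real.log α| := by
      intro v hv ht
      exact bk_lower H (bkRep_add (bk_rep0 P K hl3' 2 (by norm_num) ha ha9) hv) (by norm_num) ht hd (by omega)
    rcases Nat.lt_or_ge l 2 with hl2 | hl2
    · interval_cases l
      · exact main _ rep0 (hf2 _ a ha ha9 hv0)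
      · rcases tsth_spec ht2 with h1 | ⟨h1, h2, h3⟩
        · exact main _ rep1 (hf2 0 a ha ha9 h1)
        · rcases Nat.lt_or_ge a 9 with ha8 | ha8
          · exact main _ rep1 (hf2h 0 a ha (by omega) h2)
          · obtain rfl : a = 9 := by omega
            obtain ⟨rfl, hxQ, hcop⟩ := hh h1
            rw [bkR_c_two R, lk_one]
            have := bk_lowerh H (θ := 0) (w := 0) (N := N) hcop hxQ (by simpa using h3) (by norm_num) hd1 hd (by omega)
            simpa using this
    · obtain ⟨Z, hZ, hZZ, -⟩ := sound l hl2 (by omega) hg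
      have hv := bkZ_rep (Q := Q) P.hB (by omega) hZZ
      rcases tsth_spec hZ with h1 | ⟨h1, h2, h3⟩
      · exact main _ hv (hf2 _ a ha ha9 h1)
      · rcases Nat.lt_or_ge a 9 with ha8 | ha8
        · exact main _ hv (hf2h _ a ha (by omega) h2)
        · obtain rfl : a = 9 := by omega
          obtain ⟨rfl, hxQ, hcop⟩ := hh h1
          have hC := P.hC
          rw [bkR_c_two R, Real.log_one, mul_zero, add_zero] at hC
          unfold bkZ at hZZ
          have hw : |(Z:ℝ) - (C + 4 * B)| ≤ (((Z - (C + 4 * B)) + ((C + 4 * B) - Z) : ℕ):ℝ) := by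
            rcases le_total Z (C + 4 * B) with h | h
            · have hr : (Z:ℝ) ≤ C + 4 * B := by exact_mod_cast h
              rw [abs_of_nonpos (by linarith), Nat.sub_eq_zero_of_le h, zero_add, Nat.cast_sub h]; push_cast; linarith
            · have hr : (C:ℝ) + 4 * B ≤ Z := by exact_mod_cast h
              rw [abs_of_nonneg (by linarith), Nat.sub_eq_zero_of_le h, add_zero, Nat.cast_sub h]; push_cast; linarith
          have hθ : |2 ^ p * ((l:ℝ) * Real.log α - Real.log (lucasK 2 l))| ≤ (((Z - (C + 4 * B)) + ((C + 4 * B) - Z) : ℕ):ℝ) + 2 ^ 62 := by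
            refine le_trans ?_ (add_le_add_left hw _)
            have e1 : 2 ^ p * ((l:ℝ) * Real.log α - Real.log (lucasK 2 l)) = ((Z:ℝ) - (C + 4 * B)) + C -
              ((Z:ℝ) - (4 * B + 2 ^ p * (l * Real.log α - Real.log (lucasK 2 l)))) := by ring
            rw [e1]
            refine (abs_sub _ _).trans ?_
            have := abs_add_le ((Z:ℝ) - (C + 4 * B)) C
            linarith only [this, hC, hZZ, (by norm_num : (2:ℝ)^24+2^59 ≤ 2^62)]
          have := bk_lowerh H (N := N + l) hcop hxQ h3 hθ hd1 hd hN
          rw [bkR_c_two R]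
          push_cast at this ⊢
          rw [Real.log_one]
          have e2 : Real.log 9 - Real.log 9 - 2 * 0 + -Real.log (lucasK 2 l) + d * Real.log 10 - N * Real.log α
            = l * Real.log α - Real.log (lucasK 2 l) + d * Real.log 10 - (N + l) * Real.log α := by ring
          rw [e2]
          exact this
  · intro a d N l m ha ha9 hd1 hd hN hlm hm2 hm hmf hgl hgm
    rw [bkL_eq R ha (Nat.mul_pos (lk_pos hk2 l) (lk_pos hk2 m))]
    obtain ⟨Z, hZ, hZZ, hpr⟩ := sound m hm2 (by omega) hgm
    obtain ⟨w, hw, hf⟩ := hpr (by omega) l hlm hgl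
    have hv := bkZ_rep (Q := Q) P.hB (by omega) hZZ
    have ht := hf1 _ a ha ha9 hf
    have hL1 : (0:ℝ) < lucasK k l := by exact_mod_cast lk_pos hk2 l
    have hL2 : (0:ℝ) < lucasK k m := by exact_mod_cast lk_pos hk2 m
    have hb := bk_rep0 (Q := Q) (a := a) P K hl3' 1 (by norm_num) ha ha9
    rw [one_mul] at hb
    have := bk_lower H (d := d) (N := N) (bkRep_add hb (bkRep_add hw hv)) (by norm_num) ht hd hN
    push_cast
    rw [Real.log_mul hL1.ne' hL2.ne', neg_add]
    push_cast at this
    exact this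

theorem hmk_spec {Q B s L10 xb k : ℕ} (h : hmk Q B s L10 xb k = true) :
    k = 2 ∧ 2 ^ xb < Q ∧ Nat.Coprime (if 2 * s ≤ B then Q * L10 / B else Q * L10 / B + 1) Q := by
  unfold hmk at h
  obtain ⟨h1, h⟩ := bcd_and h
  obtain ⟨h2, h⟩ := bcd_and h
  have h2' : Nat.succ (1 <<< xb) ≤ Q := ble_iff h2
  rw [Nat.one_shiftLeft] at h2'
  refine ⟨Nat.eq_of_beq_eq_true h1, h2', ?_⟩
  rcases bcd_or h with ⟨h3, h4⟩ | ⟨h3, h4⟩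
  · have h3' : 2 * s ≤ B := ble_iff h3
    rw [if_pos h3']
    exact Nat.eq_of_beq_eq_true h4
  · have h3' : ¬ 2 * s ≤ B := by
      intro hc
      have : Nat.ble (Nat.mul 2 s) B = true := Nat.ble_eq.mpr hc
      rw [h3] at this; cases this
    rw [if_neg h3']
    exact Nat.eq_of_beq_eq_true h4

theorem chk1_sound {p k xb g mf nl l2 l3 l5 l7 : ℕ} {α : ℝ} (R : bkR k α) (hk : k ≤ 650)
    (hp : p ≤ 10000) (hp2 : 100 ≤ p) (hnl : nl ≤ 2300) (hxb : 11 ≤ xb) (he : xb + 60 ≤ p - (xb + 2 * g))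
    (K : bkK p l2 l3 l5 l7)
    (h : chk1 p (2 ^ p) xb g l2 l3 l5 l7 mf k nl = true) : bkU p (p - (xb + 2 * g)) xb mf nl k α := by
  unfold chk1 at h
  obtain ⟨x, B, C, num, den, P, h⟩ := chk_approx R hk hp hp2 K h
  simp only [frc_eq] at h
  generalize hQ : eus _ _ _ _ _ _ _ = Q at h
  generalize hs : Nat.mod (Nat.mul Q (Nat.add l2 l5)) B = s at h
  generalize hr : bcd (Nat.ble (Nat.mul 2 s) B) s (Nat.sub B s) = r at h
  have hB0 : 0 < B := by
    rcases Nat.eq_zero_or_pos B with h0 | h0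
    · exfalso
      have hB := P.hB
      have hα := R.hl2
      have hl : 1 - α⁻¹ ≤ Real.log α := Real.one_sub_inv_le_log_of_pos (by linarith)
      have h1 : α⁻¹ ≤ 1 / 1.6 := by
        rw [inv_eq_one_div]; exact one_div_le_one_div_of_le (by norm_num) (by linarith)
      have hU : (2:ℝ) ^ 100 ≤ 2 ^ p := pow_le_pow_right₀ (by norm_num) hp2
      have h2 : (2:ℝ) ^ 100 * (1/4) ≤ 2 ^ p * Real.log α := by
        apply mul_le_mul hU _ (by norm_num) (by positivity)
        norm_num at h1; linarith
      rw [h0] at hB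
      have h3 := (abs_le.mp hB).1
      norm_num at h3 h2
      linarith
    · exact h0
  have hs' : (Q * (l2 + l5)) % B = s := hs
  have hsB : s < B := by rw [← hs']; exact Nat.mod_lt _ hB0
  have hdm := Nat.div_add_mod (Q * (l2 + l5)) B
  rw [hs'] at hdm
  have hdm' : (Q:ℝ) * ((l2 + l5 : ℕ):ℝ) = B * ((Q * (l2 + l5) / B : ℕ):ℝ) + s := by exact_mod_cast hdm.symm
  refine chkT_sound (r := r) (Pn := if 2 * s ≤ B then Q * (l2 + l5) / B else Q * (l2 + l5) / B + 1)
    R hk hp hp2 hnl P K ?_ hmk_spec h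
  intro hT hQ1
  refine ⟨hB0, P.hB, ?_, ?_, ?_, hQ1, hT, he, hxb⟩
  · have e1 : Real.log 10 = Real.log 2 + Real.log 5 := by
      rw [← Real.log_mul (by norm_num) (by norm_num)]; norm_num
    have a := abs_le.mp K.h2
    have b := abs_le.mp K.h5
    change |((l2 + l5 : ℕ):ℝ) - _| ≤ _
    rw [e1, abs_le]; push_cast
    have c : (2:ℝ)^17 + 2^19 ≤ 2^20 := by norm_num
    constructor <;> linarith only [a.1, a.2, b.1, b.2, c]
  · change |(Q:ℝ) * ((l2 + l5 : ℕ):ℝ) - _| ≤ _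
    rw [hdm']
    by_cases h3 : 2 * s ≤ B
    · have : Nat.ble (Nat.mul 2 s) B = true := Nat.ble_eq.mpr h3
      rw [this, bcd_tt] at hr
      rw [if_pos h3, ← hr, abs_of_nonneg] <;> [skip; skip]
      · apply le_of_eq; ring
      · have : (0:ℝ) ≤ s := Nat.cast_nonneg _
        linarith
    · have : Nat.ble (Nat.mul 2 s) B = false := by
        rw [← Bool.not_eq_true]; intro hc; exact h3 (ble_iff hc)
      rw [this, bcd_ff] at hr
      have hr' : B - s = r := hr
      have hsr : (s:ℝ) ≤ B := by exact_mod_cast hsB.le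
      rw [if_neg h3, ← hr', Nat.cast_sub hsB.le, abs_of_nonpos]
      · push_cast; apply le_of_eq; ring
      · push_cast; linarith
  · change (r <<< xb) + Q * (1 <<< (p - (xb + 2 * g))) = _
    rw [Nat.one_shiftLeft, Nat.shiftLeft_eq]

theorem chks_sound {p xb g mf nl : ℕ} (hp : p ≤ 10000) (hp2 : 100 ≤ p) (hnl : nl ≤ 2300) (hxb : 11 ≤ xb)
    (he : xb + 60 ≤ p - (xb + 2 * g)) {k0 cnt : ℕ} (h : chks p xb g mf nl k0 cnt = true)
    {k : ℕ} {α : ℝ} (R : bkR k α) (hk : k ≤ 650) (h1 : k0 ≤ k) (h2 : k < k0 + cnt) :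
    bkU p (p - (xb + 2 * g)) xb mf nl k α := by
  unfold chks at h
  rw [frc_eq] at h
  have hU : Nat.shiftLeft 1 p = 2 ^ p := Nat.one_shiftLeft p
  rw [hU] at h
  obtain ⟨l2, l3, l5, l7, K, h'⟩ := cst_spec hp h
  clear h
  have h := h'
  clear h'
  induction cnt generalizing k0 with
  | zero => omega
  | succ c ih =>
    dsimp only at h
    rw [frc_eq] at h
    obtain ⟨h3, h4⟩ := bcd_and h
    rcases Nat.eq_or_lt_of_le h1 with h5 | h5
    · subst h5
      exact chk1_sound R hk hp hp2 hnl hxb he K h3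
    · exact ih (k0 := k0 + 1) h5 (by omega) h4

theorem bk_pw {α L : ℝ} {e p w j : ℕ} (hα : 0 < α) (hp : p = e + w) (h : (2:ℝ) ^ e / 2 ≤ 2 ^ p * |L|)
    (hL : |L| ≤ 16 * (α ^ j)⁻¹) : α ^ j ≤ 2 ^ (w + 5) := by
  have hj : 0 < α ^ j := pow_pos hα j
  have h1 : (2:ℝ) ^ e / 2 ≤ 2 ^ p * (16 * (α ^ j)⁻¹) := h.trans (mul_le_mul_of_nonneg_left hL (by positivity))
  rw [hp, pow_add] at h1
  have he : (0:ℝ) < 2 ^ e := by positivity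
  have h2 : (1:ℝ) / 2 ≤ 2 ^ w * 16 * (α ^ j)⁻¹ := by
    refine le_of_mul_le_mul_left ?_ he
    calc (2:ℝ) ^ e * (1 / 2) = 2 ^ e / 2 := by ring
      _ ≤ _ := h1
      _ = _ := by ring
  rw [← div_eq_mul_inv, le_div_iff₀ hj] at h2
  rw [pow_add]; norm_num; linarith

theorem bk_jb {α c : ℝ} {j w u v : ℕ} (hc : 0 ≤ c) (h1 : c ≤ α) (h2 : (2:ℝ) ^ u ≤ c ^ v) (h : α ^ j ≤ 2 ^ w) : u * j ≤ v * w := by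
  have h3 : ((2:ℝ) ^ u) ^ j ≤ (2 ^ w) ^ v := by
    calc ((2:ℝ) ^ u) ^ j ≤ (α ^ v) ^ j := by
            gcongr; exact h2.trans (pow_le_pow_left₀ hc h1 v)
      _ = (α ^ j) ^ v := by rw [← pow_mul, ← pow_mul, mul_comm]
      _ ≤ _ := pow_le_pow_left₀ (pow_nonneg (hc.trans h1) _) h v
  rw [← pow_mul, ← pow_mul, mul_comm w v] at h3
  exact (pow_le_pow_iff_right₀ (by norm_num : (1:ℝ) < 2)).mp h3

theorem bk_j2 {k : ℕ} {α : ℝ} {j w : ℕ} (R : bkR k α) (h : α ^ j ≤ 2 ^ w) : 11 * j ≤ 16 * w :=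
  bk_jb (by norm_num) R.hl2 (by norm_num) h

theorem bk_j3 {k : ℕ} {α : ℝ} {j w : ℕ} (R : bkR k α) (hk : 3 ≤ k) (h : α ^ j ≤ 2 ^ w) : 7 * j ≤ 8 * w :=
  bk_jb (by norm_num) (R.hl3 hk) (by norm_num) h

theorem bk_j4 {k : ℕ} {α : ℝ} {j w : ℕ} (R : bkR k α) (hk : 4 ≤ k) (h : α ^ j ≤ 2 ^ w) : 12 * j ≤ 13 * w :=
  bk_jb (by norm_num) (R.hl4 hk) (by norm_num) h

theorem bkS_G {k n m l d a : ℕ} (S : bkS k n m l d a) : bkG k l ∧ bkG k m := by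
  obtain ⟨h1, h2⟩ := bkS_nd S
  exact ⟨⟨fun h => h1 (h.mul_left _), fun h => h2 (h.mul_left _)⟩, ⟨fun h => h1 (h.mul_right _), fun h => h2 (h.mul_right _)⟩⟩

theorem bk_lev1 {k n m l d a p e xb mf nl w jb : ℕ} {α : ℝ} (S : bkS k n m l d a) (R : bkR k α) (U : bkU p e xb mf nl k α)
    (hp : p = e + w) (hD : 3 * n ≤ 2 ^ xb) (hj : ∀ j : ℕ, α ^ j ≤ 2 ^ (w + 5) → j ≤ jb) (h9 : 9 ≤ jb) : l ≤ jb := by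
  by_cases hl : l < 10
  · omega
  have hd := bkS_d S
  have := S.hnm; have := S.hml
  have h0 : 0 < α := by linarith [R.h1]
  exact hj l (bk_pw h0 hp (U.f1 a d (n + m + l) S.ha S.ha9 S.hd (by omega) (by omega)) (bkS_form1 S R (by omega)).1)

theorem bk_lev2 {k n m l d a p e xb mf nl w jb : ℕ} {α : ℝ} (S : bkS k n m l d a) (R : bkR k α) (U : bkU p e xb mf nl k α)
    (hp : p = e + w) (hD : 3 * n ≤ 2 ^ xb) (hj : ∀ j : ℕ, α ^ j ≤ 2 ^ (w + 5) → j ≤ jb) (h9 : 9 ≤ jb)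
    (hnl : jb ≤ nl) : m ≤ jb := by
  have hl := bk_lev1 S R U hp hD hj h9
  by_cases hm : m < 10
  · omega
  have hd := bkS_d S
  have := S.hnm; have := S.hml
  have h0 : 0 < α := by linarith [R.h1]
  exact hj m (bk_pw h0 hp (U.f2 (by omega) a d (n + m) l S.ha S.ha9 S.hd (by omega) (by omega) (by omega) (bkS_G S).1)
    (bkS_form2 S R (by omega)).1)

theorem bk_lev3 {k n m l d a p e xb mf nl w jb : ℕ} {α : ℝ} (S : bkS k n m l d a) (R : bkR k α) (U : bkU p e xb mf nl k α)
    (hp : p = e + w) (hD : 3 * n ≤ 2 ^ xb) (hj : ∀ j : ℕ, α ^ j ≤ 2 ^ (w + 5) → j ≤ jb) (h9 : 9 ≤ jb)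
    (hnl : jb ≤ nl) (hm300 : 300 < m) (hmf : nl + 2 ≤ 301 + mf) : n ≤ jb := by
  have hl := bk_lev2 S R U hp hD hj h9 hnl
  have hd := bkS_d S
  have := S.hnm; have := S.hml
  have h0 : 0 < α := by linarith [R.h1]
  exact hj n (bk_pw h0 hp (U.f3 (by omega) a d n l m S.ha S.ha9 S.hd (by omega) (by omega) S.hml (by omega) (by omega)
    (by omega) (bkS_G S).1 (bkS_G S).2) (bkS_form3 S R).1)

theorem bk_3n {n ℓ x : ℕ} (h : n < 2 ^ ℓ) (hx : x = ℓ + 2) : 3 * n ≤ 2 ^ x := by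
  rw [hx, pow_add]; generalize 2 ^ ℓ = t at h; omega


theorem bkUA {k : ℕ} {α : ℝ} (R : bkR k α) (h1 : 2 ≤ k) (h2 : k < 651) : bkU 9604 (9604 - (4748 + 2 * 24)) 4748 0 0 k α := by
  rcases Nat.lt_or_ge k 62 with h | h1
  · exact chks_sound (by norm_num) (by norm_num) (by norm_num) (by norm_num) (by norm_num) ckA_2 R (by omega) h1 h
  rcases Nat.lt_or_ge k 122 with h | h1
  · exact chks_sound (by norm_num) (by norm_num) (by norm_num) (by norm_num) (by norm_num) ckA_62 R (by omega) h1 h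
  rcases Nat.lt_or_ge k 182 with h | h1
  · exact chks_sound (by norm_num) (by norm_num) (by norm_num) (by norm_num) (by norm_num) ckA_122 R (by omega) h1 h
  rcases Nat.lt_or_ge k 242 with h | h1
  · exact chks_sound (by norm_num) (by norm_num) (by norm_num) (by norm_num) (by norm_num) ckA_182 R (by omega) h1 h
  rcases Nat.lt_or_ge k 302 with h | h1
  · exact chks_sound (by norm_num) (by norm_num) (by norm_num) (by norm_num) (by norm_num) ckA_242 R (by omega) h1 h
  rcases Nat.lt_or_ge k 362 with h | h1
  · exact chks_sound (by norm_num) (by norm_num) (by norm_num) (by norm_num) (by norm_num) ckA_302 R (by omega) h1 h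
  rcases Nat.lt_or_ge k 422 with h | h1
  · exact chks_sound (by norm_num) (by norm_num) (by norm_num) (by norm_num) (by norm_num) ckA_362 R (by omega) h1 h
  rcases Nat.lt_or_ge k 482 with h | h1
  · exact chks_sound (by norm_num) (by norm_num) (by norm_num) (by norm_num) (by norm_num) ckA_422 R (by omega) h1 h
  rcases Nat.lt_or_ge k 542 with h | h1
  · exact chks_sound (by norm_num) (by norm_num) (by norm_num) (by norm_num) (by norm_num) ckA_482 R (by omega) h1 h
  rcases Nat.lt_or_ge k 602 with h | h1
  · exact chks_sound (by norm_num) (by norm_num) (by norm_num) (by norm_num) (by norm_num) ckA_542 R (by omega) h1 h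
  exact chks_sound (by norm_num) (by norm_num) (by norm_num) (by norm_num) (by norm_num) ckA_602 R (by omega) h1 h2

theorem bkUB2 {k : ℕ} {α : ℝ} (R : bkR k α) (h1 : 2 ≤ k) (h2 : k < 3) : bkU 3128 (3128 - (1506 + 2 * 28)) 1506 0 2280 k α := by
  exact chks_sound (by norm_num) (by norm_num) (by norm_num) (by norm_num) (by norm_num) ckB2_2 R (by omega) h1 h2

theorem bkUB3 {k : ℕ} {α : ℝ} (R : bkR k α) (h1 : 3 ≤ k) (h2 : k < 4) : bkU 3128 (3128 - (1506 + 2 * 28)) 1506 0 1790 k α := by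
  exact chks_sound (by norm_num) (by norm_num) (by norm_num) (by norm_num) (by norm_num) ckB3_3 R (by omega) h1 h2

theorem bkUB {k : ℕ} {α : ℝ} (R : bkR k α) (h1 : 4 ≤ k) (h2 : k < 651) : bkU 3128 (3128 - (1506 + 2 * 28)) 1506 0 1697 k α := by
  rcases Nat.lt_or_ge k 28 with h | h1
  · exact chks_sound (by norm_num) (by norm_num) (by norm_num) (by norm_num) (by norm_num) ckB_4 R (by omega) h1 h
  rcases Nat.lt_or_ge k 52 with h | h1
  · exact chks_sound (by norm_num) (by norm_num) (by norm_num) (by norm_num) (by norm_num) ckB_28 R (by omega) h1 h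
  rcases Nat.lt_or_ge k 76 with h | h1
  · exact chks_sound (by norm_num) (by norm_num) (by norm_num) (by norm_num) (by norm_num) ckB_52 R (by omega) h1 h
  rcases Nat.lt_or_ge k 100 with h | h1
  · exact chks_sound (by norm_num) (by norm_num) (by norm_num) (by norm_num) (by norm_num) ckB_76 R (by omega) h1 h
  rcases Nat.lt_or_ge k 124 with h | h1
  · exact chks_sound (by norm_num) (by norm_num) (by norm_num) (by norm_num) (by norm_num) ckB_100 R (by omega) h1 h
  rcases Nat.lt_or_ge k 148 with h | h1
  · exact chks_sound (by norm_num) (by norm_num) (by norm_num) (by norm_num) (by norm_num) ckB_124 R (by omega) h1 h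
  rcases Nat.lt_or_ge k 172 with h | h1
  · exact chks_sound (by norm_num) (by norm_num) (by norm_num) (by norm_num) (by norm_num) ckB_148 R (by omega) h1 h
  rcases Nat.lt_or_ge k 196 with h | h1
  · exact chks_sound (by norm_num) (by norm_num) (by norm_num) (by norm_num) (by norm_num) ckB_172 R (by omega) h1 h
  rcases Nat.lt_or_ge k 220 with h | h1
  · exact chks_sound (by norm_num) (by norm_num) (by norm_num) (by norm_num) (by norm_num) ckB_196 R (by omega) h1 h
  rcases Nat.lt_or_ge k 244 with h | h1
  · exact chks_sound (by norm_num) (by norm_num) (by norm_num) (by norm_num) (by norm_num) ckB_220 R (by omega) h1 h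
  rcases Nat.lt_or_ge k 268 with h | h1
  · exact chks_sound (by norm_num) (by norm_num) (by norm_num) (by norm_num) (by norm_num) ckB_244 R (by omega) h1 h
  rcases Nat.lt_or_ge k 292 with h | h1
  · exact chks_sound (by norm_num) (by norm_num) (by norm_num) (by norm_num) (by norm_num) ckB_268 R (by omega) h1 h
  rcases Nat.lt_or_ge k 316 with h | h1
  · exact chks_sound (by norm_num) (by norm_num) (by norm_num) (by norm_num) (by norm_num) ckB_292 R (by omega) h1 h
  rcases Nat.lt_or_ge k 340 with h | h1
  · exact chks_sound (by norm_num) (by norm_num) (by norm_num) (by norm_num) (by norm_num) ckB_316 R (by omega) h1 h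
  rcases Nat.lt_or_ge k 364 with h | h1
  · exact chks_sound (by norm_num) (by norm_num) (by norm_num) (by norm_num) (by norm_num) ckB_340 R (by omega) h1 h
  rcases Nat.lt_or_ge k 388 with h | h1
  · exact chks_sound (by norm_num) (by norm_num) (by norm_num) (by norm_num) (by norm_num) ckB_364 R (by omega) h1 h
  rcases Nat.lt_or_ge k 412 with h | h1
  · exact chks_sound (by norm_num) (by norm_num) (by norm_num) (by norm_num) (by norm_num) ckB_388 R (by omega) h1 h
  rcases Nat.lt_or_ge k 436 with h | h1
  · exact chks_sound (by norm_num) (by norm_num) (by norm_num) (by norm_num) (by norm_num) ckB_412 R (by omega) h1 h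
  rcases Nat.lt_or_ge k 460 with h | h1
  · exact chks_sound (by norm_num) (by norm_num) (by norm_num) (by norm_num) (by norm_num) ckB_436 R (by omega) h1 h
  rcases Nat.lt_or_ge k 484 with h | h1
  · exact chks_sound (by norm_num) (by norm_num) (by norm_num) (by norm_num) (by norm_num) ckB_460 R (by omega) h1 h
  rcases Nat.lt_or_ge k 508 with h | h1
  · exact chks_sound (by norm_num) (by norm_num) (by norm_num) (by norm_num) (by norm_num) ckB_484 R (by omega) h1 h
  rcases Nat.lt_or_ge k 532 with h | h1
  · exact chks_sound (by norm_num) (by norm_num) (by norm_num) (by norm_num) (by norm_num) ckB_508 R (by omega) h1 h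
  rcases Nat.lt_or_ge k 556 with h | h1
  · exact chks_sound (by norm_num) (by norm_num) (by norm_num) (by norm_num) (by norm_num) ckB_532 R (by omega) h1 h
  rcases Nat.lt_or_ge k 580 with h | h1
  · exact chks_sound (by norm_num) (by norm_num) (by norm_num) (by norm_num) (by norm_num) ckB_556 R (by omega) h1 h
  rcases Nat.lt_or_ge k 604 with h | h1
  · exact chks_sound (by norm_num) (by norm_num) (by norm_num) (by norm_num) (by norm_num) ckB_580 R (by omega) h1 h
  rcases Nat.lt_or_ge k 628 with h | h1
  · exact chks_sound (by norm_num) (by norm_num) (by norm_num) (by norm_num) (by norm_num) ckB_604 R (by omega) h1 h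
  exact chks_sound (by norm_num) (by norm_num) (by norm_num) (by norm_num) (by norm_num) ckB_628 R (by omega) h1 h2

theorem bkUC2 {k : ℕ} {α : ℝ} (R : bkR k α) (h1 : 2 ≤ k) (h2 : k < 3) : bkU 678 (678 - (285 + 2 * 24)) 285 0 491 k α := by
  exact chks_sound (by norm_num) (by norm_num) (by norm_num) (by norm_num) (by norm_num) ckC2_2 R (by omega) h1 h2

theorem bkUC3 {k : ℕ} {α : ℝ} (R : bkR k α) (h1 : 3 ≤ k) (h2 : k < 4) : bkU 678 (678 - (285 + 2 * 24)) 285 87 386 k α := by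
  exact chks_sound (by norm_num) (by norm_num) (by norm_num) (by norm_num) (by norm_num) ckC3_3 R (by omega) h1 h2

theorem bkUC4 {k : ℕ} {α : ℝ} (R : bkR k α) (h1 : 4 ≤ k) (h2 : k < 17) : bkU 678 (678 - (285 + 2 * 24)) 285 67 366 k α := by
  rcases Nat.lt_or_ge k 5 with h | h1
  · exact chks_sound (by norm_num) (by norm_num) (by norm_num) (by norm_num) (by norm_num) ckC4_4 R (by omega) h1 h
  rcases Nat.lt_or_ge k 6 with h | h1
  · exact chks_sound (by norm_num) (by norm_num) (by norm_num) (by norm_num) (by norm_num) ckC4_5 R (by omega) h1 h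
  rcases Nat.lt_or_ge k 7 with h | h1
  · exact chks_sound (by norm_num) (by norm_num) (by norm_num) (by norm_num) (by norm_num) ckC4_6 R (by omega) h1 h
  rcases Nat.lt_or_ge k 8 with h | h1
  · exact chks_sound (by norm_num) (by norm_num) (by norm_num) (by norm_num) (by norm_num) ckC4_7 R (by omega) h1 h
  rcases Nat.lt_or_ge k 9 with h | h1
  · exact chks_sound (by norm_num) (by norm_num) (by norm_num) (by norm_num) (by norm_num) ckC4_8 R (by omega) h1 h
  rcases Nat.lt_or_ge k 10 with h | h1
  · exact chks_sound (by norm_num) (by norm_num) (by norm_num) (by norm_num) (by norm_num) ckC4_9 R (by omega) h1 h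
  rcases Nat.lt_or_ge k 11 with h | h1
  · exact chks_sound (by norm_num) (by norm_num) (by norm_num) (by norm_num) (by norm_num) ckC4_10 R (by omega) h1 h
  rcases Nat.lt_or_ge k 12 with h | h1
  · exact chks_sound (by norm_num) (by norm_num) (by norm_num) (by norm_num) (by norm_num) ckC4_11 R (by omega) h1 h
  rcases Nat.lt_or_ge k 13 with h | h1
  · exact chks_sound (by norm_num) (by norm_num) (by norm_num) (by norm_num) (by norm_num) ckC4_12 R (by omega) h1 h
  rcases Nat.lt_or_ge k 14 with h | h1
  · exact chks_sound (by norm_num) (by norm_num) (by norm_num) (by norm_num) (by norm_num) ckC4_13 R (by omega) h1 h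
  rcases Nat.lt_or_ge k 15 with h | h1
  · exact chks_sound (by norm_num) (by norm_num) (by norm_num) (by norm_num) (by norm_num) ckC4_14 R (by omega) h1 h
  rcases Nat.lt_or_ge k 16 with h | h1
  · exact chks_sound (by norm_num) (by norm_num) (by norm_num) (by norm_num) (by norm_num) ckC4_15 R (by omega) h1 h
  exact chks_sound (by norm_num) (by norm_num) (by norm_num) (by norm_num) (by norm_num) ckC4_16 R (by omega) h1 h2

theorem bkUC {k : ℕ} {α : ℝ} (R : bkR k α) (h1 : 17 ≤ k) (h2 : k < 651) : bkU 850 (850 - (371 + 2 * 24)) 371 160 459 k α := by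
  rcases Nat.lt_or_ge k 57 with h | h1
  · exact chks_sound (by norm_num) (by norm_num) (by norm_num) (by norm_num) (by norm_num) ckC_17 R (by omega) h1 h
  rcases Nat.lt_or_ge k 97 with h | h1
  · exact chks_sound (by norm_num) (by norm_num) (by norm_num) (by norm_num) (by norm_num) ckC_57 R (by omega) h1 h
  rcases Nat.lt_or_ge k 137 with h | h1
  · exact chks_sound (by norm_num) (by norm_num) (by norm_num) (by norm_num) (by norm_num) ckC_97 R (by omega) h1 h
  rcases Nat.lt_or_ge k 177 with h | h1
  · exact chks_sound (by norm_num) (by norm_num) (by norm_num) (by norm_num) (by norm_num) ckC_137 R (by omega) h1 h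
  rcases Nat.lt_or_ge k 217 with h | h1
  · exact chks_sound (by norm_num) (by norm_num) (by norm_num) (by norm_num) (by norm_num) ckC_177 R (by omega) h1 h
  rcases Nat.lt_or_ge k 257 with h | h1
  · exact chks_sound (by norm_num) (by norm_num) (by norm_num) (by norm_num) (by norm_num) ckC_217 R (by omega) h1 h
  rcases Nat.lt_or_ge k 297 with h | h1
  · exact chks_sound (by norm_num) (by norm_num) (by norm_num) (by norm_num) (by norm_num) ckC_257 R (by omega) h1 h
  rcases Nat.lt_or_ge k 337 with h | h1
  · exact chks_sound (by norm_num) (by norm_num) (by norm_num) (by norm_num) (by norm_num) ckC_297 R (by omega) h1 h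
  rcases Nat.lt_or_ge k 377 with h | h1
  · exact chks_sound (by norm_num) (by norm_num) (by norm_num) (by norm_num) (by norm_num) ckC_337 R (by omega) h1 h
  rcases Nat.lt_or_ge k 417 with h | h1
  · exact chks_sound (by norm_num) (by norm_num) (by norm_num) (by norm_num) (by norm_num) ckC_377 R (by omega) h1 h
  rcases Nat.lt_or_ge k 457 with h | h1
  · exact chks_sound (by norm_num) (by norm_num) (by norm_num) (by norm_num) (by norm_num) ckC_417 R (by omega) h1 h
  rcases Nat.lt_or_ge k 497 with h | h1
  · exact chks_sound (by norm_num) (by norm_num) (by norm_num) (by norm_num) (by norm_num) ckC_457 R (by omega) h1 h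
  rcases Nat.lt_or_ge k 537 with h | h1
  · exact chks_sound (by norm_num) (by norm_num) (by norm_num) (by norm_num) (by norm_num) ckC_497 R (by omega) h1 h
  rcases Nat.lt_or_ge k 577 with h | h1
  · exact chks_sound (by norm_num) (by norm_num) (by norm_num) (by norm_num) (by norm_num) ckC_537 R (by omega) h1 h
  rcases Nat.lt_or_ge k 617 with h | h1
  · exact chks_sound (by norm_num) (by norm_num) (by norm_num) (by norm_num) (by norm_num) ckC_577 R (by omega) h1 h
  exact chks_sound (by norm_num) (by norm_num) (by norm_num) (by norm_num) (by norm_num) ckC_617 R (by omega) h1 h2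

theorem bkUD {k : ℕ} {α : ℝ} (R : bkR k α) (h1 : 3 ≤ k) (h2 : k < 651) : bkU 700 (700 - (11 + 2 * 24)) 11 0 75 k α := by
  rcases Nat.lt_or_ge k 63 with h | h1
  · exact chks_sound (by norm_num) (by norm_num) (by norm_num) (by norm_num) (by norm_num) ckD_3 R (by omega) h1 h
  rcases Nat.lt_or_ge k 123 with h | h1
  · exact chks_sound (by norm_num) (by norm_num) (by norm_num) (by norm_num) (by norm_num) ckD_63 R (by omega) h1 h
  rcases Nat.lt_or_ge k 183 with h | h1
  · exact chks_sound (by norm_num) (by norm_num) (by norm_num) (by norm_num) (by norm_num) ckD_123 R (by omega) h1 h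
  rcases Nat.lt_or_ge k 243 with h | h1
  · exact chks_sound (by norm_num) (by norm_num) (by norm_num) (by norm_num) (by norm_num) ckD_183 R (by omega) h1 h
  rcases Nat.lt_or_ge k 303 with h | h1
  · exact chks_sound (by norm_num) (by norm_num) (by norm_num) (by norm_num) (by norm_num) ckD_243 R (by omega) h1 h
  rcases Nat.lt_or_ge k 363 with h | h1
  · exact chks_sound (by norm_num) (by norm_num) (by norm_num) (by norm_num) (by norm_num) ckD_303 R (by omega) h1 h
  rcases Nat.lt_or_ge k 423 with h | h1
  · exact chks_sound (by norm_num) (by norm_num) (by norm_num) (by norm_num) (by norm_num) ckD_363 R (by omega) h1 h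
  rcases Nat.lt_or_ge k 483 with h | h1
  · exact chks_sound (by norm_num) (by norm_num) (by norm_num) (by norm_num) (by norm_num) ckD_423 R (by omega) h1 h
  rcases Nat.lt_or_ge k 543 with h | h1
  · exact chks_sound (by norm_num) (by norm_num) (by norm_num) (by norm_num) (by norm_num) ckD_483 R (by omega) h1 h
  rcases Nat.lt_or_ge k 603 with h | h1
  · exact chks_sound (by norm_num) (by norm_num) (by norm_num) (by norm_num) (by norm_num) ckD_543 R (by omega) h1 h
  exact chks_sound (by norm_num) (by norm_num) (by norm_num) (by norm_num) (by norm_num) ckD_603 R (by omega) h1 h2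

theorem bk_lA {k n m l d a : ℕ} (S : bkS k n m l d a) : l ≤ 6983 := by
  obtain ⟨α, R⟩ := bkR_exists S.hk
  exact bk_lev1 (w := 4796) S R (bkUA R S.hk (by have := S.hk'; omega)) (by norm_num) (bk_3n (bk_descA S) (by norm_num))
    (fun j hj => by have := bk_j2 R hj; omega) (by norm_num)

theorem bk_mB {k n m l d a : ℕ} (S : bkS k n m l d a) : n < 2 ^ 1504 ∧ m ≤ 2299 := by
  obtain ⟨α, R⟩ := bkR_exists S.hk
  have hk := S.hk
  have hk' := S.hk'
  have hn := bk_descB S (by have := bk_lA S; omega)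
  have hD := bk_3n hn (show 1506 = 1504 + 2 by norm_num)
  refine ⟨hn, ?_⟩
  rcases Nat.lt_or_ge k 3 with h | h
  · have := bk_lev2 (w := 1562) (jb := 2279) S R (bkUB2 R (by omega) (by omega)) (by norm_num) hD
      (fun j hj => by have := bk_j2 R hj; omega) (by norm_num) (by norm_num)
    omega
  rcases Nat.lt_or_ge k 4 with h | h
  · have := bk_lev2 (w := 1562) (jb := 1790) S R (bkUB3 R (by omega) (by omega)) (by norm_num) hD
      (fun j hj => by have := bk_j3 R (by omega) hj; omega) (by norm_num) (by norm_num)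
    omega
  · have := bk_lev2 (w := 1562) (jb := 1697) S R (bkUB R (by omega) (by omega)) (by norm_num) hD
      (fun j hj => by have := bk_j4 R (by omega) hj; omega) (by norm_num) (by norm_num)
    omega

theorem bk_mC2 {k n m l d a : ℕ} (S : bkS k n m l d a) (hk2 : k < 3) : m ≤ 491 := by
  obtain ⟨α, R⟩ := bkR_exists S.hk
  have hk := S.hk
  obtain ⟨hn, hm⟩ := bk_mB S
  have hD := bk_3n (bk_descC16 S (by omega) hn hm) (show 285 = 283 + 2 by norm_num)
  exact bk_lev2 (w := 333) S R (bkUC2 R (by omega) (by omega)) (by norm_num) hD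
      (fun j hj => by have := bk_j2 R hj; omega) (by norm_num) (by norm_num)

theorem bk_mC3 {k n m l d a : ℕ} (S : bkS k n m l d a) (hk3 : 3 ≤ k) (hm300 : 300 < m) : n ≤ 459 := by
  obtain ⟨α, R⟩ := bkR_exists S.hk
  have hk' := S.hk'
  obtain ⟨hn, hm⟩ := bk_mB S
  rcases Nat.lt_or_ge k 17 with h | h
  · have hD := bk_3n (bk_descC16 S (by omega) hn hm) (show 285 = 283 + 2 by norm_num)
    rcases Nat.lt_or_ge k 4 with h | h
    · have := bk_lev3 (w := 333) (jb := 386) S R (bkUC3 R (by omega) (by omega)) (by norm_num) hD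
        (fun j hj => by have := bk_j3 R (by omega) hj; omega) (by norm_num) (by norm_num) hm300 (by norm_num)
      omega
    · have := bk_lev3 (w := 333) (jb := 366) S R (bkUC4 R (by omega) (by omega)) (by norm_num) hD
        (fun j hj => by have := bk_j4 R (by omega) hj; omega) (by norm_num) (by norm_num) hm300 (by norm_num)
      omega
  · have hD := bk_3n (bk_descC650 S (by omega) hn hm) (show 371 = 369 + 2 by norm_num)
    exact bk_lev3 (w := 419) S R (bkUC R (by omega) (by omega)) (by norm_num) hD
        (fun j hj => by have := bk_j4 R (by omega) hj; omega) (by norm_num) (by norm_num) hm300 (by norm_num)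

theorem bk_mD {k n m l d a : ℕ} (S : bkS k n m l d a) (hk3 : 3 ≤ k) : m ≤ 300 := by
  by_contra hc
  obtain ⟨α, R⟩ := bkR_exists S.hk
  have hk' := S.hk'
  have hn := bk_mC3 S hk3 (by omega)
  have := bk_lev2 (w := 59) (jb := 73) S R (bkUD R (by omega) (by omega)) (by norm_num) (by norm_num; omega)
      (fun j hj => by have := bk_j3 R (by omega) hj; omega) (by norm_num) (by norm_num)
  omega

theorem m_bound_for_small_k
    (k n m l d a : ℕ) (hk : 2 ≤ k) (hk' : k ≤ 650) (hnm : m ≤ n) (hml : l ≤ m)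
    (hnk : k + 1 ≤ n) (hn : 25 < n)
    (hd : 2 ≤ d) (ha1 : 1 ≤ a) (ha9 : a ≤ 9)
    (heq : lucasK k n * lucasK k m * lucasK k l = a * ((10 ^ d - 1) / 9)) :
    m ≤ 606 ∧ (3 ≤ k → m ≤ 300) := by
  have S : bkS k n m l d a := bkS_of hk hk' hnm hml hn hd ha1 ha9 heq
  refine ⟨?_, bk_mD S⟩
  rcases Nat.lt_or_ge k 3 with h | h
  · have := bk_mC2 S h
    omega
  · have := bk_mD S h
    omega
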